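/- arXiv:1406.3850 — 3 statements merged into one kernel-verified Lean document; each statement's English description precedes it below -/
import Mathlib

section
/- Let N ≥ 2 and 1 < p < (N+2)/2. There exists a constant c = c(N,p) > 0 such that for every compact set K ⊂ closure(Q̃_{100}(0,0)) one has Cap_{2,1,p}(K) ≥ c |K|^{1 − 2p/(N+2)}, where |K| is the Lebesgue measure of K in ℝ^{N+1}. -/
open MeasureTheory Metric Set
open scoped ENNReal NNReal

noncomputable section

/-- Points of `ℝ^{N+1}` are written `(x, t)` with `x ∈ ℝ^N` and `t ∈ ℝ`. -/
abbrev PSpace (N : ℕ) := EuclideanSpace ℝ (Fin N) × ℝ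

/-- The parabolic cylinder `Q_δ(x,t) = B_δ(x) × (t - δ², t]`. -/
def pQ (N : ℕ) (δ : ℝ) (z : PSpace N) : Set (PSpace N) :=
  ball z.1 δ ×ˢ Ioc (z.2 - δ ^ 2) z.2

/-- The parabolic cylinder `Q̃_r(x,t) = B_r(x) × (t - r², t + r²)`. -/
def pQt (N : ℕ) (r : ℝ) (z : PSpace N) : Set (PSpace N) :=
  ball z.1 r ×ˢ Ioo (z.2 - r ^ 2) (z.2 + r ^ 2)

/-- The parabolic boundary of an open set `O ⊆ ℝ^{N+1}`: points of the topological
boundary such that every downward cylinder `Q_δ` meets the complement of `O`. -/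
def pBoundary (N : ℕ) (O : Set (PSpace N)) : Set (PSpace N) :=
  {z ∈ frontier O | ∀ δ > 0, (pQ N δ z ∩ Oᶜ).Nonempty}

/-- Partial derivative in time. -/
def tDeriv {N : ℕ} (u : PSpace N → ℝ) (z : PSpace N) : ℝ :=
  deriv (fun s => u (z.1, s)) z.2

/-- Partial derivative in the `i`-th spatial direction. -/
def xDeriv {N : ℕ} (i : Fin N) (u : PSpace N → ℝ) (z : PSpace N) : ℝ :=
  lineDeriv ℝ (fun y => u (y, z.2)) z.1 (EuclideanSpace.single i 1)

/-- Second spatial partial derivative. -/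
def xxDeriv {N : ℕ} (i j : Fin N) (u : PSpace N → ℝ) (z : PSpace N) : ℝ :=
  xDeriv i (xDeriv j u) z

/-- Spatial Laplacian. -/
def lapl {N : ℕ} (u : PSpace N → ℝ) (z : PSpace N) : ℝ :=
  ∑ i : Fin N, xxDeriv i i u z

/-- Euclidean norm of the spatial gradient. -/
def gradNorm {N : ℕ} (u : PSpace N → ℝ) (z : PSpace N) : ℝ :=
  Real.sqrt (∑ i : Fin N, (xDeriv i u z) ^ 2)

/-- `u ∈ C^{2,1}(O)` : `u`, its first and second spatial derivatives and its time
derivative exist and are continuous in `O`. -/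
structure IsC21 {N : ℕ} (O : Set (PSpace N)) (u : PSpace N → ℝ) : Prop where
  cont : ContinuousOn u O
  diff_t : ∀ z ∈ O, DifferentiableAt ℝ (fun s => u (z.1, s)) z.2
  cont_t : ContinuousOn (tDeriv u) O
  diff_x : ∀ (i : Fin N), ∀ z ∈ O,
    LineDifferentiableAt ℝ (fun y => u (y, z.2)) z.1 (EuclideanSpace.single i 1)
  cont_x : ∀ i : Fin N, ContinuousOn (xDeriv i u) O
  diff_xx : ∀ (i j : Fin N), ∀ z ∈ O,
    LineDifferentiableAt ℝ (fun y => xDeriv j u (y, z.2)) z.1 (EuclideanSpace.single i 1)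
  cont_xx : ∀ i j : Fin N, ContinuousOn (xxDeriv i j u) O

/-- The blow-up condition `lim_{δ→0} inf_{O ∩ Q_δ(z)} u = ∞` at every point of the
parabolic boundary. -/
def BlowsUp {N : ℕ} (O : Set (PSpace N)) (u : PSpace N → ℝ) : Prop :=
  ∀ z ∈ pBoundary N O, ∀ M : ℝ, ∃ δ > (0 : ℝ), ∀ w ∈ O ∩ pQ N δ z, M ≤ u w

/-- A large solution of `∂_t u - Δu + f(u) = 0` in `O`. -/
def IsLargeSolution {N : ℕ} (O : Set (PSpace N)) (f : ℝ → ℝ) (u : PSpace N → ℝ) : Prop :=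
  IsC21 O u ∧ (∀ z ∈ O, tDeriv u z - lapl u z + f (u z) = 0) ∧ BlowsUp O u

/-- The parabolic Sobolev norm `‖φ‖_{W^{2,1}_p(ℝ^{N+1})}`. -/
def W21Norm (N : ℕ) (p : ℝ) (φ : PSpace N → ℝ) : ℝ :=
  (eLpNorm φ (ENNReal.ofReal p) volume).toReal
    + (eLpNorm (tDeriv φ) (ENNReal.ofReal p) volume).toReal
    + (eLpNorm (gradNorm φ) (ENNReal.ofReal p) volume).toReal
    + ∑ i : Fin N, ∑ j : Fin N, (eLpNorm (xxDeriv i j φ) (ENNReal.ofReal p) volume).toReal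

/-- The capacity `Cap_{2,1,p}` of a compact set `K ⊆ ℝ^{N+1}`. -/
def cap21c (N : ℕ) (p : ℝ) (K : Set (PSpace N)) : ℝ :=
  sInf { c | ∃ φ : SchwartzMap (PSpace N) ℝ,
    (∃ U, IsOpen U ∧ K ⊆ U ∧ ∀ z ∈ U, 1 ≤ φ z) ∧ c = W21Norm N p (fun z => φ z) ^ p }

/-- The capacity `Cap_{2,1,p}` of an arbitrary (Suslin) set. -/
def cap21 (N : ℕ) (p : ℝ) (E : Set (PSpace N)) : ℝ :=
  sSup { c | ∃ D, D ⊆ E ∧ IsCompact D ∧ c = cap21c N p D }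

/-- The parabolic Hausdorff capacity `PH_ρ^N(E)`. -/
def PHcap (N : ℕ) (ρ : ℝ) (E : Set (PSpace N)) : ℝ≥0∞ :=
  ⨅ (c : ℕ → PSpace N × ℝ)
    (_ : (∀ j, 0 ≤ (c j).2 ∧ (c j).2 ≤ ρ) ∧ E ⊆ ⋃ j, pQt N (c j).2 (c j).1),
    ∑' j, ENNReal.ofReal ((c j).2 ^ N)

/-- The truncated Riesz parabolic potential `I_2^R[μ]`. -/
def riesz (N : ℕ) (R : ℝ) (μ : Measure (PSpace N)) (z : PSpace N) : ℝ≥0∞ :=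
  ∫⁻ ρ in Ioo (0 : ℝ) R, μ (pQt N ρ z) / ENNReal.ofReal (ρ ^ (N + 1))

/-- The truncated fractional maximal parabolic potential `M_2^R[μ]`. -/
def maxPot (N : ℕ) (R : ℝ) (μ : Measure (PSpace N)) (z : PSpace N) : ℝ≥0∞ :=
  ⨆ (ρ : ℝ) (_ : ρ ∈ Ioo (0 : ℝ) R), μ (pQt N ρ z) / ENNReal.ofReal (ρ ^ N)

/-- The Gaussian heat kernel on `ℝ^{N+1}`. -/
def heatK (N : ℕ) (z : PSpace N) : ℝ :=
  if 0 < z.2 then (4 * Real.pi * z.2) ^ (-(N : ℝ) / 2) * Real.exp (-‖z.1‖ ^ 2 / (4 * z.2))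
  else 0

/-- The heat potential `(ℍ * μ)(x,t)` of a nonnegative measure. -/
def heatPot (N : ℕ) (μ : Measure (PSpace N)) (z : PSpace N) : ℝ≥0∞ :=
  ∫⁻ w, ENNReal.ofReal (heatK N (z.1 - w.1, z.2 - w.2)) ∂μ

/-- Exponential on `ℝ≥0∞`. -/
def expE (x : ℝ≥0∞) : ℝ≥0∞ := if x = ⊤ then ⊤ else ENNReal.ofReal (Real.exp x.toReal)

/-- Parabolic distance from a point to a set (taken over points at earlier times). -/
def pDist (N : ℕ) (z : PSpace N) (S : Set (PSpace N)) : ℝ :=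
  sInf { r | ∃ w ∈ S, w.2 ≤ z.2 ∧ r = max (dist z.1 w.1) (Real.sqrt (z.2 - w.2)) }

end

open scoped LineDeriv SchwartzMap

/-- The real-valued `L^p` seminorm. -/
noncomputable def lpn {α : Type*} [MeasurableSpace α] (μ : Measure α) (p : ℝ) (u : α → ℝ) : ℝ :=
  (eLpNorm u (ENNReal.ofReal p) μ).toReal

lemma lpn_nonneg {α : Type*} [MeasurableSpace α] {μ : Measure α} {p : ℝ} (u : α → ℝ) :
    0 ≤ lpn μ p u := ENNReal.toReal_nonneg

section Translates

variable {E : Type*} [NormedAddCommGroup E] [NormedSpace ℝ E]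

lemma SchwartzMap.exists_norm_le (u : 𝓢(E, ℝ)) : ∃ C, ∀ x, ‖u x‖ ≤ C := by
  obtain ⟨C, -, hC⟩ := u.decay 0 0
  exact ⟨C, fun x => by simpa using hC x⟩

variable [MeasurableSpace E] {μ : Measure E} {p : ℝ}

/-- The integral of `u` over the translate `A + z`. -/
noncomputable def transInt (μ : Measure E) (A : Set E) (u : E → ℝ) (z : E) : ℝ :=
  ∫ w in A, u (w + z) ∂μ

variable [BorelSpace E]

lemma integrableOn_translate {A : Set E} (hA : μ A ≠ ∞) (u : 𝓢(E, ℝ)) (z : E) :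
    IntegrableOn (fun w => u (w + z)) A μ := by
  obtain ⟨C, hC⟩ := u.exists_norm_le
  have : IsFiniteMeasure (μ.restrict A) := ⟨by simpa using hA.lt_top⟩
  have hc : Continuous fun w => u (w + z) := by fun_prop
  exact Integrable.of_bound (C := C) hc.aestronglyMeasurable
    (ae_of_all _ fun w => hC _)

lemma hasDerivAt_transInt {A : Set E} (hA : μ A ≠ ∞) (u : 𝓢(E, ℝ)) (z v : E) (τ : ℝ) :
    HasDerivAt (fun τ : ℝ => transInt μ A u (z + τ • v))
      (transInt μ A (∂_{v} u : 𝓢(E, ℝ)) (z + τ • v)) τ := by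
  obtain ⟨C, hC⟩ := (∂_{v} u : 𝓢(E, ℝ)).exists_norm_le
  have : IsFiniteMeasure (μ.restrict A) := ⟨by simpa using hA.lt_top⟩
  refine (hasDerivAt_integral_of_dominated_loc_of_deriv_le (μ := μ.restrict A)
    (F := fun τ w => u (w + (z + τ • v)))
    (F' := fun τ w => (∂_{v} u : 𝓢(E, ℝ)) (w + (z + τ • v))) (bound := fun _ => C)
    Filter.univ_mem ?_ ?_ ?_ ?_ ?_ ?_).2
  · exact Filter.Eventually.of_forall fun τ =>
      (by fun_prop : Continuous fun w => u (w + (z + τ • v))).aestronglyMeasurable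
  · exact integrableOn_translate hA u _
  · exact (integrableOn_translate hA (∂_{v} u : 𝓢(E, ℝ)) _).1
  · exact ae_of_all _ fun w τ _ => hC _
  · exact integrable_const _
  · refine ae_of_all _ fun w τ _ => ?_
    rw [SchwartzMap.lineDerivOp_apply_eq_fderiv]
    have h1 : HasDerivAt (fun τ : ℝ => w + (z + τ • v)) v τ := by
      simpa using (((hasDerivAt_id τ).smul_const v).const_add z).const_add w
    exact (u.differentiableAt.hasFDerivAt).comp_hasDerivAt τ h1

lemma continuous_transInt {A : Set E} (hA : μ A ≠ ∞) (u : 𝓢(E, ℝ)) :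
    Continuous (transInt μ A u) := by
  obtain ⟨C, hC⟩ := u.exists_norm_le
  have : IsFiniteMeasure (μ.restrict A) := ⟨by simpa using hA.lt_top⟩
  refine continuous_of_dominated (bound := fun _ => C) (fun z => ?_)
    (fun z => ae_of_all _ fun w => hC _) (integrable_const _) (ae_of_all _ fun w => ?_)
  · exact (integrableOn_translate hA u z).1
  · fun_prop

variable [FiniteDimensional ℝ E] [μ.IsAddHaarMeasure]

lemma lpn_eq_norm (u : 𝓢(E, ℝ)) : lpn μ p u = ‖u.toLp (ENNReal.ofReal p) μ‖ := by
  rw [SchwartzMap.norm_toLp]; rfl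

lemma lpn_smul (hp : 1 ≤ p) (c : ℝ) (u : 𝓢(E, ℝ)) :
    lpn μ p (c • u : 𝓢(E, ℝ)) = |c| * lpn μ p u := by
  have : Fact (1 ≤ ENNReal.ofReal p) := ⟨by simpa using hp⟩
  have := (SchwartzMap.toLpCLM ℝ (E := E) ℝ (ENNReal.ofReal p) μ).map_smul c u
  simp only [SchwartzMap.toLpCLM_apply] at this
  rw [lpn_eq_norm, lpn_eq_norm, this, norm_smul, Real.norm_eq_abs]

lemma lpn_sum_le {ι : Type*} (hp : 1 ≤ p) (s : Finset ι) (u : ι → 𝓢(E, ℝ)) :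
    lpn μ p (∑ i ∈ s, u i : 𝓢(E, ℝ)) ≤ ∑ i ∈ s, lpn μ p (u i) := by
  have : Fact (1 ≤ ENNReal.ofReal p) := ⟨by simpa using hp⟩
  have := map_sum (SchwartzMap.toLpCLM ℝ (E := E) ℝ (ENNReal.ofReal p) μ) u s
  simp only [SchwartzMap.toLpCLM_apply] at this
  simp_rw [lpn_eq_norm]
  rw [this]
  exact norm_sum_le _ _

lemma abs_transInt_le (hp : 1 ≤ p) {A : Set E} (hA : μ A ≠ ∞) (u : 𝓢(E, ℝ)) (z : E) :
    |transInt μ A u z| ≤ μ.real A ^ (1 - 1 / p) * lpn μ p u := by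
  have hp' : (1 : ℝ≥0∞) ≤ ENNReal.ofReal p := by simpa using hp
  have hc : Continuous fun w => u (w + z) := by fun_prop
  have h1 := eLpNorm_le_eLpNorm_mul_rpow_measure_univ (μ := μ.restrict A) hp'
    hc.aestronglyMeasurable
  have h2 : eLpNorm (fun w => u (w + z)) (ENNReal.ofReal p) (μ.restrict A)
      ≤ eLpNorm u (ENNReal.ofReal p) μ := by
    refine (eLpNorm_mono_measure _ Measure.restrict_le_self).trans ?_
    exact (eLpNorm_comp_measurePreserving (μ := μ) (f := fun w => w + z)
      u.continuous.aestronglyMeasurable (measurePreserving_add_right μ z)).le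
  have h0 : 0 ≤ 1 - 1 / p := by
    rw [sub_nonneg, div_le_one (by linarith)]; exact hp
  have h3 : ‖transInt μ A u z‖ₑ ≤
      eLpNorm u (ENNReal.ofReal p) μ * μ A ^ (1 - 1 / p) := by
    refine (enorm_integral_le_lintegral_enorm _).trans ?_
    rw [← eLpNorm_one_eq_lintegral_enorm]
    refine h1.trans ?_
    rw [ENNReal.toReal_ofReal (by linarith)]
    simp only [ENNReal.toReal_one, div_one, Measure.restrict_apply_univ]
    gcongr
  have h4 := ENNReal.toReal_mono (ENNReal.mul_ne_top (u.eLpNorm_lt_top _ μ).ne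
    (ENNReal.rpow_ne_top_of_nonneg h0 hA)) h3
  rw [ENNReal.toReal_mul, ← ENNReal.toReal_rpow] at h4
  simpa [lpn, Measure.real, mul_comm] using h4

lemma abs_transInt_sub_le (hp : 1 ≤ p) {A : Set E} (hA : μ A ≠ ∞) (u : 𝓢(E, ℝ)) (z v : E) :
    |transInt μ A u (z + v) - transInt μ A u z|
      ≤ μ.real A ^ (1 - 1 / p) * lpn μ p (∂_{v} u : 𝓢(E, ℝ)) := by
  have := norm_image_sub_le_of_norm_deriv_le_segment_01'
    (fun τ _ => (hasDerivAt_transInt hA u z v τ).hasDerivWithinAt)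
    (fun τ _ => abs_transInt_le hp hA (∂_{v} u : 𝓢(E, ℝ)) (z + τ • v))
  simpa using this

lemma abs_transInt_symm_le (hp : 1 ≤ p) {A : Set E} (hA : μ A ≠ ∞) (u : 𝓢(E, ℝ)) (z v : E) :
    |transInt μ A u (z + v) + transInt μ A u (z - v) - 2 * transInt μ A u z|
      ≤ 2 * (μ.real A ^ (1 - 1 / p) * lpn μ p (∂_{v} (∂_{v} u) : 𝓢(E, ℝ))) := by
  set M := μ.real A ^ (1 - 1 / p) * lpn μ p (∂_{v} (∂_{v} u) : 𝓢(E, ℝ)) with hM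
  have hM0 : 0 ≤ M := mul_nonneg (by positivity) (lpn_nonneg _)
  have hd : ∀ τ : ℝ, HasDerivAt
      (fun τ : ℝ => transInt μ A u (z + τ • v) + transInt μ A u (z + τ • (-v)))
      (transInt μ A (∂_{v} u : 𝓢(E, ℝ)) (z + τ • v)
        + transInt μ A (∂_{-v} u : 𝓢(E, ℝ)) (z + τ • (-v))) τ := fun τ =>
    (hasDerivAt_transInt hA u z v τ).add (hasDerivAt_transInt hA u z (-v) τ)
  have hb : ∀ τ ∈ Ico (0 : ℝ) 1, ‖transInt μ A (∂_{v} u : 𝓢(E, ℝ)) (z + τ • v)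
        + transInt μ A (∂_{-v} u : 𝓢(E, ℝ)) (z + τ • (-v))‖ ≤ 2 * M := by
    intro τ hτ
    have h1 : transInt μ A (∂_{-v} u : 𝓢(E, ℝ)) (z + τ • (-v))
        = - transInt μ A (∂_{v} u : 𝓢(E, ℝ)) (z + τ • (-v)) := by
      simp only [transInt, ← integral_neg]
      congr 1 with w
      simp [SchwartzMap.lineDerivOp_apply_eq_fderiv]
    have h2 := abs_transInt_sub_le hp hA (∂_{v} u : 𝓢(E, ℝ)) (z + τ • (-v)) ((2 * τ) • v)
    rw [show z + τ • (-v) + (2 * τ) • v = z + τ • v by module,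
      LineDeriv.lineDerivOp_left_smul, lpn_smul hp,
      abs_of_nonneg (a := 2 * τ) (by linarith [hτ.1])] at h2
    rw [h1, ← sub_eq_add_neg, Real.norm_eq_abs]
    refine h2.trans ?_
    calc _ = τ * (2 * M) := by rw [hM]; ring
      _ ≤ 1 * (2 * M) := by gcongr; exact hτ.2.le
      _ = 2 * M := one_mul _
  have := norm_image_sub_le_of_norm_deriv_le_segment_01'
    (fun τ _ => (hd τ).hasDerivWithinAt) hb
  simp only [one_smul, zero_smul, add_zero, ← sub_eq_add_neg, Real.norm_eq_abs] at this
  rwa [two_mul (transInt μ A u z)]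

lemma integral_transInt_comm {A B : Set E} (hA : μ A ≠ ∞) (hB : μ B ≠ ∞) (u : 𝓢(E, ℝ)) (z : E) :
    ∫ v in B, transInt μ A u (z + v) ∂μ = ∫ w in A, transInt μ B u (z + w) ∂μ := by
  obtain ⟨C, hC⟩ := u.exists_norm_le
  have : IsFiniteMeasure (μ.restrict A) := ⟨by simpa using hA.lt_top⟩
  have : IsFiniteMeasure (μ.restrict B) := ⟨by simpa using hB.lt_top⟩
  simp only [transInt]
  rw [integral_integral_swap]
  · congr 1 with w
    congr 1 with v
    congr 1
    abel
  · exact Integrable.of_bound (C := C) (by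
      refine Continuous.aestronglyMeasurable ?_
      simp only [Function.uncurry_def]
      fun_prop) (ae_of_all _ fun w => hC _)

lemma abs_integral_transInt_sub_le {A Q : Set E} (hA : μ A ≠ ∞) (hQm : MeasurableSet Q)
    (hQ : Bornology.IsBounded Q) (hneg : ∀ v, -v ∈ Q ↔ v ∈ Q) (u : 𝓢(E, ℝ)) (z : E) {M : ℝ}
    (hM : ∀ v ∈ Q, |transInt μ A u (z + v) + transInt μ A u (z - v) - 2 * transInt μ A u z|
      ≤ 2 * M) :
    |(∫ v in Q, transInt μ A u (z + v) ∂μ) - μ.real Q * transInt μ A u z| ≤ M * μ.real Q := by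
  have hc := continuous_transInt hA u
  have hint : ∀ f : E → ℝ, Continuous f → IntegrableOn f Q μ := fun f hf =>
    (hf.continuousOn.integrableOn_compact hQ.isCompact_closure).mono_set subset_closure
  have hfin : μ Q < ∞ := hQ.measure_lt_top
  have h1 : ∫ v in Q, transInt μ A u (z - v) ∂μ = ∫ v in Q, transInt μ A u (z + v) ∂μ := by
    rw [← integral_indicator hQm, ← integral_indicator hQm, ← integral_neg_eq_self]
    congr 1 with v
    by_cases hv : v ∈ Q
    · rw [indicator_of_mem ((hneg v).2 hv), indicator_of_mem hv, sub_neg_eq_add]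
    · rw [indicator_of_notMem (mt (hneg v).1 hv), indicator_of_notMem hv]
  have h2 : ∫ v in Q, (transInt μ A u (z + v) + transInt μ A u (z - v) - 2 * transInt μ A u z) ∂μ
      = 2 * ((∫ v in Q, transInt μ A u (z + v) ∂μ) - μ.real Q * transInt μ A u z) := by
    rw [integral_sub, integral_add, h1, setIntegral_const, smul_eq_mul]
    · ring
    all_goals exact hint _ (by fun_prop)
  have h3 := norm_setIntegral_le_of_norm_le_const (μ := μ) (C := 2 * M) hfin
    (f := fun v => transInt μ A u (z + v) + transInt μ A u (z - v) - 2 * transInt μ A u z) hM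
  rw [h2, Real.norm_eq_abs, abs_mul, abs_two] at h3
  linarith

end Translates

lemma le_of_geometric_telescope {a : ℕ → ℝ} {B q : ℝ} (hq : q < 1) (hq0 : 0 ≤ q) (hB : 0 ≤ B)
    (ha : ∀ k, a k ≤ a (k + 1) + B * q ^ k) (hlim : Filter.Tendsto a Filter.atTop (nhds 0)) :
    a 0 ≤ B / (1 - q) := by
  have h1 : ∀ n, a 0 ≤ a n + B * ∑ k ∈ Finset.range n, q ^ k := by
    intro n
    induction n with
    | zero => simp
    | succ n ih =>
      rw [Finset.sum_range_succ]
      linarith [ha n]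
  have h2 : ∀ n, a 0 ≤ a n + B / (1 - q) := fun n => by
    refine (h1 n).trans ?_
    rw [div_eq_mul_inv]
    gcongr
    rw [← tsum_geometric_of_lt_one hq0 hq]
    exact (summable_geometric_of_lt_one hq0 hq).sum_le_tsum _ fun _ _ => by positivity
  have h3 := hlim.add_const (B / (1 - q))
  rw [zero_add] at h3
  exact ge_of_tendsto' h3 h2

section Parabolic

variable {N : ℕ} {p : ℝ}

instance : (volume : Measure (PSpace N)).IsAddHaarMeasure :=
  inferInstanceAs ((volume : Measure (EuclideanSpace ℝ (Fin N))).prod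
    (volume : Measure ℝ)).IsAddHaarMeasure

lemma tDeriv_eq_lineDerivOp (u : 𝓢(PSpace N, ℝ)) :
    tDeriv u = (∂_{((0, 1) : PSpace N)} u : 𝓢(PSpace N, ℝ)) := by
  ext z
  rw [SchwartzMap.lineDerivOp_apply, tDeriv, lineDeriv]
  have := deriv_comp_const_add (fun s => u (z.1, s)) z.2 0
  simp only [add_zero] at this
  rw [← this]
  congr 1 with s
  congr 1
  ext <;> simp

lemma xDeriv_eq_lineDerivOp (i : Fin N) (u : 𝓢(PSpace N, ℝ)) :
    xDeriv i u = (∂_{((EuclideanSpace.single i 1, 0) : PSpace N)} u : 𝓢(PSpace N, ℝ)) := by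
  ext z
  rw [SchwartzMap.lineDerivOp_apply, xDeriv, lineDeriv, lineDeriv]
  congr 1 with s
  congr 1
  ext <;> simp

lemma xxDeriv_eq_lineDerivOp (i j : Fin N) (u : 𝓢(PSpace N, ℝ)) :
    xxDeriv i j u = (∂_{((EuclideanSpace.single i 1, 0) : PSpace N)}
      (∂_{((EuclideanSpace.single j 1, 0) : PSpace N)} u) : 𝓢(PSpace N, ℝ)) := by
  rw [← xDeriv_eq_lineDerivOp, ← xDeriv_eq_lineDerivOp]
  rfl

/-- The sum of the `L^p` norms of the derivatives of parabolic order two. -/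
noncomputable def topNorm (p : ℝ) (u : PSpace N → ℝ) : ℝ :=
  lpn volume p (tDeriv u) + ∑ i : Fin N, ∑ j : Fin N, lpn volume p (xxDeriv i j u)

lemma topNorm_nonneg (u : PSpace N → ℝ) : 0 ≤ topNorm p u :=
  add_nonneg (lpn_nonneg _) (Finset.sum_nonneg fun _ _ => Finset.sum_nonneg fun _ _ => lpn_nonneg _)

lemma topNorm_le_W21Norm (u : PSpace N → ℝ) : topNorm p u ≤ W21Norm N p u := by
  have h1 : 0 ≤ (eLpNorm u (ENNReal.ofReal p) volume).toReal := ENNReal.toReal_nonneg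
  have h2 : 0 ≤ (eLpNorm (gradNorm u) (ENNReal.ofReal p) volume).toReal := ENNReal.toReal_nonneg
  simp only [topNorm, W21Norm, lpn]
  linarith

lemma lpn_lineDerivOp_time (hp : 1 ≤ p) (u : 𝓢(PSpace N, ℝ)) (s : ℝ) :
    lpn volume p (∂_{((0, s) : PSpace N)} u : 𝓢(PSpace N, ℝ)) = |s| * lpn volume p (tDeriv u) := by
  have : ((0, s) : PSpace N) = s • ((0, 1) : PSpace N) := by ext <;> simp
  rw [this, LineDeriv.lineDerivOp_left_smul, lpn_smul hp, tDeriv_eq_lineDerivOp]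

lemma lineDerivOp_space (u : 𝓢(PSpace N, ℝ)) (h : EuclideanSpace ℝ (Fin N)) :
    (∂_{((h, 0) : PSpace N)} u : 𝓢(PSpace N, ℝ))
      = ∑ i, h i • (∂_{((EuclideanSpace.single i 1, 0) : PSpace N)} u : 𝓢(PSpace N, ℝ)) := by
  have : ((h, 0) : PSpace N) = ∑ i, h i • ((EuclideanSpace.single i 1, 0) : PSpace N) := by
    refine Prod.ext ?_ ?_
    · rw [Prod.fst_sum]
      ext j
      simp [Finset.sum_apply, Pi.single_apply]
    · rw [Prod.snd_sum]
      simp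
  ext z
  simp only [SchwartzMap.lineDerivOp_apply_eq_fderiv, this, map_sum, map_smul, sum_apply,
    smul_apply]

lemma lpn_lineDerivOp_space_le (hp : 1 ≤ p) (u : 𝓢(PSpace N, ℝ)) (h : EuclideanSpace ℝ (Fin N)) :
    lpn volume p (∂_{((h, 0) : PSpace N)} (∂_{((h, 0) : PSpace N)} u) : 𝓢(PSpace N, ℝ))
      ≤ ‖h‖ ^ 2 * ∑ i : Fin N, ∑ j : Fin N, lpn volume p (xxDeriv i j u) := by
  rw [lineDerivOp_space]
  refine (lpn_sum_le hp _ _).trans ?_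
  rw [Finset.mul_sum]
  refine Finset.sum_le_sum fun i _ => ?_
  rw [lpn_smul hp, lineDerivOp_space u h, LineDeriv.lineDerivOp_sum, Finset.mul_sum]
  have hi : ∀ i, |h i| ≤ ‖h‖ := fun i => PiLp.norm_apply_le h i
  calc _ ≤ |h i| * ∑ j, |h j| * lpn volume p (xxDeriv i j u) := by
        gcongr
        refine (lpn_sum_le hp _ _).trans (le_of_eq ?_)
        refine Finset.sum_congr rfl fun j _ => ?_
        rw [LineDeriv.lineDerivOp_smul, lpn_smul hp, xxDeriv_eq_lineDerivOp]
    _ ≤ ‖h‖ * ∑ j, ‖h‖ * lpn volume p (xxDeriv i j u) := by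
        gcongr with j
        · exact Finset.sum_nonneg fun j _ => mul_nonneg (abs_nonneg _) (lpn_nonneg _)
        · exact hi i
        · exact lpn_nonneg _
        · exact hi j
    _ = _ := by rw [← Finset.mul_sum, ← Finset.mul_sum]; ring

lemma abs_transInt_parabolic_symm_le (hp : 1 ≤ p) {A : Set (PSpace N)} (hA : volume A ≠ ∞)
    (u : 𝓢(PSpace N, ℝ)) {R : ℝ} (z v : PSpace N) (hv : v ∈ pQt N R 0) :
    |transInt volume A u (z + v) + transInt volume A u (z - v) - 2 * transInt volume A u z|
      ≤ 2 * (R ^ 2 * volume.real A ^ (1 - 1 / p) * topNorm p u) := by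
  obtain ⟨h, s⟩ := v
  simp only [pQt, mem_prod, mem_ball, mem_Ioo, Prod.fst_zero, Prod.snd_zero, dist_zero_right,
    zero_sub, zero_add] at hv
  obtain ⟨hh, hs⟩ := hv
  have hs' : |s| ≤ R ^ 2 := abs_le.2 ⟨hs.1.le, hs.2.le⟩
  have hh' : ‖h‖ ^ 2 ≤ R ^ 2 := by gcongr
  have h1 := abs_transInt_symm_le hp hA u z ((h, 0) : PSpace N)
  have h2 := abs_transInt_sub_le hp hA u (z + (h, 0)) ((0, s) : PSpace N)
  have h3 := abs_transInt_sub_le hp hA u (z - (h, 0)) ((0, -s) : PSpace N)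
  rw [lpn_lineDerivOp_time hp] at h2 h3
  rw [abs_neg] at h3
  rw [show z + (h, 0) + (0, s) = z + (h, s) by ext <;> simp] at h2
  rw [show z - (h, 0) + (0, -s) = z - (h, s) by ext <;> simp [sub_eq_add_neg]] at h3
  have h4 := lpn_lineDerivOp_space_le hp u h
  set a := volume.real A ^ (1 - 1 / p)
  have ha : 0 ≤ a := by positivity
  have ht := lpn_nonneg (μ := volume) (p := p) (tDeriv u)
  have hx : 0 ≤ ∑ i : Fin N, ∑ j : Fin N, lpn volume p (xxDeriv i j u) :=
    Finset.sum_nonneg fun _ _ => Finset.sum_nonneg fun _ _ => lpn_nonneg _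
  have h5 : a * (|s| * lpn volume p (tDeriv u)) ≤ a * (R ^ 2 * lpn volume p (tDeriv u)) := by gcongr
  have h6 := mul_le_mul_of_nonneg_left (h4.trans (mul_le_mul_of_nonneg_right hh' hx)) ha
  have h7 : 2 * (R ^ 2 * a * topNorm p u) = 2 * (a * (R ^ 2 * lpn volume p (tDeriv u)))
      + 2 * (a * (R ^ 2 * ∑ i : Fin N, ∑ j : Fin N, lpn volume p (xxDeriv i j u))) := by
    rw [topNorm]; ring
  rw [h7]
  rw [abs_le] at *
  constructor <;> linarith [h1.1, h1.2, h2.1, h2.2, h3.1, h3.2]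

lemma measurableSet_pQt (R : ℝ) : MeasurableSet (pQt N R 0) :=
  measurableSet_ball.prod measurableSet_Ioo

lemma isBounded_pQt (R : ℝ) : Bornology.IsBounded (pQt N R 0) :=
  isBounded_ball.prod (isBounded_Ioo _ _)

lemma volume_pQt_ne_top (R : ℝ) : volume (pQt N R 0) ≠ ∞ :=
  (isBounded_pQt R).measure_lt_top.ne

lemma neg_mem_pQt (R : ℝ) (v : PSpace N) : -v ∈ pQt N R 0 ↔ v ∈ pQt N R 0 := by
  simp only [pQt, mem_prod, mem_ball, mem_Ioo, Prod.fst_zero, Prod.snd_zero, dist_zero_right,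
    zero_sub, zero_add, Prod.fst_neg, Prod.snd_neg, norm_neg, neg_lt_neg_iff]
  rw [neg_lt (b := R ^ 2), and_comm (a := v.2 < R ^ 2)]

lemma volume_real_pQt {R : ℝ} (hR : 0 < R) :
    volume.real (pQt N R 0) = volume.real (pQt N 1 0) * R ^ ((N : ℝ) + 2) := by
  have h : ∀ r : ℝ, 0 < r → volume.real (pQt N r 0)
      = r ^ N * volume.real (ball (0 : EuclideanSpace ℝ (Fin N)) 1) * (2 * r ^ 2) := by
    intro r hr
    rw [pQt, Measure.volume_eq_prod, measureReal_prod_prod, Prod.fst_zero, Prod.snd_zero,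
      Measure.real, Measure.addHaar_ball_of_pos _ _ hr, ENNReal.toReal_mul,
      Real.volume_real_Ioo_of_le (by nlinarith)]
    rw [ENNReal.toReal_ofReal (by positivity), finrank_euclideanSpace_fin, Measure.real]
    ring
  rw [h R hR, h 1 zero_lt_one]
  rw [show (N : ℝ) + 2 = ((N + 2 : ℕ) : ℝ) by push_cast; ring, Real.rpow_natCast]
  ring

lemma volume_real_pQt_one_pos : 0 < volume.real (pQt N 1 0) := by
  rw [Measure.real, ENNReal.toReal_pos_iff]
  refine ⟨IsOpen.measure_pos _ (isOpen_ball.prod isOpen_Ioo) ⟨0, ?_⟩,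
    (isBounded_pQt 1).measure_lt_top⟩
  simp [pQt]

/-- The average of `u` over the cylinder `Q̃_R` centred at `z`. -/
noncomputable def cylAvg (R : ℝ) (u : PSpace N → ℝ) (z : PSpace N) : ℝ :=
  (volume.real (pQt N R 0))⁻¹ * transInt volume (pQt N R 0) u z

lemma volume_real_pQt_pos {R : ℝ} (hR : 0 < R) : 0 < volume.real (pQt N R 0) := by
  rw [volume_real_pQt hR]
  exact mul_pos volume_real_pQt_one_pos (by positivity)

lemma abs_integral_cylAvg_sub_le (hp : 1 ≤ p) {A : Set (PSpace N)} (hA : volume A ≠ ∞)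
    (u : 𝓢(PSpace N, ℝ)) {R : ℝ} (hR : 0 < R) (z : PSpace N) :
    |(∫ w in A, cylAvg R u (z + w)) - transInt volume A u z|
      ≤ R ^ 2 * volume.real A ^ (1 - 1 / p) * topNorm p u := by
  have hQ := volume_real_pQt_pos (N := N) hR
  have h := abs_integral_transInt_sub_le hA (measurableSet_pQt R) (isBounded_pQt R) (neg_mem_pQt R)
    u z (fun v hv => abs_transInt_parabolic_symm_le hp hA u z v hv)
  rw [integral_transInt_comm hA (volume_pQt_ne_top R)] at h
  simp only [cylAvg, integral_const_mul]
  set V := volume.real (pQt N R 0)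
  rw [show V⁻¹ * (∫ w in A, transInt volume (pQt N R 0) u (z + w)) - transInt volume A u z
    = V⁻¹ * ((∫ w in A, transInt volume (pQt N R 0) u (z + w)) - V * transInt volume A u z) by
      field_simp, abs_mul, abs_of_pos (inv_pos.2 hQ), inv_mul_le_iff₀ hQ]
  linarith

lemma abs_cylAvg_le (hp : 1 ≤ p) (u : 𝓢(PSpace N, ℝ)) {R : ℝ} (hR : 0 < R) (z : PSpace N) :
    |cylAvg R u z| ≤ volume.real (pQt N R 0) ^ (- (1 / p)) * lpn volume p u := by
  have hQ := volume_real_pQt_pos (N := N) hR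
  have h := abs_transInt_le hp (volume_pQt_ne_top R) u z
  rw [cylAvg, abs_mul, abs_of_pos (inv_pos.2 hQ), inv_mul_le_iff₀ hQ]
  rwa [sub_eq_add_neg, Real.rpow_add hQ, Real.rpow_one, mul_assoc] at h

lemma abs_cylAvg_cylAvg_sub_le (hp : 1 ≤ p) (u : 𝓢(PSpace N, ℝ)) {R r : ℝ} (hR : 0 < R) (hr : 0 < r)
    (z : PSpace N) :
    |(volume.real (pQt N r 0))⁻¹ * (∫ w in pQt N r 0, cylAvg R u (z + w)) - cylAvg r u z|
      ≤ R ^ 2 * volume.real (pQt N r 0) ^ (- (1 / p)) * topNorm p u := by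
  have hQ := volume_real_pQt_pos (N := N) hr
  have h := abs_integral_cylAvg_sub_le hp (volume_pQt_ne_top r) u hR z
  rw [cylAvg, ← mul_sub, abs_mul, abs_of_pos (inv_pos.2 hQ), inv_mul_le_iff₀ hQ]
  rw [sub_eq_add_neg 1, Real.rpow_add hQ, Real.rpow_one] at h
  linarith

lemma abs_cylAvg_sub_le (hp : 1 ≤ p) (u : 𝓢(PSpace N, ℝ)) {R : ℝ} (hR : 0 < R) (z : PSpace N) :
    |cylAvg R u z - cylAvg (2 * R) u z|
      ≤ 5 * (R ^ 2 * volume.real (pQt N R 0) ^ (- (1 / p)) * topNorm p u) := by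
  have hR2 : 0 < 2 * R := by positivity
  have h1 := abs_cylAvg_cylAvg_sub_le hp u hR hR2 z
  have h2 := abs_cylAvg_cylAvg_sub_le hp u hR2 hR z
  have h3 : (volume.real (pQt N R 0))⁻¹ * (∫ w in pQt N R 0, cylAvg (2 * R) u (z + w))
      = (volume.real (pQt N (2 * R) 0))⁻¹ * (∫ w in pQt N (2 * R) 0, cylAvg R u (z + w)) := by
    simp only [cylAvg, integral_const_mul]
    rw [integral_transInt_comm (volume_pQt_ne_top (2 * R)) (volume_pQt_ne_top R)]
    ring
  have h4 : volume.real (pQt N (2 * R) 0) ^ (- (1 / p))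
      ≤ volume.real (pQt N R 0) ^ (- (1 / p)) := by
    refine Real.rpow_le_rpow_of_nonpos (volume_real_pQt_pos hR) ?_ (by
      rw [neg_nonpos]; positivity)
    rw [volume_real_pQt hR, volume_real_pQt hR2]
    gcongr
    linarith
  have h5 : R ^ 2 * volume.real (pQt N (2 * R) 0) ^ (- (1 / p)) * topNorm p u
      ≤ R ^ 2 * volume.real (pQt N R 0) ^ (- (1 / p)) * topNorm p u := by
    have := topNorm_nonneg (p := p) (u : PSpace N → ℝ)
    gcongr
  rw [h3] at h2
  rw [abs_le] at *
  constructor <;> nlinarith [h1.1, h1.2, h2.1, h2.2]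

lemma volume_real_pQt_rpow {R : ℝ} (hR : 0 < R) :
    volume.real (pQt N R 0) ^ (-(1 / p))
      = volume.real (pQt N 1 0) ^ (-(1 / p)) * R ^ (-(((N : ℝ) + 2) / p)) := by
  rw [volume_real_pQt hR, Real.mul_rpow volume_real_pQt_one_pos.le (by positivity),
    ← Real.rpow_mul hR.le]
  congr 2
  ring

lemma abs_cylAvg_le_topNorm (hp : 1 ≤ p) (hp2 : p < ((N : ℝ) + 2) / 2) (u : 𝓢(PSpace N, ℝ))
    {R : ℝ} (hR : 0 < R) (z : PSpace N) :
    |cylAvg R u z| ≤ 5 * volume.real (pQt N 1 0) ^ (-(1 / p)) / (1 - 2 ^ (2 - ((N : ℝ) + 2) / p))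
      * R ^ (2 - ((N : ℝ) + 2) / p) * topNorm p u := by
  set κ := volume.real (pQt N 1 0) ^ (-(1 / p))
  have hκ : 0 ≤ κ := by positivity
  have hp0 : 0 < p := by linarith
  have hα : 2 - ((N : ℝ) + 2) / p < 0 := by
    rw [sub_neg, lt_div_iff₀ hp0]; linarith
  set β := 2 - ((N : ℝ) + 2) / p with hβ
  have hT := topNorm_nonneg (p := p) (u : PSpace N → ℝ)
  have hlim : Filter.Tendsto (fun k : ℕ => |cylAvg (2 ^ k * R) u z|) Filter.atTop (nhds 0) := by
    have hq : (2 : ℝ) ^ (-(((N : ℝ) + 2) / p)) < 1 :=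
      Real.rpow_lt_one_of_one_lt_of_neg one_lt_two (by rw [neg_lt_zero]; positivity)
    have h1 := (tendsto_pow_atTop_nhds_zero_of_lt_one (by positivity) hq).const_mul
      (κ * R ^ (-(((N : ℝ) + 2) / p)) * lpn volume p u)
    rw [mul_zero] at h1
    refine squeeze_zero (fun _ => abs_nonneg _) (fun k => ?_) h1
    refine (abs_cylAvg_le hp u (by positivity) z).trans (le_of_eq ?_)
    rw [volume_real_pQt_rpow (by positivity), Real.mul_rpow (by positivity) hR.le,
      ← Real.rpow_natCast, ← Real.rpow_mul zero_le_two, mul_comm (k : ℝ), Real.rpow_mul zero_le_two,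
      Real.rpow_natCast]
    ring
  have hstep : ∀ k : ℕ, |cylAvg (2 ^ k * R) u z| ≤ |cylAvg (2 ^ (k + 1) * R) u z|
      + 5 * κ * R ^ β * topNorm p u * ((2 : ℝ) ^ β) ^ k := by
    intro k
    have h1 := abs_cylAvg_sub_le hp u (R := 2 ^ k * R) (by positivity) z
    rw [volume_real_pQt_rpow (by positivity), ← mul_assoc 2, ← pow_succ'] at h1
    have h2 : (2 ^ k * R) ^ 2 * (κ * (2 ^ k * R) ^ (-(((N : ℝ) + 2) / p)))
        = κ * R ^ β * ((2 : ℝ) ^ β) ^ k := by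
      calc _ = κ * ((2 ^ k * R) ^ (2 : ℝ) * (2 ^ k * R) ^ (-(((N : ℝ) + 2) / p))) := by
            rw [Real.rpow_two]; ring
        _ = κ * (2 ^ k * R) ^ β := by
            rw [← Real.rpow_add (by positivity), ← sub_eq_add_neg]
        _ = _ := by
            rw [Real.mul_rpow (by positivity) hR.le, ← Real.rpow_natCast 2 k,
              ← Real.rpow_mul zero_le_two, mul_comm (k : ℝ), Real.rpow_mul zero_le_two,
              Real.rpow_natCast]
            ring
    rw [h2] at h1
    have h3 := (abs_sub_abs_le_abs_sub (cylAvg (2 ^ k * R) u z)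
      (cylAvg (2 ^ (k + 1) * R) u z)).trans h1
    linarith
  have := le_of_geometric_telescope (Real.rpow_lt_one_of_one_lt_of_neg one_lt_two hα)
    (by positivity) (by positivity) hstep hlim
  simp only [pow_zero, one_mul] at this
  refine this.trans (le_of_eq ?_)
  ring

/-- The weak-type parabolic Sobolev inequality in `ℝ^{N+1}`. -/
lemma exists_volume_rpow_le_topNorm (hp : 1 ≤ p) (hp2 : p < ((N : ℝ) + 2) / 2) :
    ∃ C > (0 : ℝ), ∀ K : Set (PSpace N), IsCompact K → ∀ u : 𝓢(PSpace N, ℝ),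
      (∀ z ∈ K, 1 ≤ u z) → volume.real K ^ (1 - 2 * p / ((N : ℝ) + 2)) ≤ (C * topNorm p u) ^ p := by
  have hp0 : 0 < p := by linarith
  have hN2 : (0 : ℝ) < (N : ℝ) + 2 := by positivity
  have hβ : 2 - ((N : ℝ) + 2) / p < 0 := by
    rw [sub_neg, lt_div_iff₀ hp0]; linarith
  set C := 5 * volume.real (pQt N 1 0) ^ (-(1 / p)) / (1 - 2 ^ (2 - ((N : ℝ) + 2) / p)) with hC
  have hC0 : 0 ≤ C := by
    have := Real.rpow_lt_one_of_one_lt_of_neg one_lt_two hβ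
    exact div_nonneg (by positivity) (by linarith)
  refine ⟨C + 1, by positivity, fun K hK u hu => ?_⟩
  have hT := topNorm_nonneg (p := p) (u : PSpace N → ℝ)
  have he : 0 < 1 - 2 * p / ((N : ℝ) + 2) := by
    rw [sub_pos, div_lt_one hN2]; linarith
  have hKfin : volume K ≠ ∞ := hK.measure_lt_top.ne
  rcases (measureReal_nonneg : 0 ≤ volume.real K).eq_or_lt with h0 | hpos
  · rw [← h0, Real.zero_rpow he.ne']
    positivity
  set m := volume.real K with hm
  set R := m ^ (1 / ((N : ℝ) + 2)) with hR
  have hR0 : 0 < R := by positivity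
  have hmR : m = R ^ ((N : ℝ) + 2) := by
    rw [hR, ← Real.rpow_mul hpos.le, one_div_mul_cancel hN2.ne', Real.rpow_one]
  set β := 2 - ((N : ℝ) + 2) / p with hβd
  have h1 := abs_integral_cylAvg_sub_le hp hKfin u hR0 0
  have h2 : m ≤ transInt volume K u 0 := by
    have := setIntegral_mono_on (integrableOn_const hKfin (C := (1 : ℝ)))
      (integrableOn_translate hKfin u 0) hK.measurableSet
      (fun z hz => by simpa using hu z hz)
    simpa [transInt] using this
  have h3 : |∫ w in K, cylAvg R u (0 + w)| ≤ C * R ^ β * topNorm p u * m :=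
    norm_setIntegral_le_of_norm_le_const (f := fun w => cylAvg R u (0 + w)) hKfin.lt_top
      fun w _ => abs_cylAvg_le_topNorm hp hp2 u hR0 (0 + w)
  have h4 : R ^ 2 * m ^ (1 - 1 / p) = R ^ β * m := by
    rw [hmR, ← Real.rpow_mul hR0.le, ← Real.rpow_two, ← Real.rpow_add hR0, ← Real.rpow_add hR0]
    congr 1
    rw [hβd]
    ring
  rw [← hm, h4] at h1
  have h5 : m * 1 ≤ m * ((C + 1) * topNorm p u * R ^ β) := by
    have := (abs_le.1 h1).1
    have := (abs_le.1 h3).2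
    nlinarith
  have h6 : 1 ≤ (C + 1) * topNorm p u * R ^ β := le_of_mul_le_mul_left h5 hpos
  have h7 : R ^ (-β) ≤ (C + 1) * topNorm p u := by
    rw [Real.rpow_neg hR0.le, inv_le_iff_one_le_mul₀ (by positivity)]
    exact h6
  calc m ^ (1 - 2 * p / ((N : ℝ) + 2)) = (R ^ (-β)) ^ p := by
        rw [hR, ← Real.rpow_mul hpos.le, ← Real.rpow_mul hpos.le, hβd]
        congr 1
        field_simp
        ring
    _ ≤ _ := by gcongr

lemma exists_schwartz_one_le {K : Set (PSpace N)} (hK : IsCompact K) :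
    ∃ u : 𝓢(PSpace N, ℝ), ∃ U, IsOpen U ∧ K ⊆ U ∧ ∀ z ∈ U, 1 ≤ u z := by
  obtain ⟨r, hr, hKr⟩ := hK.isBounded.subset_ball_lt 0 (0 : PSpace N)
  let f : ContDiffBump (0 : PSpace N) := ⟨r, r + 1, hr, by linarith⟩
  exact ⟨f.hasCompactSupport.toSchwartzMap f.contDiff, ball 0 r, isOpen_ball, hKr,
    fun z hz => (f.one_of_mem_closedBall (ball_subset_closedBall hz)).ge⟩

end Parabolic

/-- First estimate in (2.2): for `1 < p < (N+2)/2` and compact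
`K ⊆ closure Q̃_{100}(0,0)`, `Cap_{2,1,p}(K) ≥ c |K|^{1 - 2p/(N+2)}`. -/
theorem cap21_ge_volume_pow
    (N : ℕ) (hN : 2 ≤ N) (p : ℝ) (hp : 1 < p) (hp2 : p < ((N : ℝ) + 2) / 2) :
    ∃ c > (0 : ℝ), ∀ K : Set (PSpace N), K ⊆ closure (pQt N 100 0) → IsCompact K →
      c * (volume K).toReal ^ (1 - 2 * p / ((N : ℝ) + 2)) ≤ cap21c N p K := by
  obtain ⟨C, hC, h⟩ := exists_volume_rpow_le_topNorm hp.le hp2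
  refine ⟨(C ^ p)⁻¹, by positivity, fun K _ hK => ?_⟩
  obtain ⟨u₀, hu₀⟩ := exists_schwartz_one_le hK
  refine le_csInf ⟨_, u₀, hu₀, rfl⟩ ?_
  rintro _ ⟨u, ⟨U, -, hKU, hU⟩, rfl⟩
  have hT := topNorm_nonneg (p := p) (u : PSpace N → ℝ)
  rw [inv_mul_le_iff₀ (by positivity)]
  refine (h K hK u fun z hz => hU z (hKU hz)).trans ?_
  rw [Real.mul_rpow hC.le hT]
  gcongr
  exact topNorm_le_W21Norm _
end

section
/- Let N ≥ 2. There exists a constant c = c(N) > 0 such that for every compact set K ⊂ closure(Q̃_{100}(0,0)) with |K| > 0 one has Cap_{2,1,(N+2)/2}(K) ≥ c ( log( |Q̃_{200}(0,0)| / |K| ) )^{−N/2}, where |·| denotes Lebesgue measure in ℝ^{N+1}. -/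
open MeasureTheory Metric Set
open scoped ENNReal NNReal

namespace CriticalCapacity

open scoped SchwartzMap LineDeriv
open Filter Topology LineDeriv

/-- The unnormalized Gaussian `exp (-|z|²/4)` on `ℝ^N`. -/
noncomputable def gauss {N : ℕ} (z : EuclideanSpace ℝ (Fin N)) : ℝ :=
  Real.exp (-(1 / 4) * ‖z‖ ^ 2)

section Gaussian

variable {N : ℕ}

lemma gauss_pos (z : EuclideanSpace ℝ (Fin N)) : 0 < gauss z := Real.exp_pos _

lemma gauss_le_one (z : EuclideanSpace ℝ (Fin N)) : gauss z ≤ 1 :=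
  Real.exp_le_one_iff.2 (by nlinarith [sq_nonneg ‖z‖])

lemma continuous_gauss : Continuous (gauss (N := N)) := by
  unfold gauss; fun_prop

lemma integral_exp_neg_mul_norm_sq_pos {b : ℝ} (hb : 0 < b) :
    0 < ∫ z : EuclideanSpace ℝ (Fin N), Real.exp (-b * ‖z‖ ^ 2) := by
  rw [GaussianFourier.integral_rexp_neg_mul_sq_norm hb]
  exact Real.rpow_pos_of_pos (div_pos Real.pi_pos hb) _

lemma integrable_exp_neg_mul_norm_sq {b : ℝ} (hb : 0 < b) :
    Integrable fun z : EuclideanSpace ℝ (Fin N) => Real.exp (-b * ‖z‖ ^ 2) :=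
  Integrable.of_integral_ne_zero (integral_exp_neg_mul_norm_sq_pos hb).ne'

lemma integral_gauss_pos : 0 < ∫ z : EuclideanSpace ℝ (Fin N), gauss z :=
  integral_exp_neg_mul_norm_sq_pos (by norm_num)

lemma integrable_gauss : Integrable (gauss (N := N)) :=
  integrable_exp_neg_mul_norm_sq (by norm_num)

lemma integrable_norm_mul_gauss :
    Integrable fun z : EuclideanSpace ℝ (Fin N) => ‖z‖ * gauss z := by
  refine ((integrable_exp_neg_mul_norm_sq (N := N) (b := 1 / 8) (by norm_num)).const_mul 2).mono'
    (continuous_norm.mul continuous_gauss).aestronglyMeasurable (.of_forall fun z => ?_)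
  rw [Real.norm_of_nonneg (mul_nonneg (norm_nonneg _) (gauss_pos z).le)]
  have h1 : ‖z‖ ≤ 2 * Real.exp (1 / 8 * ‖z‖ ^ 2) := by
    nlinarith [Real.add_one_le_exp (1 / 8 * ‖z‖ ^ 2), sq_nonneg (‖z‖ - 2)]
  calc ‖z‖ * gauss z ≤ 2 * Real.exp (1 / 8 * ‖z‖ ^ 2) * gauss z :=
        mul_le_mul_of_nonneg_right h1 (gauss_pos z).le
    _ = 2 * Real.exp (-(1 / 8) * ‖z‖ ^ 2) := by
        rw [gauss, mul_assoc, ← Real.exp_add]; ring_nf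

lemma fderiv_gauss (z : EuclideanSpace ℝ (Fin N)) (i : Fin N) :
    fderiv ℝ gauss z (EuclideanSpace.single i 1) = -(1 / 2) * (z i * gauss z) := by
  have h := ((hasStrictFDerivAt_norm_sq z).hasFDerivAt.const_mul (-(1 / 4) : ℝ)).exp
  have h' : fderiv ℝ gauss z = _ := h.fderiv
  rw [h']
  simp [gauss, EuclideanSpace.inner_single_right]
  ring

lemma differentiable_gauss : Differentiable ℝ (gauss (N := N)) := by
  intro z
  exact ((hasStrictFDerivAt_norm_sq z).hasFDerivAt.const_mul (-(1 / 4) : ℝ)).exp.differentiableAt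

end Gaussian

section Representation

variable {N : ℕ}

/-- Spatial coordinate direction in space-time. -/
noncomputable def eX (i : Fin N) : PSpace N := (EuclideanSpace.single i 1, 0)

/-- Time direction in space-time. -/
def eT (N : ℕ) : PSpace N := (0, 1)

/-- The spatial partial derivative `∂_i ψ` as a Schwartz function. -/
noncomputable def dX (i : Fin N) (ψ : 𝓢(PSpace N, ℝ)) : 𝓢(PSpace N, ℝ) := ∂_{eX i} ψ

/-- The time derivative `∂_t ψ` as a Schwartz function. -/
noncomputable def dT (ψ : 𝓢(PSpace N, ℝ)) : 𝓢(PSpace N, ℝ) := ∂_{eT N} ψ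

lemma dX_apply (i : Fin N) (ψ : 𝓢(PSpace N, ℝ)) (w : PSpace N) :
    dX i ψ w = fderiv ℝ ψ w (eX i) := rfl

lemma dT_apply (ψ : 𝓢(PSpace N, ℝ)) (w : PSpace N) : dT ψ w = fderiv ℝ ψ w (eT N) := rfl

lemma integrable_gauss_mul (ψ : 𝓢(PSpace N, ℝ)) {f : EuclideanSpace ℝ (Fin N) → PSpace N}
    (hf : Continuous f) : Integrable fun z => gauss z * ψ (f z) := by
  refine integrable_gauss.mul_bdd (c := SchwartzMap.seminorm ℝ 0 0 ψ)
    (ψ.continuous.comp hf).aestronglyMeasurable (.of_forall fun z => ?_)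
  exact SchwartzMap.norm_le_seminorm ℝ ψ _

lemma integrable_coord_mul_gauss_mul (ψ : 𝓢(PSpace N, ℝ))
    {f : EuclideanSpace ℝ (Fin N) → PSpace N} (hf : Continuous f) (i : Fin N) :
    Integrable fun z => z i * gauss z * ψ (f z) := by
  have h : Integrable fun z : EuclideanSpace ℝ (Fin N) => z i * gauss z := by
    refine integrable_norm_mul_gauss.mono' ?_ (.of_forall fun z => ?_)
    · exact (Continuous.mul (by fun_prop) continuous_gauss).aestronglyMeasurable
    · rw [norm_mul, Real.norm_of_nonneg (gauss_pos z).le]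
      exact mul_le_mul_of_nonneg_right (PiLp.norm_apply_le z i) (gauss_pos z).le
  refine h.mul_bdd (c := SchwartzMap.seminorm ℝ 0 0 ψ)
    (ψ.continuous.comp hf).aestronglyMeasurable (.of_forall fun z => ?_)
  exact SchwartzMap.norm_le_seminorm ℝ ψ _

/-- Parabolic Gaussian average of `ψ` at scale `r` around `w`, looking backwards in time. -/
noncomputable def gaussAvg (ψ : PSpace N → ℝ) (w : PSpace N) (r : ℝ) : ℝ :=
  ∫ z, gauss z * ψ (w.1 - r • z, w.2 - r ^ 2)

lemma continuous_gaussAvg (ψ : 𝓢(PSpace N, ℝ)) (w : PSpace N) : Continuous (gaussAvg ψ w) := by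
  refine continuous_of_dominated (bound := fun z => gauss z * SchwartzMap.seminorm ℝ 0 0 ψ)
    (fun r => (integrable_gauss_mul ψ (by fun_prop)).aestronglyMeasurable)
    (fun r => .of_forall fun z => ?_) (integrable_gauss.mul_const _) (.of_forall fun z => ?_)
  · rw [norm_mul, Real.norm_of_nonneg (gauss_pos z).le]
    exact mul_le_mul_of_nonneg_left (SchwartzMap.norm_le_seminorm ℝ ψ _) (gauss_pos z).le
  · exact continuous_const.mul (ψ.continuous.comp (by fun_prop))

lemma gaussAvg_zero (ψ : PSpace N → ℝ) (w : PSpace N) :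
    gaussAvg ψ w 0 = (∫ z, gauss (N := N) z) * ψ w := by
  simp [gaussAvg, integral_mul_const]

lemma integral_coord_mul_gauss_mul (ψ : 𝓢(PSpace N, ℝ)) (w : PSpace N) (r : ℝ) (i : Fin N) :
    ∫ z, z i * gauss z * ψ (w.1 - r • z, w.2 - r ^ 2)
      = -2 * r * gaussAvg (dX i ψ) w r := by
  set G : EuclideanSpace ℝ (Fin N) → ℝ := fun z => ψ (w.1 - r • z, w.2 - r ^ 2) with hG
  have hd : ∀ z, HasFDerivAt G ((fderiv ℝ ψ (w.1 - r • z, w.2 - r ^ 2)).comp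
      ((-(r • ContinuousLinearMap.id ℝ (EuclideanSpace ℝ (Fin N)))).prod 0)) z := by
    intro z
    refine (ψ.hasFDerivAt _).comp z (HasFDerivAt.prodMk ?_ (hasFDerivAt_const _ _))
    exact ((hasFDerivAt_id z).const_smul r).const_sub w.1
  have hd' : ∀ z, fderiv ℝ G z (EuclideanSpace.single i 1)
      = -r * (dX i ψ) (w.1 - r • z, w.2 - r ^ 2) := by
    intro z
    rw [(hd z).fderiv, dX_apply]
    have : ((-(r • EuclideanSpace.single i (1 : ℝ)), 0) : PSpace N) = (-r) • eX i := by
      ext <;> simp [eX]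
    simp only [ContinuousLinearMap.comp_apply, ContinuousLinearMap.prod_apply,
      neg_apply, smul_apply, ContinuousLinearMap.id_apply,
      zero_apply]
    rw [this, map_smul, smul_eq_mul]
  have hc : Continuous fun z : EuclideanSpace ℝ (Fin N) => (w.1 - r • z, w.2 - r ^ 2) := by fun_prop
  have key := integral_mul_fderiv_eq_neg_fderiv_mul_of_integrable (μ := volume)
    (f := gauss (N := N)) (g := G) (v := EuclideanSpace.single i 1) ?_ ?_
    (integrable_gauss_mul ψ hc) (fun z _ => differentiable_gauss z)
    (fun z _ => (hd z).differentiableAt)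
  · simp only [fderiv_gauss, hd'] at key
    have h1 : ∀ z : EuclideanSpace ℝ (Fin N), gauss z *
        (-r * (dX i ψ) (w.1 - r • z, w.2 - r ^ 2))
        = -r * (gauss z * (dX i ψ) (w.1 - r • z, w.2 - r ^ 2)) :=
      fun z => by ring
    have h2 : ∀ z : EuclideanSpace ℝ (Fin N), -(1 / 2) * (z i * gauss z) * G z
        = -(1 / 2) * (z i * gauss z * G z) := fun z => by ring
    simp only [h1, h2, integral_const_mul] at key
    simp only [gaussAvg, hG] at key ⊢
    linarith
  · simp only [fderiv_gauss, mul_assoc]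
    simpa only [mul_assoc] using (integrable_coord_mul_gauss_mul ψ hc i).const_mul (-(1 / 2))
  · simp only [hd']
    simpa only [mul_assoc, mul_left_comm] using
      (integrable_gauss_mul (dX i ψ) hc).const_mul (-r)

lemma vec_decomp (z : EuclideanSpace ℝ (Fin N)) (a : ℝ) :
    ((-z, a) : PSpace N) = a • eT N - ∑ i, z i • eX i := by
  ext j
  · simp [eT, eX, Prod.fst_sum, Pi.single_apply]
  · simp [eT, eX, Prod.snd_sum]

lemma hasDerivAt_path (ψ : 𝓢(PSpace N, ℝ)) (w : PSpace N) (z : EuclideanSpace ℝ (Fin N)) (r : ℝ) :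
    HasDerivAt (fun r : ℝ => ψ (w.1 - r • z, w.2 - r ^ 2))
      (-2 * r * (dT ψ) (w.1 - r • z, w.2 - r ^ 2)
        - ∑ i, z i * (dX i ψ) (w.1 - r • z, w.2 - r ^ 2)) r := by
  have h1 : HasDerivAt (fun r : ℝ => ((w.1 - r • z, w.2 - r ^ 2) : PSpace N))
      (-z, -2 * r) r := by
    refine HasDerivAt.prodMk ?_ ?_
    · simpa using ((hasDerivAt_id r).smul_const z).const_sub w.1
    · simpa using (hasDerivAt_pow 2 r).const_sub w.2
  have h2 := (ψ.hasFDerivAt (w.1 - r • z, w.2 - r ^ 2)).comp_hasDerivAt r h1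
  refine h2.congr_deriv ?_
  symm
  rw [vec_decomp, map_sub, map_smul, map_sum]
  simp [dX_apply, dT_apply]

lemma hasDerivAt_gaussAvg (ψ : 𝓢(PSpace N, ℝ)) (w : PSpace N) (r : ℝ) :
    HasDerivAt (gaussAvg ψ w)
      (2 * r * (∑ i, gaussAvg (dX i (dX i ψ)) w r
        - gaussAvg (dT ψ) w r)) r := by
  set CT := SchwartzMap.seminorm ℝ 0 0 (dT ψ) with hCT
  set CX := fun i : Fin N => SchwartzMap.seminorm ℝ 0 0 (dX i ψ) with hCX
  have hc : ∀ r : ℝ, Continuous fun z : EuclideanSpace ℝ (Fin N) =>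
    ((w.1 - r • z, w.2 - r ^ 2) : PSpace N) := fun r => by fun_prop
  have hint : ∀ i, Integrable fun z : EuclideanSpace ℝ (Fin N) => z i * gauss z *
      (dX i ψ) (w.1 - r • z, w.2 - r ^ 2) :=
    fun i => integrable_coord_mul_gauss_mul _ (hc r) i
  have hintT := (integrable_gauss_mul (dT ψ) (hc r)).const_mul (-2 * r)
  have h := (hasDerivAt_integral_of_dominated_loc_of_deriv_le (μ := volume)
    (F := fun r (z : EuclideanSpace ℝ (Fin N)) => gauss z * ψ (w.1 - r • z, w.2 - r ^ 2))
    (F' := fun r z => gauss z *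
      (-2 * r * (dT ψ) (w.1 - r • z, w.2 - r ^ 2)
        - ∑ i, z i * (dX i ψ) (w.1 - r • z, w.2 - r ^ 2)))
    (bound := fun z => gauss z * (2 * (|r| + 1) * CT) + ‖z‖ * gauss z * ∑ i, CX i)
    (x₀ := r) (Metric.ball_mem_nhds r one_pos)
    (.of_forall fun r => (integrable_gauss_mul ψ (hc r)).aestronglyMeasurable)
    (integrable_gauss_mul ψ (hc r)) ?_ (.of_forall fun z s hs => ?_)
    ((integrable_gauss.mul_const _).add (integrable_norm_mul_gauss.mul_const _))
    (.of_forall fun z s _ => (hasDerivAt_path ψ w z s).const_mul _)).2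
  · refine h.congr_deriv ?_
    have : ∀ z : EuclideanSpace ℝ (Fin N), gauss z *
      (-2 * r * (dT ψ) (w.1 - r • z, w.2 - r ^ 2)
        - ∑ i, z i * (dX i ψ) (w.1 - r • z, w.2 - r ^ 2))
      = -2 * r * (gauss z * (dT ψ) (w.1 - r • z, w.2 - r ^ 2))
        - ∑ i, z i * gauss z * (dX i ψ) (w.1 - r • z, w.2 - r ^ 2) := by
      intro z
      rw [mul_sub, Finset.mul_sum]
      congr 1
      · ring
      · exact Finset.sum_congr rfl fun i _ => by ring
    rw [integral_congr_ae (.of_forall this), integral_sub hintT (integrable_finsetSum _ fun i _ => hint i),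
      integral_finsetSum _ fun i _ => hint i, integral_const_mul]
    simp only [integral_coord_mul_gauss_mul, ← Finset.mul_sum]
    simp only [gaussAvg]
    ring
  · refine Continuous.aestronglyMeasurable (continuous_gauss.mul (Continuous.sub ?_ ?_))
    · exact continuous_const.mul ((SchwartzMap.continuous _).comp (hc r))
    · exact continuous_finsetSum _ fun i _ =>
        Continuous.mul (by fun_prop) ((SchwartzMap.continuous _).comp (hc r))
  · rw [norm_mul, Real.norm_of_nonneg (gauss_pos z).le]
    have hs' : |s| ≤ |r| + 1 := by
      have h1 : |s - r| < 1 := by simpa [Real.dist_eq] using hs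
      have h2 := abs_add_le (s - r) r
      rw [sub_add_cancel] at h2
      linarith
    have hT : ‖-2 * s * (dT ψ) (w.1 - s • z, w.2 - s ^ 2)‖
        ≤ 2 * (|r| + 1) * CT := by
      rw [norm_mul]
      refine mul_le_mul ?_ (SchwartzMap.norm_le_seminorm ℝ _ _) (norm_nonneg _) (by positivity)
      simpa [abs_mul] using hs'
    have hX : ‖∑ i, z i * (dX i ψ) (w.1 - s • z, w.2 - s ^ 2)‖
        ≤ ‖z‖ * ∑ i, CX i := by
      rw [Finset.mul_sum]
      refine (norm_sum_le _ _).trans (Finset.sum_le_sum fun i _ => ?_)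
      rw [norm_mul]
      exact mul_le_mul (PiLp.norm_apply_le z i) (SchwartzMap.norm_le_seminorm ℝ _ _)
        (norm_nonneg _) (norm_nonneg _)
    calc _ ≤ gauss z * (2 * (|r| + 1) * CT + ‖z‖ * ∑ i, CX i) :=
          mul_le_mul_of_nonneg_left ((norm_sub_le _ _).trans (add_le_add hT hX)) (gauss_pos z).le
      _ = _ := by ring

/-- The pointwise quantity `|ψ| + |∂_t ψ| + ∑ |∂_{ii} ψ|`. -/
noncomputable def source (ψ : 𝓢(PSpace N, ℝ)) (w : PSpace N) : ℝ :=
  |ψ w| + |(dT ψ) w|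
    + ∑ i, |(dX i (dX i ψ)) w|

lemma continuous_source (ψ : 𝓢(PSpace N, ℝ)) : Continuous (source ψ) :=
  ((SchwartzMap.continuous _).abs.add (SchwartzMap.continuous _).abs).add
    (continuous_finsetSum _ fun _ _ => (SchwartzMap.continuous _).abs)

lemma source_nonneg (ψ : 𝓢(PSpace N, ℝ)) (w : PSpace N) : 0 ≤ source ψ w := by
  unfold source; positivity

lemma integral_gauss_mul_eq (ψ : 𝓢(PSpace N, ℝ)) (w : PSpace N) :
    (∫ z, gauss (N := N) z) * ψ w = ∫ s in (0 : ℝ)..1, (gaussAvg ψ w √s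
      + (1 - s) * (gaussAvg (dT ψ) w √s
        - ∑ i, gaussAvg (dX i (dX i ψ)) w √s)) := by
  set H : ℝ → ℝ := fun s => gaussAvg ψ w √s
      + (1 - s) * (gaussAvg (dT ψ) w √s
        - ∑ i, gaussAvg (dX i (dX i ψ)) w √s) with hH
  have hHc : Continuous H := by
    have hA : ∀ η : 𝓢(PSpace N, ℝ), Continuous fun s => gaussAvg η w √s :=
      fun η => (continuous_gaussAvg η w).comp Real.continuous_sqrt
    exact (hA _).add ((continuous_const.sub continuous_id).mul
      ((hA _).sub (continuous_finsetSum _ fun i _ => hA _)))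
  have key := intervalIntegral.integral_eq_sub_of_hasDerivAt_of_le (zero_le_one' ℝ)
    (f := fun s => (1 - s) * gaussAvg ψ w √s) (f' := fun s => -H s)
    (((continuous_const.sub continuous_id).mul
      ((continuous_gaussAvg ψ w).comp Real.continuous_sqrt)).continuousOn) ?_
    (hHc.neg.intervalIntegrable _ _)
  · rw [intervalIntegral.integral_neg] at key
    simp only [sub_self, zero_mul, sub_zero, one_mul, Real.sqrt_zero, gaussAvg_zero] at key
    linarith
  · intro s hs
    have h1 := (hasDerivAt_gaussAvg ψ w √s).comp s (Real.hasDerivAt_sqrt hs.1.ne')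
    have h2 := ((hasDerivAt_id s).const_sub 1).mul h1
    refine h2.congr_deriv ?_
    have : √s ≠ 0 := (Real.sqrt_pos.2 hs.1).ne'
    simp only [hH, id_eq, Function.comp]
    field_simp
    ring

lemma integrable_gauss_mul_abs (ψ : 𝓢(PSpace N, ℝ)) (w : PSpace N) (r : ℝ) :
    Integrable fun z : EuclideanSpace ℝ (Fin N) => gauss z * |ψ (w.1 - r • z, w.2 - r ^ 2)| := by
  simpa [abs_mul, abs_of_pos (gauss_pos _)] using
    (integrable_gauss_mul ψ (f := fun z => (w.1 - r • z, w.2 - r ^ 2)) (by fun_prop)).abs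

lemma gaussAvg_source (ψ : 𝓢(PSpace N, ℝ)) (w : PSpace N) (r : ℝ) :
    gaussAvg (source ψ) w r = gaussAvg (fun v => |ψ v|) w r
      + gaussAvg (fun v => |(dT ψ) v|) w r
      + ∑ i, gaussAvg (fun v => |(dX i (dX i ψ)) v|) w r := by
  simp only [gaussAvg, source, mul_add, Finset.mul_sum]
  have h0 := integrable_gauss_mul_abs ψ w r
  have h1 := integrable_gauss_mul_abs (dT ψ) w r
  have h2 := fun i => integrable_gauss_mul_abs (dX i (dX i ψ)) w r
  rw [integral_add (by exact h0.add h1) (integrable_finsetSum _ fun i _ => h2 i),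
    integral_add h0 h1, integral_finsetSum _ fun i _ => h2 i]

lemma abs_gaussAvg_le (ψ : PSpace N → ℝ) (w : PSpace N) (r : ℝ) :
    |gaussAvg ψ w r| ≤ gaussAvg (fun v => |ψ v|) w r := by
  refine (abs_integral_le_integral_abs).trans_eq ?_
  simp [gaussAvg, abs_mul, abs_of_pos (gauss_pos _)]

lemma integrable_gauss_mul_source (ψ : 𝓢(PSpace N, ℝ)) (w : PSpace N) (r : ℝ) :
    Integrable fun z : EuclideanSpace ℝ (Fin N) =>
      gauss z * source ψ (w.1 - r • z, w.2 - r ^ 2) := by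
  simp only [source, mul_add, Finset.mul_sum]
  exact ((integrable_gauss_mul_abs _ _ _).add (integrable_gauss_mul_abs _ _ _)).add
    (integrable_finsetSum _ fun i _ => integrable_gauss_mul_abs _ _ _)

lemma ofReal_integral_gauss_mul_le (ψ : 𝓢(PSpace N, ℝ)) (w : PSpace N) :
    ENNReal.ofReal ((∫ z, gauss (N := N) z) * ψ w) ≤ ∫⁻ s in Ioc (0 : ℝ) 1,
      ∫⁻ z, ENNReal.ofReal (gauss z) * ENNReal.ofReal (source ψ (w.1 - √s • z, w.2 - s)) := by
  rw [integral_gauss_mul_eq, intervalIntegral.integral_of_le zero_le_one]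
  refine (ENNReal.ofReal_le_ofReal (le_abs_self _)).trans ?_
  rw [← Real.enorm_eq_ofReal_abs]
  refine (enorm_integral_le_lintegral_enorm _).trans
    (setLIntegral_mono' measurableSet_Ioc fun s hs => ?_)
  have hle : |gaussAvg ψ w √s + (1 - s) * (gaussAvg (dT ψ) w √s
      - ∑ i, gaussAvg (dX i (dX i ψ)) w √s)|
      ≤ gaussAvg (source ψ) w √s := by
    rw [gaussAvg_source]
    have h1 := abs_gaussAvg_le ψ w √s
    have h2 := abs_gaussAvg_le (dT ψ) w √s
    have h3 : |∑ i, gaussAvg (dX i (dX i ψ)) w √s|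
        ≤ ∑ i, gaussAvg (fun v => |(dX i (dX i ψ)) v|) w √s :=
      (Finset.abs_sum_le_sum_abs _ _).trans (Finset.sum_le_sum fun i _ => abs_gaussAvg_le _ _ _)
    refine (abs_add_le _ _).trans ?_
    rw [abs_mul, abs_of_nonneg (sub_nonneg.2 hs.2), add_assoc]
    refine add_le_add h1 ?_
    refine (mul_le_of_le_one_left (abs_nonneg _) (by linarith [hs.1])).trans ?_
    exact (abs_sub _ _).trans (add_le_add h2 h3)
  rw [Real.enorm_eq_ofReal_abs]
  refine (ENNReal.ofReal_le_ofReal hle).trans_eq ?_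
  rw [gaussAvg, ofReal_integral_eq_lintegral_ofReal (integrable_gauss_mul_source ψ w √s)
    (.of_forall fun z => mul_nonneg (gauss_pos z).le (source_nonneg _ _))]
  simp only [ENNReal.ofReal_mul (gauss_pos _).le, Real.sq_sqrt hs.1.le]

end Representation

section Potential

variable {N : ℕ}

lemma lintegral_comp_sub_smul (f : EuclideanSpace ℝ (Fin N) → ℝ≥0∞) (hf : Measurable f)
    (x : EuclideanSpace ℝ (Fin N)) {r : ℝ} (hr : 0 < r) :
    ENNReal.ofReal (r ^ N) * ∫⁻ z, f (x - r • z) = ∫⁻ y, f y := by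
  have h1 : ∫⁻ z, f (x - r • z) = ∫⁻ y, f (x - y) ∂(Measure.map (r • ·) volume) :=
    (lintegral_map (hf.comp (measurable_const.sub measurable_id)) (measurable_const_smul r)).symm
  rw [h1, Measure.map_addHaar_smul volume hr.ne', lintegral_smul_measure,
    lintegral_sub_left_eq_self, finrank_euclideanSpace_fin, abs_of_pos (by positivity),
    smul_eq_mul, ← mul_assoc, ← ENNReal.ofReal_mul (by positivity),
    mul_inv_cancel₀ (by positivity), ENNReal.ofReal_one, one_mul]

lemma setLIntegral_sub_le {F : PSpace N → ℝ≥0∞} (hF : Measurable F) {p q : ℝ}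
    (hpq : p.HolderConjugate q) (K : Set (PSpace N)) (v : PSpace N) :
    ∫⁻ w in K, F (w - v) ≤ volume K ^ (1 / q) * (∫⁻ w, F w ^ p) ^ (1 / p) := by
  have h := ENNReal.lintegral_mul_le_Lp_mul_Lq (volume.restrict K) hpq
    (f := fun w => F (w - v)) (g := fun _ => 1)
    (hF.comp (measurable_id.sub_const v)).aemeasurable aemeasurable_const
  simp only [Pi.mul_apply, mul_one, ENNReal.one_rpow, lintegral_const, one_mul,
    Measure.restrict_apply_univ] at h
  rw [mul_comm]
  refine h.trans (mul_le_mul_left ?_ _)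
  refine ENNReal.rpow_le_rpow ?_ (one_div_nonneg.2 hpq.nonneg)
  have : (volume : Measure (PSpace N)).IsAddRightInvariant :=
    inferInstanceAs ((volume : Measure (EuclideanSpace ℝ (Fin N))).prod
      (volume : Measure ℝ)).IsAddRightInvariant
  exact (setLIntegral_le_lintegral _ _).trans_eq (lintegral_sub_right_eq_self (fun w => F w ^ p) v)

lemma measurable_gauss_ofReal :
    Measurable fun z : EuclideanSpace ℝ (Fin N) => ENNReal.ofReal (gauss z) :=
  continuous_gauss.measurable.ennreal_ofReal

lemma measurable_potential_integrand {F : PSpace N → ℝ≥0∞} (hF : Measurable F) :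
    Measurable fun a : (PSpace N × ℝ) × EuclideanSpace ℝ (Fin N) =>
      ENNReal.ofReal (gauss a.2) * F (a.1.1.1 - √a.1.2 • a.2, a.1.1.2 - a.1.2) := by
  refine (measurable_gauss_ofReal.comp measurable_snd).mul (hF.comp ?_)
  fun_prop

lemma setLIntegral_potential_near_le {F : PSpace N → ℝ≥0∞} (hF : Measurable F) {p q : ℝ}
    (hpq : p.HolderConjugate q) (K : Set (PSpace N)) {δ : ℝ} :
    ∫⁻ w in K, ∫⁻ s in Ioc 0 δ, ∫⁻ z,
        ENNReal.ofReal (gauss z) * F (w.1 - √s • z, w.2 - s)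
      ≤ ENNReal.ofReal δ * ((∫⁻ z : EuclideanSpace ℝ (Fin N), ENNReal.ofReal (gauss z))
        * (volume K ^ (1 / q) * (∫⁻ w, F w ^ p) ^ (1 / p))) := by
  rw [lintegral_lintegral_swap
    (measurable_potential_integrand hF).lintegral_prod_right'.aemeasurable]
  refine (setLIntegral_mono' measurableSet_Ioc (g := fun _ =>
    (∫⁻ z : EuclideanSpace ℝ (Fin N), ENNReal.ofReal (gauss z))
        * (volume K ^ (1 / q) * (∫⁻ w, F w ^ p) ^ (1 / p))) fun s _ => ?_).trans_eq ?_
  · have hm' : Measurable fun a : PSpace N × EuclideanSpace ℝ (Fin N) =>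
        ENNReal.ofReal (gauss a.2) * F (a.1.1 - √s • a.2, a.1.2 - s) :=
      (measurable_gauss_ofReal.comp measurable_snd).mul (hF.comp (by fun_prop))
    rw [lintegral_lintegral_swap hm'.aemeasurable,
      ← lintegral_mul_const _ measurable_gauss_ofReal]
    refine lintegral_mono fun z => ?_
    rw [lintegral_const_mul' _ _ ENNReal.ofReal_ne_top]
    exact mul_le_mul_right (setLIntegral_sub_le hF hpq K (√s • z, s)) _
  · rw [setLIntegral_const, Real.volume_Ioc, sub_zero, mul_comm]

lemma setLIntegral_inv {δ : ℝ} (hδ : 0 < δ) (hδ1 : δ ≤ 1) :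
    ∫⁻ s in Ioc δ 1, ENNReal.ofReal s⁻¹ = ENNReal.ofReal (Real.log (1 / δ)) := by
  rw [← integral_inv_of_pos hδ one_pos, intervalIntegral.integral_of_le hδ1,
    ofReal_integral_eq_lintegral_ofReal]
  · refine (intervalIntegrable_iff_integrableOn_Ioc_of_le hδ1).1 ?_
    exact intervalIntegrable_inv_iff.2
      (Or.inr (notMem_uIcc_of_lt hδ one_pos))
  · exact (ae_restrict_iff' measurableSet_Ioc).2 (.of_forall fun s hs =>
      inv_nonneg.2 (hδ.le.trans hs.1.le))

lemma potential_far_le {F : PSpace N → ℝ≥0∞} (hF : Measurable F) {p q : ℝ}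
    (hpq : p.HolderConjugate q) (hpN : p / q = N / 2) (w : PSpace N) {δ : ℝ} (hδ : 0 < δ)
    (hδ1 : δ ≤ 1) :
    ∫⁻ s in Ioc δ 1, ∫⁻ z, ENNReal.ofReal (gauss z) * F (w.1 - √s • z, w.2 - s)
      ≤ (∫⁻ w, F w ^ p) ^ (1 / p)
        * (ENNReal.ofReal (Real.log (1 / δ))
          * ∫⁻ z : EuclideanSpace ℝ (Fin N), ENNReal.ofReal (gauss z)) ^ (1 / q) := by
  set a : ℝ × EuclideanSpace ℝ (Fin N) → ℝ≥0∞ := fun y =>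
    ENNReal.ofReal (y.1 ^ (1 / q)) * F (w.1 - √y.1 • y.2, w.2 - y.1) with ha
  set b : ℝ × EuclideanSpace ℝ (Fin N) → ℝ≥0∞ := fun y =>
    ENNReal.ofReal (y.1 ^ (-(1 / q))) * ENNReal.ofReal (gauss y.2) with hb
  set μ := ((volume : Measure ℝ).restrict (Ioc δ 1)).prod
    (volume : Measure (EuclideanSpace ℝ (Fin N))) with hμ
  have hFm : Measurable fun y : ℝ × EuclideanSpace ℝ (Fin N) =>
      F (w.1 - √y.1 • y.2, w.2 - y.1) := hF.comp (by fun_prop)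
  have ham : Measurable a := Measurable.mul (by fun_prop) hFm
  have hbm : Measurable b :=
    Measurable.mul (by fun_prop) (measurable_gauss_ofReal.comp measurable_snd)
  have hp0 := hpq.pos
  have hq0 := hpq.symm.pos
  have h1 : ∫⁻ s in Ioc δ 1, ∫⁻ z, ENNReal.ofReal (gauss z) * F (w.1 - √s • z, w.2 - s)
      = ∫⁻ y, (a * b) y ∂μ := by
    rw [hμ, lintegral_prod _ (ham.mul hbm).aemeasurable]
    refine setLIntegral_congr_fun measurableSet_Ioc fun s hs => lintegral_congr fun z => ?_
    have hs0 : 0 < s := hδ.trans hs.1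
    have : ENNReal.ofReal (s ^ (1 / q)) * ENNReal.ofReal (s ^ (-(1 / q))) = 1 := by
      rw [← ENNReal.ofReal_mul (by positivity), ← Real.rpow_add hs0, add_neg_cancel,
        Real.rpow_zero, ENNReal.ofReal_one]
    simp only [ha, hb, Pi.mul_apply]
    rw [mul_mul_mul_comm, this, one_mul, mul_comm]
  have h2 : ∫⁻ y, a y ^ p ∂μ ≤ ∫⁻ w, F w ^ p := by
    rw [hμ, lintegral_prod _ (ham.pow_const p).aemeasurable, Measure.volume_eq_prod,
      lintegral_prod_symm _ (hF.pow_const p).aemeasurable,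
      ← lintegral_sub_left_eq_self (fun t => ∫⁻ x, F (x, t) ^ p) w.2]
    refine (setLIntegral_mono' measurableSet_Ioc fun s hs => ?_).trans
      (setLIntegral_le_lintegral (Ioc δ 1) _)
    have hs0 : 0 < s := hδ.trans hs.1
    have hpow : √s ^ N = s ^ (p / q) := by
      rw [hpN, Real.sqrt_eq_rpow, ← Real.rpow_natCast, ← Real.rpow_mul hs0.le]
      congr 1; ring
    have hFs : Measurable fun x : EuclideanSpace ℝ (Fin N) => F (x, w.2 - s) ^ p :=
      (hF.comp (by fun_prop)).pow_const p
    rw [← lintegral_comp_sub_smul _ hFs w.1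
      (Real.sqrt_pos.2 hs0), hpow, ← lintegral_const_mul' _ _ ENNReal.ofReal_ne_top]
    refine lintegral_mono fun z => ?_
    simp only [ha]
    rw [ENNReal.mul_rpow_of_nonneg _ _ hp0.le, ENNReal.ofReal_rpow_of_nonneg (by positivity) hp0.le,
      ← Real.rpow_mul hs0.le, one_div_mul_eq_div]
  have h3 : ∫⁻ y, b y ^ q ∂μ ≤ ENNReal.ofReal (Real.log (1 / δ))
          * ∫⁻ z : EuclideanSpace ℝ (Fin N), ENNReal.ofReal (gauss z) := by
    rw [hμ, lintegral_prod _ (hbm.pow_const q).aemeasurable, ← setLIntegral_inv hδ hδ1,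
      ← lintegral_mul_const _ (by fun_prop)]
    refine setLIntegral_mono' measurableSet_Ioc fun s hs => ?_
    have hs0 : 0 < s := hδ.trans hs.1
    rw [← lintegral_const_mul _ measurable_gauss_ofReal]
    refine lintegral_mono fun z => ?_
    simp only [hb]
    rw [ENNReal.mul_rpow_of_nonneg _ _ hq0.le, ENNReal.ofReal_rpow_of_nonneg (by positivity) hq0.le,
      ← Real.rpow_mul hs0.le]
    have : -(1 / q) * q = -1 := by field_simp
    rw [this, Real.rpow_neg_one]
    refine mul_le_mul_right ?_ _
    calc ENNReal.ofReal (gauss z) ^ q ≤ ENNReal.ofReal (gauss z) ^ (1 : ℝ) :=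
          ENNReal.rpow_le_rpow_of_exponent_ge
            (ENNReal.ofReal_le_one.2 (gauss_le_one z)) hpq.symm.lt.le
      _ = _ := ENNReal.rpow_one _
  rw [h1]
  refine (ENNReal.lintegral_mul_le_Lp_mul_Lq μ hpq ham.aemeasurable hbm.aemeasurable).trans ?_
  exact mul_le_mul' (ENNReal.rpow_le_rpow h2 (by positivity))
    (ENNReal.rpow_le_rpow h3 (by positivity))

end Potential

section Capacity

variable {N : ℕ}

lemma lintegral_gauss :
    ∫⁻ z : EuclideanSpace ℝ (Fin N), ENNReal.ofReal (gauss z)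
      = ENNReal.ofReal (∫ z : EuclideanSpace ℝ (Fin N), gauss z) :=
  (ofReal_integral_eq_lintegral_ofReal integrable_gauss
    (.of_forall fun z => (gauss_pos z).le)).symm

lemma eLpNorm_source (ψ : 𝓢(PSpace N, ℝ)) {p : ℝ} (hp : 0 < p) :
    (∫⁻ w, ENNReal.ofReal (source ψ w) ^ p) ^ (1 / p)
      = eLpNorm (source ψ) (ENNReal.ofReal p) volume := by
  rw [eLpNorm_eq_lintegral_rpow_enorm_toReal (ENNReal.ofReal_pos.2 hp).ne' ENNReal.ofReal_ne_top,
    ENNReal.toReal_ofReal hp.le]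
  simp only [Real.enorm_of_nonneg (source_nonneg ψ _)]

lemma integral_gauss_mul_volume_le (ψ : 𝓢(PSpace N, ℝ)) {p q : ℝ} (hpq : p.HolderConjugate q)
    (hpN : p / q = N / 2) {K : Set (PSpace N)} (hK : MeasurableSet K)
    (hψ : ∀ w ∈ K, 1 ≤ ψ w) {δ : ℝ} (hδ : 0 < δ) (hδ1 : δ ≤ 1) :
    ENNReal.ofReal (∫ z, gauss (N := N) z) * volume K
      ≤ ENNReal.ofReal δ * (ENNReal.ofReal (∫ z, gauss (N := N) z)
          * (volume K ^ (1 / q) * eLpNorm (source ψ) (ENNReal.ofReal p) volume))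
        + eLpNorm (source ψ) (ENNReal.ofReal p) volume
          * (ENNReal.ofReal (Real.log (1 / δ)) * ENNReal.ofReal (∫ z, gauss (N := N) z)) ^ (1 / q)
          * volume K := by
  set F : PSpace N → ℝ≥0∞ := fun w => ENNReal.ofReal (source ψ w) with hFdef
  have hF : Measurable F := (continuous_source ψ).measurable.ennreal_ofReal
  have hinner : Measurable fun a : PSpace N × ℝ => ∫⁻ z,
      ENNReal.ofReal (gauss z) * F (a.1.1 - √a.2 • z, a.1.2 - a.2) :=
    (measurable_potential_integrand hF).lintegral_prod_right'
  calc ENNReal.ofReal (∫ z, gauss (N := N) z) * volume K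
      = ∫⁻ _ in K, ENNReal.ofReal (∫ z, gauss (N := N) z) := (setLIntegral_const _ _).symm
    _ ≤ ∫⁻ w in K, ((∫⁻ s in Ioc 0 δ, ∫⁻ z,
          ENNReal.ofReal (gauss z) * F (w.1 - √s • z, w.2 - s))
        + ∫⁻ s in Ioc δ 1, ∫⁻ z,
          ENNReal.ofReal (gauss z) * F (w.1 - √s • z, w.2 - s)) := by
        refine setLIntegral_mono' hK fun w hw => ?_
        rw [← lintegral_union measurableSet_Ioc (Ioc_disjoint_Ioc_of_le le_rfl),
          Ioc_union_Ioc_eq_Ioc hδ.le hδ1]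
        refine le_trans ?_ (ofReal_integral_gauss_mul_le ψ w)
        exact ENNReal.ofReal_le_ofReal
          (le_mul_of_one_le_right integral_gauss_pos.le (hψ w hw))
    _ = (∫⁻ w in K, ∫⁻ s in Ioc 0 δ, ∫⁻ z,
          ENNReal.ofReal (gauss z) * F (w.1 - √s • z, w.2 - s))
        + ∫⁻ w in K, ∫⁻ s in Ioc δ 1, ∫⁻ z,
          ENNReal.ofReal (gauss z) * F (w.1 - √s • z, w.2 - s) :=
        lintegral_add_left hinner.lintegral_prod_right' _
    _ ≤ _ := by
        rw [← eLpNorm_source ψ hpq.pos, ← lintegral_gauss]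
        refine add_le_add (setLIntegral_potential_near_le hF hpq K) ?_
        refine (setLIntegral_mono' hK fun w _ => potential_far_le hF hpq hpN w hδ hδ1).trans_eq ?_
        rw [setLIntegral_const]

/-- The choice `δ = (k / V) ^ (1 / p)` balances the two parts of the potential estimate. -/
lemma le_rpow_of_balance {c k V I p q l : ℝ} (hpq : p.HolderConjugate q) (hc : 0 < c)
    (hk : 0 < k) (hkV : k ≤ V) (hI : 0 ≤ I) (hl : 0 < l) (hlV : l ≤ Real.log (V / k))
    (h : ∀ δ : ℝ, 0 < δ → δ ≤ 1 → c * k ≤ δ * (c * (k ^ (1 / q) * I))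
      + I * (Real.log (1 / δ) * c) ^ (1 / q) * k) :
    (c / (c * V ^ (-(1 / p)) * l ^ (-(1 / q)) + (c / p) ^ (1 / q))) ^ p
      * Real.log (V / k) ^ (-(p / q)) ≤ I ^ p := by
  have hp := hpq.pos
  have hq := hpq.symm.pos
  have hV : 0 < V := hk.trans_le hkV
  set L := Real.log (V / k) with hL
  have hL0 : 0 < L := hl.trans_le hlV
  set D := c * V ^ (-(1 / p)) * l ^ (-(1 / q)) + (c / p) ^ (1 / q) with hD
  have hD0 : 0 < D := by positivity
  have hδ := h ((k / V) ^ (1 / p)) (by positivity)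
    (Real.rpow_le_one (by positivity) ((div_le_one hV).2 hkV) (by positivity))
  have hlog : Real.log (1 / (k / V) ^ (1 / p)) = L / p := by
    rw [one_div, ← Real.inv_rpow (by positivity), inv_div, Real.log_rpow (by positivity), hL]
    ring
  have hkp : (k / V) ^ (1 / p) * k ^ (1 / q) = V ^ (-(1 / p)) * k := by
    rw [Real.div_rpow hk.le hV.le, Real.rpow_neg hV.le, div_mul_eq_mul_div, ← Real.rpow_add hk,
      one_div, one_div, hpq.inv_add_inv_eq_one, Real.rpow_one]
    ring
  have hLq : 1 ≤ l ^ (-(1 / q)) * L ^ (1 / q) := by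
    rw [Real.rpow_neg hl.le, inv_mul_eq_div, ← Real.div_rpow hL0.le hl.le]
    exact Real.one_le_rpow ((one_le_div hl).2 hlV) (by positivity)
  have hmain : c ≤ I * (D * L ^ (1 / q)) := by
    rw [hlog] at hδ
    have e1 : L / p * c = c / p * L := by ring
    rw [e1, Real.mul_rpow (by positivity) hL0.le] at hδ
    have e2 : (k / V) ^ (1 / p) * (c * (k ^ (1 / q) * I))
        = k * (I * (c * V ^ (-(1 / p)))) := by
      linear_combination (c * I) * hkp
    rw [e2] at hδ
    have h1 : c ≤ I * (c * V ^ (-(1 / p))) + I * ((c / p) ^ (1 / q) * L ^ (1 / q)) := by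
      refine le_of_mul_le_mul_left ?_ hk
      linarith
    have h2 : I * (c * V ^ (-(1 / p))) ≤
        I * (c * V ^ (-(1 / p))) * (l ^ (-(1 / q)) * L ^ (1 / q)) :=
      le_mul_of_one_le_right (by positivity) hLq
    rw [hD]
    linarith
  have h3 : c / D * L ^ (-(1 / q)) ≤ I := by
    rw [Real.rpow_neg hL0.le, ← div_eq_mul_inv, div_div, div_le_iff₀ (by positivity)]
    exact hmain
  calc (c / D) ^ p * L ^ (-(p / q)) = (c / D * L ^ (-(1 / q))) ^ p := by
        rw [Real.mul_rpow (by positivity) (by positivity), ← Real.rpow_mul hL0.le]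
        congr 2
        ring
    _ ≤ I ^ p := Real.rpow_le_rpow (by positivity) h3 hp.le

lemma tDeriv_eq (ψ : 𝓢(PSpace N, ℝ)) : tDeriv (fun z => ψ z) = fun z => dT ψ z := by
  funext z
  have h1 : HasDerivAt (fun s : ℝ => ((z.1, s) : PSpace N)) (eT N) z.2 :=
    (hasDerivAt_const _ _).prodMk (hasDerivAt_id _)
  rw [dT_apply]
  exact ((ψ.differentiableAt (x := z)).hasFDerivAt.comp_hasDerivAt z.2 h1).deriv

lemma xDeriv_eq (i : Fin N) (ψ : 𝓢(PSpace N, ℝ)) :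
    xDeriv i (fun z => ψ z) = fun z => dX i ψ z := by
  funext z
  have h1 : HasFDerivAt (fun y => ((y, z.2) : PSpace N))
      (ContinuousLinearMap.inl ℝ (EuclideanSpace ℝ (Fin N)) ℝ) z.1 :=
    hasFDerivAt_prodMk_left z.1 z.2
  have h2 := (ψ.differentiableAt (x := z)).hasFDerivAt.comp z.1 h1
  rw [dX_apply]
  exact (h2.hasLineDerivAt (EuclideanSpace.single i 1)).lineDeriv

lemma xxDeriv_eq (i j : Fin N) (ψ : 𝓢(PSpace N, ℝ)) :
    xxDeriv i j (fun z => ψ z) = fun z => dX i (dX j ψ) z := by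
  rw [← xDeriv_eq, ← xDeriv_eq]
  rfl

lemma eLpNorm_ne_top (η : 𝓢(PSpace N, ℝ)) (p : ℝ≥0∞) : eLpNorm η p volume ≠ ⊤ := by
  have : (volume : Measure (PSpace N)).IsAddHaarMeasure :=
    inferInstanceAs ((volume : Measure (EuclideanSpace ℝ (Fin N))).prod
      (volume : Measure ℝ)).IsAddHaarMeasure
  exact (η.eLpNorm_lt_top _ volume).ne

lemma eLpNorm_source_le_add (ψ : 𝓢(PSpace N, ℝ)) {p : ℝ} (hp : 1 ≤ p) :
    eLpNorm (source ψ) (ENNReal.ofReal p) volume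
      ≤ eLpNorm ψ (ENNReal.ofReal p) volume + eLpNorm (dT ψ) (ENNReal.ofReal p) volume
        + ∑ i, eLpNorm (dX i (dX i ψ)) (ENNReal.ofReal p) volume := by
  have hp' : 1 ≤ ENNReal.ofReal p := ENNReal.one_le_ofReal.2 hp
  have hm : ∀ η : 𝓢(PSpace N, ℝ), AEStronglyMeasurable (fun w => |η w|) volume := fun η =>
    η.continuous.abs.aestronglyMeasurable
  have habs : ∀ η : 𝓢(PSpace N, ℝ), eLpNorm (fun w => |η w|) (ENNReal.ofReal p) volume
      = eLpNorm η (ENNReal.ofReal p) volume := fun η => eLpNorm_norm η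
  have hs : source ψ = (fun w => |ψ w|) + (fun w => |dT ψ w|)
      + ∑ i, fun w => |dX i (dX i ψ) w| := by
    funext w
    simp [source]
  rw [hs]
  refine (eLpNorm_add_le ((hm _).add (hm _))
    (Finset.aestronglyMeasurable_sum _ fun i _ => hm _) hp').trans (add_le_add
    ((eLpNorm_add_le (hm _) (hm _) hp').trans_eq ?_)
    ((eLpNorm_sum_le (fun i _ => hm _) hp').trans_eq ?_))
  · rw [habs, habs]
  · simp only [habs]

lemma sum_eLpNorm_ne_top (ψ : 𝓢(PSpace N, ℝ)) (p : ℝ≥0∞) :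
    ∑ i, eLpNorm (dX i (dX i ψ)) p volume ≠ ⊤ :=
  ENNReal.sum_ne_top.2 fun _ _ => eLpNorm_ne_top _ _

lemma eLpNorm_source_ne_top (ψ : 𝓢(PSpace N, ℝ)) {p : ℝ} (hp : 1 ≤ p) :
    eLpNorm (source ψ) (ENNReal.ofReal p) volume ≠ ⊤ :=
  ne_top_of_le_ne_top (ENNReal.add_ne_top.2 ⟨ENNReal.add_ne_top.2
    ⟨eLpNorm_ne_top _ _, eLpNorm_ne_top _ _⟩, sum_eLpNorm_ne_top _ _⟩)
    (eLpNorm_source_le_add ψ hp)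

lemma eLpNorm_source_le (ψ : 𝓢(PSpace N, ℝ)) {p : ℝ} (hp : 1 ≤ p) :
    (eLpNorm (source ψ) (ENNReal.ofReal p) volume).toReal ≤ W21Norm N p (fun z => ψ z) := by
  have h2 := ENNReal.add_ne_top.2 ⟨eLpNorm_ne_top ψ (ENNReal.ofReal p),
    eLpNorm_ne_top (dT ψ) (ENNReal.ofReal p)⟩
  have hsum := sum_eLpNorm_ne_top ψ (ENNReal.ofReal p)
  refine (ENNReal.toReal_mono (ENNReal.add_ne_top.2 ⟨h2, hsum⟩)
    (eLpNorm_source_le_add ψ hp)).trans ?_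
  rw [ENNReal.toReal_add h2 hsum, ENNReal.toReal_add (eLpNorm_ne_top _ _) (eLpNorm_ne_top _ _),
    ENNReal.toReal_sum fun i _ => eLpNorm_ne_top _ _, W21Norm, tDeriv_eq]
  refine add_le_add (le_add_of_nonneg_right ENNReal.toReal_nonneg)
    (Finset.sum_le_sum fun i _ => ?_)
  simp only [xxDeriv_eq]
  exact Finset.single_le_sum (f := fun j =>
    (eLpNorm (fun z => dX i (dX j ψ) z) (ENNReal.ofReal p) volume).toReal)
    (fun j _ => ENNReal.toReal_nonneg) (Finset.mem_univ i)

lemma exists_schwartz_ge_one {K : Set (PSpace N)} (hK : IsCompact K) :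
    ∃ φ : 𝓢(PSpace N, ℝ), ∃ U, IsOpen U ∧ K ⊆ U ∧ ∀ z ∈ U, 1 ≤ φ z := by
  obtain ⟨r, hr, hKr⟩ := hK.isBounded.subset_ball_lt 0 0
  let f : ContDiffBump (0 : PSpace N) := ⟨r, r + 1, hr, lt_add_one r⟩
  refine ⟨f.hasCompactSupport.toSchwartzMap f.contDiff, ball 0 r, isOpen_ball, hKr,
    fun z hz => ?_⟩
  exact (f.one_of_mem_closedBall (ball_subset_closedBall hz)).ge

lemma four_mul_volume_le {K : Set (PSpace N)} (hK : K ⊆ closure (pQt N 100 0)) :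
    4 * volume K ≤ volume (pQt N 200 (0 : PSpace N)) := by
  have hK' : K ⊆ closedBall 0 100 ×ˢ Icc (-(100 ^ 2)) (100 ^ 2) := by
    refine hK.trans (closure_minimal ?_ (isClosed_closedBall.prod isClosed_Icc))
    refine prod_mono ball_subset_closedBall ?_
    simpa using Ioo_subset_Icc_self
  have h1 := measure_mono (μ := volume) hK'
  rw [pQt, Measure.volume_eq_prod, Measure.prod_prod, Real.volume_Ioo]
  rw [Measure.volume_eq_prod, Measure.prod_prod, Real.volume_Icc] at h1
  have h2 : volume (closedBall (0 : EuclideanSpace ℝ (Fin N)) 100)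
      ≤ volume (ball (0 : EuclideanSpace ℝ (Fin N)) 200) :=
    measure_mono (closedBall_subset_ball (by norm_num))
  refine (mul_le_mul_right (h1.trans (mul_le_mul_left h2 _)) 4).trans_eq ?_
  have h3 : (4 : ℝ≥0∞) = ENNReal.ofReal 4 := by norm_num
  rw [mul_left_comm, h3, ← ENNReal.ofReal_mul (by norm_num)]
  norm_num

end Capacity

end CriticalCapacity

/-- Second estimate in (2.2): for compact `K ⊆ closure Q̃_{100}(0,0)` of positive
Lebesgue measure, `Cap_{2,1,(N+2)/2}(K) ≥ c (log(|Q̃_{200}(0,0)|/|K|))^{-N/2}`. -/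
theorem cap21_critical_ge_log
    (N : ℕ) (hN : 2 ≤ N) :
    ∃ c > (0 : ℝ), ∀ K : Set (PSpace N), K ⊆ closure (pQt N 100 0) → IsCompact K →
      0 < volume K →
      c * Real.log ((volume (pQt N 200 (0 : PSpace N))).toReal / (volume K).toReal)
            ^ (-(N : ℝ) / 2)
        ≤ cap21c N (((N : ℝ) + 2) / 2) K := by
  have hN0 : (0 : ℝ) < N := by exact_mod_cast (by omega : 0 < N)
  set p : ℝ := ((N : ℝ) + 2) / 2 with hp
  set q : ℝ := ((N : ℝ) + 2) / N with hq
  have hp1 : 1 < p := by rw [hp]; linarith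
  have hpq : p.HolderConjugate q := Real.holderConjugate_iff.2
    ⟨hp1, by rw [hp, hq, inv_div, inv_div]; field_simp; ring⟩
  have hpN : p / q = N / 2 := by rw [hp, hq]; field_simp
  set c₀ : ℝ := ∫ z : EuclideanSpace ℝ (Fin N), CriticalCapacity.gauss z with hc₀
  have hc₀pos : 0 < c₀ := CriticalCapacity.integral_gauss_pos
  have hlog2 : 0 < Real.log 2 := Real.log_pos one_lt_two
  set V : ℝ := (volume (pQt N 200 (0 : PSpace N))).toReal with hV
  have hVtop : volume (pQt N 200 (0 : PSpace N)) ≠ ⊤ :=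
    (isBounded_ball.prod (isBounded_Ioo _ _)).measure_lt_top.ne
  have hp0 := hpq.pos
  have hq0 := hpq.symm.pos
  refine ⟨(c₀ / (c₀ * V ^ (-(1 / p)) * Real.log 2 ^ (-(1 / q)) + (c₀ / p) ^ (1 / q))) ^ p,
    by positivity, fun K hKQ hK hKpos => ?_⟩
  set k : ℝ := (volume K).toReal with hk
  have hKtop : volume K ≠ ⊤ := hK.measure_lt_top.ne
  have hk0 : 0 < k := ENNReal.toReal_pos hKpos.ne' hKtop
  have h4 : 4 * k ≤ V := by
    have := ENNReal.toReal_mono hVtop (CriticalCapacity.four_mul_volume_le hKQ)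
    rwa [ENNReal.toReal_mul, ENNReal.toReal_ofNat] at this
  have hlV : Real.log 2 ≤ Real.log (V / k) :=
    Real.log_le_log two_pos ((le_div_iff₀ hk0).2 (by linarith))
  obtain ⟨φ₀, hφ₀⟩ := CriticalCapacity.exists_schwartz_ge_one hK
  refine le_csInf ⟨_, φ₀, hφ₀, rfl⟩ ?_
  rintro _ ⟨ψ, ⟨U, -, hKU, hU⟩, rfl⟩
  set I : ℝ := (eLpNorm (CriticalCapacity.source ψ) (ENNReal.ofReal p) volume).toReal with hI
  have hItop := CriticalCapacity.eLpNorm_source_ne_top ψ hp1.le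
  refine le_trans ?_ (Real.rpow_le_rpow ENNReal.toReal_nonneg
    (CriticalCapacity.eLpNorm_source_le ψ hp1.le) hp0.le)
  rw [neg_div, ← hpN]
  refine CriticalCapacity.le_rpow_of_balance hpq hc₀pos hk0 (by linarith)
    ENNReal.toReal_nonneg hlog2 hlV fun δ hδ hδ1 => ?_
  have h := CriticalCapacity.integral_gauss_mul_volume_le ψ hpq hpN hK.measurableSet
    (fun w hw => hU w (hKU hw)) hδ hδ1
  rw [← ENNReal.ofReal_toReal hKtop, ← ENNReal.ofReal_toReal hItop, ← hk, ← hI, ← hc₀] at h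
  have hlog : 0 ≤ Real.log (1 / δ) := Real.log_nonneg ((one_le_div hδ).2 hδ1)
  rw [ENNReal.ofReal_rpow_of_pos hk0, ← ENNReal.ofReal_mul hlog,
    ENNReal.ofReal_rpow_of_nonneg (by positivity) (by positivity),
    ← ENNReal.ofReal_mul (by positivity), ← ENNReal.ofReal_mul (by positivity),
    ← ENNReal.ofReal_mul (by positivity), ← ENNReal.ofReal_mul (by positivity),
    ← ENNReal.ofReal_mul (by positivity), ← ENNReal.ofReal_mul (by positivity),
    ← ENNReal.ofReal_add (by positivity) (by positivity)] at h
  exact (ENNReal.ofReal_le_ofReal_iff (by positivity)).1 h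
end

section
/- Let N ≥ 2 and 1 < p < (N+2)/2. There exists a constant C = C(N,p) ≥ 1 such that for every compact set K ⊂ closure(Q̃_{100}(0,0)) and every 0 < ρ < 1, setting K_ρ := { (ρx, ρ²t) : (x,t) ∈ K }, one has C^{−1} ρ^{N+2−2p} Cap_{2,1,p}(K) ≤ Cap_{2,1,p}(K_ρ) ≤ C ρ^{N+2−2p} Cap_{2,1,p}(K). -/
open MeasureTheory Metric Set
open scoped ENNReal NNReal

open scoped SchwartzMap LineDeriv

noncomputable section

namespace ParabolicCapacity

variable {N : ℕ}

/-- The `i`-th spatial coordinate vector of `ℝ^{N+1}`. -/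
def spaceDir (i : Fin N) : PSpace N := (EuclideanSpace.single i 1, 0)

/-- The time coordinate vector of `ℝ^{N+1}`. -/
def timeDir (N : ℕ) : PSpace N := (0, 1)

lemma tDeriv_eq (φ : 𝓢(PSpace N, ℝ)) : tDeriv φ = ∂_{timeDir N} φ := by
  ext z
  rw [SchwartzMap.lineDerivOp_apply, tDeriv, lineDeriv]
  have h : (fun t : ℝ => φ (z + t • timeDir N)) = fun t => (fun s => φ (z.1, s)) (z.2 + t) := by
    ext t
    congr 1
    ext <;> simp [timeDir]
  rw [h, deriv_comp_const_add (fun s => φ (z.1, s)), add_zero]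

lemma xDeriv_eq (i : Fin N) (φ : 𝓢(PSpace N, ℝ)) : xDeriv i φ = ∂_{spaceDir i} φ := by
  ext z
  rw [SchwartzMap.lineDerivOp_apply, xDeriv, lineDeriv, lineDeriv]
  congr 1
  ext t
  congr 1
  ext <;> simp [spaceDir]

lemma xxDeriv_eq (i j : Fin N) (φ : 𝓢(PSpace N, ℝ)) :
    xxDeriv i j φ = ∂_{spaceDir i} (∂_{spaceDir j} φ) := by
  ext z
  rw [xxDeriv, xDeriv_eq, xDeriv_eq]

/-- The parabolic dilation `(x, t) ↦ (ρ x, ρ² t)`. -/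
def pdil (N : ℕ) (ρ : ℝ) : PSpace N →L[ℝ] PSpace N :=
  (ρ • ContinuousLinearMap.fst ℝ _ _).prod (ρ ^ 2 • ContinuousLinearMap.snd ℝ _ _)

@[simp] lemma pdil_apply (ρ : ℝ) (z : PSpace N) : pdil N ρ z = (ρ • z.1, ρ ^ 2 * z.2) := rfl

/-- The parabolic dilation with factor `ρ ≠ 0`, as a linear isomorphism. -/
def pdilEquiv (N : ℕ) {ρ : ℝ} (hρ : ρ ≠ 0) : PSpace N ≃L[ℝ] PSpace N :=
  ContinuousLinearEquiv.equivOfInverse (pdil N ρ) (pdil N ρ⁻¹)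
    (fun z => by ext <;> simp [hρ]) (fun z => by ext <;> simp [hρ])

@[simp] lemma pdilEquiv_apply {ρ : ℝ} (hρ : ρ ≠ 0) (z : PSpace N) :
    pdilEquiv N hρ z = (ρ • z.1, ρ ^ 2 * z.2) := rfl

/-- The Schwartz function `z ↦ φ (δ_ρ z)`. -/
def dilate {ρ : ℝ} (hρ : ρ ≠ 0) (φ : 𝓢(PSpace N, ℝ)) : 𝓢(PSpace N, ℝ) :=
  SchwartzMap.compCLMOfContinuousLinearEquiv ℝ (pdilEquiv N hρ) φ

lemma dilate_apply {ρ : ℝ} (hρ : ρ ≠ 0) (φ : 𝓢(PSpace N, ℝ)) (z : PSpace N) :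
    dilate hρ φ z = φ (ρ • z.1, ρ ^ 2 * z.2) := rfl

lemma lineDeriv_spaceDir_dilate {ρ : ℝ} (hρ : ρ ≠ 0) (i : Fin N) (φ : 𝓢(PSpace N, ℝ)) :
    ∂_{spaceDir i} (dilate hρ φ) = ρ • dilate hρ (∂_{spaceDir i} φ) := by
  have h : pdilEquiv N hρ (spaceDir i) = ρ • spaceDir i := by
    ext <;> simp [spaceDir]
  rw [dilate, SchwartzMap.lineDerivOp_compCLMOfContinuousLinearEquiv, h,
    LineDeriv.lineDerivOp_left_smul, map_smul]
  rfl

lemma lineDeriv_timeDir_dilate {ρ : ℝ} (hρ : ρ ≠ 0) (φ : 𝓢(PSpace N, ℝ)) :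
    ∂_{timeDir N} (dilate hρ φ) = ρ ^ 2 • dilate hρ (∂_{timeDir N} φ) := by
  have h : pdilEquiv N hρ (timeDir N) = ρ ^ 2 • timeDir N := by
    ext <;> simp [timeDir]
  rw [dilate, SchwartzMap.lineDerivOp_compCLMOfContinuousLinearEquiv, h,
    LineDeriv.lineDerivOp_left_smul, map_smul]
  rfl

lemma map_pdil_volume {ρ : ℝ} (hρ : 0 < ρ) :
    Measure.map (pdilEquiv N hρ.ne') volume = ENNReal.ofReal (ρ ^ (-((N : ℝ) + 2))) • volume := by
  have h : (pdilEquiv N hρ.ne' : PSpace N → PSpace N) =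
      Prod.map (fun x => ρ • x) (fun t => ρ ^ 2 • t) := rfl
  rw [h, Measure.volume_eq_prod, ← Measure.map_prod_map _ _ (measurable_const_smul ρ)
    (measurable_const_smul (ρ ^ 2)), Measure.map_addHaar_smul _ hρ.ne',
    Measure.map_addHaar_smul _ (pow_ne_zero 2 hρ.ne'), Measure.prod_smul_left,
    Measure.prod_smul_right, smul_smul, ← ENNReal.ofReal_mul (abs_nonneg _), ← abs_mul]
  congr 2
  simp only [finrank_euclideanSpace, Fintype.card_fin, Module.finrank_self, pow_one]
  rw [abs_of_pos (by positivity), Real.rpow_neg hρ.le, ← mul_inv, ← pow_add]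
  norm_cast

lemma lintegral_comp_pdil {ρ : ℝ} (hρ : 0 < ρ) {f : PSpace N → ℝ≥0∞} (hf : Measurable f) :
    ∫⁻ z, f (pdil N ρ z) = ENNReal.ofReal (ρ ^ (-((N : ℝ) + 2))) * ∫⁻ z, f z := by
  rw [← smul_eq_mul, ← lintegral_smul_measure, ← map_pdil_volume hρ,
    lintegral_map hf (pdilEquiv N hρ.ne').continuous.measurable]
  rfl

lemma eLpNorm_comp_pdil {p : ℝ} (hp : 0 < p) {ρ : ℝ} (hρ : 0 < ρ) {f : PSpace N → ℝ}
    (hf : Continuous f) :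
    eLpNorm (fun z => f (pdil N ρ z)) (ENNReal.ofReal p) volume =
      ENNReal.ofReal (ρ ^ (-((N : ℝ) + 2) / p)) * eLpNorm f (ENNReal.ofReal p) volume := by
  have h := eLpNorm_map_measure (p := ENNReal.ofReal p) (f := pdilEquiv N hρ.ne') (g := f)
    (μ := volume) hf.aestronglyMeasurable
    (pdilEquiv N hρ.ne').continuous.measurable.aemeasurable
  rw [show (fun z => f (pdil N ρ z)) = f ∘ pdilEquiv N hρ.ne' from rfl, ← h, map_pdil_volume hρ,
    eLpNorm_smul_measure_of_ne_top ENNReal.ofReal_ne_top, smul_eq_mul, ENNReal.toReal_div,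
    ENNReal.toReal_ofReal hp.le, ENNReal.ofReal_rpow_of_pos (by positivity),
    ← Real.rpow_mul hρ.le]
  congr 3
  simp [div_eq_mul_inv]

lemma eLpNorm_smul_dilate {p : ℝ} (hp : 0 < p) {ρ c : ℝ} (hρ : 0 < ρ) (hc : 0 ≤ c)
    (φ : 𝓢(PSpace N, ℝ)) :
    (eLpNorm (c • dilate hρ.ne' φ) (ENNReal.ofReal p) volume).toReal =
      c * ρ ^ (-((N : ℝ) + 2) / p) * (eLpNorm φ (ENNReal.ofReal p) volume).toReal := by
  have h := eLpNorm_comp_pdil hp hρ φ.continuous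
  rw [show ⇑(c • dilate hρ.ne' φ) = c • fun z => φ (pdil N ρ z) from rfl, eLpNorm_const_smul, h,
    ENNReal.toReal_mul, ENNReal.toReal_mul,
    ENNReal.toReal_ofReal (by positivity), toReal_enorm, Real.norm_of_nonneg hc, mul_assoc]

lemma continuous_gradNorm (φ : 𝓢(PSpace N, ℝ)) : Continuous (gradNorm φ) := by
  unfold gradNorm
  simp only [xDeriv_eq]
  have := fun i : Fin N => (∂_{spaceDir i} φ).continuous
  fun_prop

lemma gradNorm_dilate {ρ : ℝ} (hρ : 0 < ρ) (φ : 𝓢(PSpace N, ℝ)) :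
    gradNorm (dilate hρ.ne' φ) = fun z => ρ * gradNorm φ (pdil N ρ z) := by
  ext z
  unfold gradNorm
  simp only [xDeriv_eq, lineDeriv_spaceDir_dilate, smul_apply, smul_eq_mul, mul_pow,
    ← Finset.mul_sum]
  rw [Real.sqrt_mul (by positivity), Real.sqrt_sq hρ.le]
  rfl

/-- The part of the parabolic Sobolev norm made of the derivatives of parabolic order two. -/
def topNorm (p : ℝ) (φ : 𝓢(PSpace N, ℝ)) : ℝ :=
  (eLpNorm (∂_{timeDir N} φ : 𝓢(PSpace N, ℝ)) (ENNReal.ofReal p) volume).toReal +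
    ∑ i : Fin N, ∑ j : Fin N,
      (eLpNorm (∂_{spaceDir i} (∂_{spaceDir j} φ) : 𝓢(PSpace N, ℝ)) (ENNReal.ofReal p) volume).toReal

lemma topNorm_nonneg (p : ℝ) (φ : 𝓢(PSpace N, ℝ)) : 0 ≤ topNorm p φ := by
  unfold topNorm
  positivity

lemma W21Norm_eq (p : ℝ) (φ : 𝓢(PSpace N, ℝ)) :
    W21Norm N p φ = (eLpNorm φ (ENNReal.ofReal p) volume).toReal +
      (eLpNorm (gradNorm φ) (ENNReal.ofReal p) volume).toReal + topNorm p φ := by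
  rw [W21Norm, topNorm]
  simp only [tDeriv_eq, xxDeriv_eq]
  ring

lemma W21Norm_nonneg (p : ℝ) (φ : 𝓢(PSpace N, ℝ)) : 0 ≤ W21Norm N p φ := by
  unfold W21Norm
  positivity

lemma topNorm_le_W21Norm (p : ℝ) (φ : 𝓢(PSpace N, ℝ)) : topNorm p φ ≤ W21Norm N p φ := by
  rw [W21Norm_eq]
  have h₁ := ENNReal.toReal_nonneg (a := eLpNorm φ (ENNReal.ofReal p) volume)
  have h₂ := ENNReal.toReal_nonneg (a := eLpNorm (gradNorm φ) (ENNReal.ofReal p) volume)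
  linarith

lemma topNorm_dilate {p : ℝ} (hp : 0 < p) {ρ : ℝ} (hρ : 0 < ρ) (φ : 𝓢(PSpace N, ℝ)) :
    topNorm p (dilate hρ.ne' φ) = ρ ^ 2 * ρ ^ (-((N : ℝ) + 2) / p) * topNorm p φ := by
  have h (i j : Fin N) : ∂_{spaceDir i} (∂_{spaceDir j} (dilate hρ.ne' φ)) =
      ρ ^ 2 • dilate hρ.ne' (∂_{spaceDir i} (∂_{spaceDir j} φ)) := by
    rw [lineDeriv_spaceDir_dilate, LineDeriv.lineDerivOp_smul, lineDeriv_spaceDir_dilate, smul_smul,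
      sq]
  simp only [topNorm, h, lineDeriv_timeDir_dilate, eLpNorm_smul_dilate hp hρ (sq_nonneg ρ),
    ← Finset.mul_sum, mul_add]

lemma W21Norm_dilate_le {p : ℝ} (hp : 0 < p) {ρ : ℝ} (hρ : 1 ≤ ρ) (φ : 𝓢(PSpace N, ℝ)) :
    W21Norm N p (dilate (zero_lt_one.trans_le hρ).ne' φ) ≤
      ρ ^ 2 * ρ ^ (-((N : ℝ) + 2) / p) * W21Norm N p φ := by
  have hρ₀ := zero_lt_one.trans_le hρ
  have h₁ := eLpNorm_smul_dilate hp hρ₀ zero_le_one φ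
  rw [one_smul] at h₁
  rw [W21Norm_eq, W21Norm_eq, topNorm_dilate hp hρ₀, h₁, gradNorm_dilate hρ₀,
    show (fun z => ρ * gradNorm φ (pdil N ρ z)) = ρ • fun z => gradNorm φ (pdil N ρ z) from rfl,
    eLpNorm_const_smul, eLpNorm_comp_pdil hp hρ₀ (continuous_gradNorm φ), ENNReal.toReal_mul,
    ENNReal.toReal_mul, ENNReal.toReal_ofReal (by positivity), toReal_enorm,
    Real.norm_of_nonneg hρ₀.le, mul_add, mul_add, ← mul_assoc]
  have : ρ ≤ ρ ^ 2 := by nlinarith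
  have : 1 ≤ ρ ^ 2 := by nlinarith
  gcongr

/-- The function `φ` is admissible for the capacity of `K`. -/
def Admissible (K : Set (PSpace N)) (φ : 𝓢(PSpace N, ℝ)) : Prop :=
  ∃ U, IsOpen U ∧ K ⊆ U ∧ ∀ z ∈ U, 1 ≤ φ z

lemma cap21c_le {p : ℝ} {K : Set (PSpace N)} {φ : 𝓢(PSpace N, ℝ)} (h : Admissible K φ) :
    cap21c N p K ≤ W21Norm N p φ ^ p :=
  csInf_le ⟨0, by rintro _ ⟨φ, -, rfl⟩; exact Real.rpow_nonneg (W21Norm_nonneg p φ) p⟩ ⟨φ, h, rfl⟩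

lemma cap21c_le_mul {p A : ℝ} (hp : 0 < p) (hA : 0 < A) {K L : Set (PSpace N)}
    (hL : ∃ φ : 𝓢(PSpace N, ℝ), Admissible L φ)
    (h : ∀ φ : 𝓢(PSpace N, ℝ), Admissible L φ →
      ∃ ψ : 𝓢(PSpace N, ℝ), Admissible K ψ ∧ W21Norm N p ψ ≤ A * W21Norm N p φ) :
    cap21c N p K ≤ A ^ p * cap21c N p L := by
  rw [← div_le_iff₀' (by positivity)]
  obtain ⟨φ₀, hφ₀⟩ := hL
  refine le_csInf ⟨_, φ₀, hφ₀, rfl⟩ ?_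
  rintro _ ⟨φ, hφ, rfl⟩
  obtain ⟨ψ, hψ, hle⟩ := h φ hφ
  rw [div_le_iff₀' (by positivity), ← Real.mul_rpow hA.le (W21Norm_nonneg p φ)]
  exact (cap21c_le hψ).trans (Real.rpow_le_rpow (W21Norm_nonneg p ψ) hle hp.le)

lemma Admissible.dilate {ρ : ℝ} (hρ : ρ ≠ 0) {K L : Set (PSpace N)} {φ : 𝓢(PSpace N, ℝ)}
    (h : Admissible L φ) (hK : MapsTo (pdil N ρ) K L) : Admissible K (dilate hρ φ) := by
  obtain ⟨U, hU, hLU, h1⟩ := h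
  exact ⟨pdil N ρ ⁻¹' U, hU.preimage (pdil N ρ).continuous, fun z hz => hLU (hK hz),
    fun z hz => h1 _ hz⟩

/-- A smooth compactly supported function of `‖x‖² + t²`. -/
def bump (N : ℕ) (w : PSpace N) : ℝ := Real.smoothTransition (1 - (‖w.1‖ ^ 2 + w.2 ^ 2))

/-- The averaging weight attached to `bump`. -/
def weight (N : ℕ) (w : PSpace N) : ℝ :=
  2 * deriv Real.smoothTransition (1 - (‖w.1‖ ^ 2 + w.2 ^ 2))

lemma contDiff_bump : ContDiff ℝ (⊤ : ℕ∞) (bump N) := by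
  have h : ContDiff ℝ (⊤ : ℕ∞) fun w : PSpace N => ‖w.1‖ ^ 2 := contDiff_fst.norm_sq ℝ
  exact Real.smoothTransition.contDiff.comp
    (contDiff_const.sub (h.add (contDiff_snd.pow 2)))

lemma one_lt_of_notMem_closedBall {w : PSpace N} (hw : w ∉ closedBall 0 1) :
    1 < ‖w.1‖ ^ 2 + w.2 ^ 2 := by
  rw [mem_closedBall_zero_iff, Prod.norm_def, sup_le_iff, not_and_or, not_le, not_le,
    Real.norm_eq_abs] at hw
  rcases hw with h | h
  · nlinarith [sq_nonneg w.2]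
  · nlinarith [sq_nonneg ‖w.1‖, sq_abs w.2]

lemma bump_eq_zero {w : PSpace N} (hw : w ∉ closedBall 0 1) : bump N w = 0 :=
  Real.smoothTransition.zero_of_nonpos (by linarith [one_lt_of_notMem_closedBall hw])

lemma weight_eq_zero {w : PSpace N} (hw : w ∉ closedBall 0 1) : weight N w = 0 := by
  have h : Real.smoothTransition =ᶠ[nhds (1 - (‖w.1‖ ^ 2 + w.2 ^ 2))] fun _ => 0 := by
    filter_upwards [Iio_mem_nhds (show 1 - (‖w.1‖ ^ 2 + w.2 ^ 2) < 0 by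
      linarith [one_lt_of_notMem_closedBall hw])] with x hx
    exact Real.smoothTransition.zero_of_nonpos (le_of_lt hx)
  rw [weight, h.deriv_eq, deriv_const, mul_zero]

lemma continuous_weight : Continuous (weight N) := by
  have h : Continuous (deriv Real.smoothTransition) :=
    (Real.smoothTransition.contDiff (n := 1)).continuous_deriv le_rfl
  exact continuous_const.mul (h.comp (by fun_prop))

lemma weight_nonneg (w : PSpace N) : 0 ≤ weight N w :=
  mul_nonneg zero_le_two Real.smoothTransition.monotone.deriv_nonneg

lemma hasCompactSupport_bump : HasCompactSupport (bump N) :=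
  .intro (isCompact_closedBall 0 1) fun _ => bump_eq_zero

lemma hasCompactSupport_weight : HasCompactSupport (weight N) :=
  .intro (isCompact_closedBall 0 1) fun _ => weight_eq_zero

lemma integral_weight_pos : 0 < ∫ w, weight N w := by
  obtain ⟨c, hc, h⟩ := exists_deriv_eq_slope Real.smoothTransition zero_lt_one
    Real.smoothTransition.continuous.continuousOn
    ((Real.smoothTransition.contDiff (n := 1)).differentiable one_ne_zero).differentiableOn
  refine continuous_weight.integral_pos_of_hasCompactSupport_nonneg_nonzero
    (x := ((0, √(1 - c)) : PSpace N)) hasCompactSupport_weight weight_nonneg ?_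
  simp [weight, Real.sq_sqrt (sub_nonneg.2 hc.2.le), h]

/-- `bump` as a Schwartz function. -/
def bumpS (N : ℕ) : 𝓢(PSpace N, ℝ) := hasCompactSupport_bump.toSchwartzMap contDiff_bump

lemma lineDeriv_spaceDir_bumpS (i : Fin N) (w : PSpace N) :
    (∂_{spaceDir i} (bumpS N) : 𝓢(PSpace N, ℝ)) w = -(w.1 i * weight N w) := by
  have h₁ : HasDerivAt Real.smoothTransition
      (deriv Real.smoothTransition (1 - (‖w.1‖ ^ 2 + w.2 ^ 2))) (1 - (‖w.1‖ ^ 2 + w.2 ^ 2)) :=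
    ((Real.smoothTransition.contDiff (n := 1)).differentiable one_ne_zero _).hasDerivAt
  have h₂ := h₁.comp_hasFDerivAt w
    (((hasFDerivAt_fst (𝕜 := ℝ) (p := w)).norm_sq.add
      ((hasFDerivAt_snd (𝕜 := ℝ) (p := w)).pow 2)).const_sub 1)
  have h₃ : HasFDerivAt (bumpS N) _ w := h₂
  rw [SchwartzMap.lineDerivOp_apply_eq_fderiv, h₃.fderiv]
  simp [spaceDir, weight, EuclideanSpace.inner_single_right]
  ring

/-- The Schwartz function `w ↦ ψ (z + w)`. -/
def translate (z : PSpace N) (ψ : 𝓢(PSpace N, ℝ)) : 𝓢(PSpace N, ℝ) :=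
  ψ.compSubConstCLM ℝ (-z)

lemma translate_apply (z : PSpace N) (ψ : 𝓢(PSpace N, ℝ)) (w : PSpace N) :
    translate z ψ w = ψ (z + w) := by
  simp [translate, add_comm]

lemma lineDeriv_translate (v z : PSpace N) (ψ : 𝓢(PSpace N, ℝ)) :
    ∂_{v} (translate z ψ) = translate z (∂_{v} ψ) := by
  ext w
  rw [translate_apply, SchwartzMap.lineDerivOp_apply, SchwartzMap.lineDerivOp_apply,
    lineDeriv, lineDeriv]
  simp only [translate_apply, add_assoc]

lemma fderiv_eq_sum (ψ : 𝓢(PSpace N, ℝ)) (z v : PSpace N) :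
    fderiv ℝ ψ z v = ∑ i, v.1 i * (∂_{spaceDir i} ψ : 𝓢(PSpace N, ℝ)) z +
      v.2 * (∂_{timeDir N} ψ : 𝓢(PSpace N, ℝ)) z := by
  have hv : v = ∑ i, v.1 i • spaceDir i + v.2 • timeDir N := by
    ext
    · simp [spaceDir, timeDir, Prod.fst_sum, Finset.sum_apply, Pi.single_apply]
    · simp [spaceDir, timeDir, Prod.snd_sum]
  conv_lhs => rw [hv]
  simp only [map_add, map_sum, map_smul, SchwartzMap.lineDerivOp_apply_eq_fderiv, smul_eq_mul]

/-- The derivative of `s ↦ ψ (δ_s w)`. -/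
def flowDeriv (ψ : 𝓢(PSpace N, ℝ)) (s : ℝ) (w : PSpace N) : ℝ :=
  ∑ i : Fin N, w.1 i * (∂_{spaceDir i} ψ : 𝓢(PSpace N, ℝ)) (pdil N s w) +
    2 * s * w.2 * (∂_{timeDir N} ψ : 𝓢(PSpace N, ℝ)) (pdil N s w)

/-- The integrand obtained from `weight N w * flowDeriv ψ s w` by integration by parts. -/
def flowParts (ψ : 𝓢(PSpace N, ℝ)) (s : ℝ) (w : PSpace N) : ℝ :=
  s * (bump N w *
    ∑ i : Fin N, (∂_{spaceDir i} (∂_{spaceDir i} ψ) : 𝓢(PSpace N, ℝ)) (pdil N s w)) +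
    2 * s * (weight N w * (w.2 * (∂_{timeDir N} ψ : 𝓢(PSpace N, ℝ)) (pdil N s w)))

lemma hasDerivAt_comp_pdil (ψ : 𝓢(PSpace N, ℝ)) (w : PSpace N) (s : ℝ) :
    HasDerivAt (fun s => ψ (pdil N s w))
      (flowDeriv ψ s w) s := by
  have h₁ : HasDerivAt (fun s : ℝ => pdil N s w) (w.1, 2 * s * w.2) s := by
    have h₂ : HasDerivAt (fun s : ℝ => s • w.1) w.1 s := by
      simpa using (hasDerivAt_id s).smul_const w.1
    have h₃ : HasDerivAt (fun s : ℝ => s ^ 2 * w.2) (2 * s * w.2) s := by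
      simpa using (hasDerivAt_pow 2 s).mul_const w.2
    exact h₂.prodMk h₃
  have h := (ψ.differentiableAt (x := pdil N s w)).hasFDerivAt.comp_hasDerivAt s h₁
  rwa [fderiv_eq_sum] at h

lemma continuous_pdil : Continuous fun q : ℝ × PSpace N => pdil N q.1 q.2 := by
  simp only [pdil_apply]
  fun_prop

instance : (volume : Measure (PSpace N)).IsAddHaarMeasure :=
  inferInstanceAs ((volume.prod volume).IsAddHaarMeasure)

lemma integral_weight_mul_lineDeriv {s : ℝ} (hs : s ≠ 0) (i : Fin N) (ψ : 𝓢(PSpace N, ℝ)) :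
    ∫ w, weight N w * (w.1 i * (∂_{spaceDir i} ψ : 𝓢(PSpace N, ℝ)) (pdil N s w)) =
      ∫ w, s * (bump N w *
        (∂_{spaceDir i} (∂_{spaceDir i} ψ) : 𝓢(PSpace N, ℝ)) (pdil N s w)) := by
  have h := SchwartzMap.integral_mul_lineDerivOp_right_eq_neg_left (μ := volume) (bumpS N)
    (dilate hs (∂_{spaceDir i} ψ)) (spaceDir i)
  rw [lineDeriv_spaceDir_dilate, ← integral_neg] at h
  simp only [lineDeriv_spaceDir_bumpS, smul_apply, smul_eq_mul] at h
  calc _ = ∫ w, -(-(w.1 i * weight N w) * dilate hs (∂_{spaceDir i} ψ) w) := by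
        refine integral_congr_ae (.of_forall fun w => ?_)
        simp only [dilate_apply, pdil_apply]
        ring
    _ = _ := by
        rw [← h]
        refine integral_congr_ae (.of_forall fun w => ?_)
        simp only [dilate_apply, pdil_apply, show bumpS N w = bump N w from rfl]
        ring

lemma integral_weight_mul_deriv {s : ℝ} (hs : s ≠ 0) (ψ : 𝓢(PSpace N, ℝ)) :
    ∫ w : PSpace N, weight N w * flowDeriv ψ s w = ∫ w, flowParts ψ s w := by
  unfold flowDeriv flowParts
  have hw : Continuous (weight N) := continuous_weight
  have hds : Continuous (pdil N s) := (pdil N s).continuous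
  have hi₁ (i : Fin N) : Integrable fun w =>
      weight N w * (w.1 i * (∂_{spaceDir i} ψ : 𝓢(PSpace N, ℝ)) (pdil N s w)) :=
    (hw.mul (.mul (by fun_prop) ((SchwartzMap.continuous _).comp
      hds))).integrable_of_hasCompactSupport hasCompactSupport_weight.mul_right
  have hi₂ (i : Fin N) : Integrable fun w => s * (bump N w *
        (∂_{spaceDir i} (∂_{spaceDir i} ψ) : 𝓢(PSpace N, ℝ)) (pdil N s w)) :=
    ((contDiff_bump.continuous.mul ((SchwartzMap.continuous _).comp
      hds)).integrable_of_hasCompactSupport hasCompactSupport_bump.mul_right).const_mul s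
  have hi₃ : Integrable fun w =>
      2 * s * (weight N w * (w.2 * (∂_{timeDir N} ψ : 𝓢(PSpace N, ℝ)) (pdil N s w))) :=
    ((hw.mul (.mul (by fun_prop) ((SchwartzMap.continuous _).comp
      hds))).integrable_of_hasCompactSupport hasCompactSupport_weight.mul_right).const_mul _
  simp_rw [mul_add, Finset.mul_sum]
  rw [integral_add (integrable_finsetSum _ fun i _ => hi₂ i) hi₃,
    integral_finsetSum _ fun i _ => hi₂ i, ← Finset.sum_congr rfl fun i _ =>
      integral_weight_mul_lineDeriv hs i ψ, ← integral_finsetSum _ fun i _ => hi₁ i,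
    ← integral_add (integrable_finsetSum _ fun i _ => hi₁ i) hi₃]
  refine integral_congr_ae (.of_forall fun w => ?_)
  simp only
  ring

lemma intervalIntegral_integral_swap_of_continuous {F : ℝ → PSpace N → ℝ}
    (hF : Continuous (Function.uncurry F)) (h₀ : ∀ s, ∀ w ∉ closedBall 0 1, F s w = 0) (S : ℝ) :
    ∫ s in (0 : ℝ)..S, ∫ w, F s w = ∫ w, ∫ s in (0 : ℝ)..S, F s w := by
  apply intervalIntegral_integral_swap
  rw [← Measure.restrict_univ (μ := (volume : Measure (PSpace N))), Measure.prod_restrict]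
  have hc : IntegrableOn (Function.uncurry F) (uIcc 0 S ×ˢ closedBall 0 1)
      (volume.prod volume) :=
    hF.continuousOn.integrableOn_compact (isCompact_uIcc.prod (isCompact_closedBall 0 1))
  refine hc.of_forall_sdiff_eq_zero (measurableSet_uIoc.prod .univ) ?_
  rintro ⟨s, w⟩ ⟨⟨hs, -⟩, h⟩
  exact h₀ s w fun h' => h ⟨uIoc_subset_uIcc hs, h'⟩

lemma continuous_weight_mul_flowDeriv (ψ : 𝓢(PSpace N, ℝ)) :
    Continuous (Function.uncurry fun s w => weight N w * flowDeriv ψ s w) := by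
  have h (φ : 𝓢(PSpace N, ℝ)) : Continuous fun q : ℝ × PSpace N => φ (pdil N q.1 q.2) :=
    φ.continuous.comp continuous_pdil
  have h₁ (i : Fin N) := h (∂_{spaceDir i} ψ)
  have h₂ := h (∂_{timeDir N} ψ)
  have h₃ : Continuous fun q : ℝ × PSpace N => weight N q.2 :=
    continuous_weight.comp continuous_snd
  refine h₃.mul (.add (continuous_finsetSum _ fun i _ => ?_) (.mul ?_ h₂))
  · exact .mul (by fun_prop) (h₁ i)
  · fun_prop

lemma integral_weight_sub (ψ : 𝓢(PSpace N, ℝ)) (S : ℝ) :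
    ∫ w, weight N w * (ψ (pdil N S w) - ψ 0) =
      ∫ s in (0 : ℝ)..S, ∫ w : PSpace N, flowParts ψ s w := by
  have hF := continuous_weight_mul_flowDeriv ψ
  have h₁ (w : PSpace N) : weight N w * (ψ (pdil N S w) - ψ 0) =
      ∫ s in (0 : ℝ)..S, weight N w * flowDeriv ψ s w := by
    have hFs : Continuous fun s => weight N w * flowDeriv ψ s w :=
      hF.comp (g := Function.uncurry _) (f := fun s : ℝ => (s, w)) (by fun_prop)
    have h := intervalIntegral.integral_eq_sub_of_hasDerivAt (a := 0) (b := S)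
      (fun s _ => (hasDerivAt_comp_pdil ψ w s).const_mul (weight N w))
      (hFs.intervalIntegrable 0 S)
    have h₀ : pdil N 0 w = 0 := by ext <;> simp
    rw [h, h₀, mul_sub]
  rw [integral_congr_ae (.of_forall h₁), ← intervalIntegral_integral_swap_of_continuous hF
    fun s w hw => by rw [weight_eq_zero hw, zero_mul]]
  refine intervalIntegral.integral_congr_ae ?_
  filter_upwards [Measure.ae_ne volume (0 : ℝ)] with s hs _
  exact integral_weight_mul_deriv hs ψ

/-- The integral of `G` over the parabolic ball of radius `s` around `z`, rescaled to unit size. -/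
def ballAvg (G : PSpace N → ℝ≥0∞) (s : ℝ) (z : PSpace N) : ℝ≥0∞ :=
  ∫⁻ w in closedBall 0 1, G (z + pdil N s w)

/-- The sum of the sizes of `∂ₜ ψ` and of the pure second derivatives `∂ᵢ ∂ᵢ ψ`. -/
def heatSize (ψ : 𝓢(PSpace N, ℝ)) (z : PSpace N) : ℝ≥0∞ :=
  ∑ i : Fin N, ‖(∂_{spaceDir i} (∂_{spaceDir i} ψ) : 𝓢(PSpace N, ℝ)) z‖ₑ +
    ‖(∂_{timeDir N} ψ : 𝓢(PSpace N, ℝ)) z‖ₑ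

lemma measurable_heatSize (ψ : 𝓢(PSpace N, ℝ)) : Measurable (heatSize ψ) := by
  have h (φ : 𝓢(PSpace N, ℝ)) : Measurable fun z => ‖φ z‖ₑ := φ.continuous.measurable.enorm
  exact (Finset.measurable_sum _ fun i _ => h _).add (h _)

lemma lintegral_le_of_bump {f g : PSpace N → ℝ≥0∞} (h : ∀ w ∈ closedBall 0 1, f w ≤ g w)
    (h₀ : ∀ w ∉ closedBall 0 1, f w = 0) : ∫⁻ w, f w ≤ ∫⁻ w in closedBall 0 1, g w := by
  rw [← lintegral_indicator measurableSet_closedBall]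
  refine lintegral_mono fun w => ?_
  by_cases hw : w ∈ closedBall 0 1
  · rw [indicator_of_mem hw]
    exact h w hw
  · rw [h₀ w hw]
    exact zero_le

lemma exists_weight_le (N : ℕ) : ∃ L : ℝ≥0, ∀ w : PSpace N, ‖weight N w‖ₑ ≤ L := by
  obtain ⟨L, hL⟩ := continuous_weight.bounded_above_of_compact_support
    (hasCompactSupport_weight (N := N))
  refine ⟨L.toNNReal, fun w => ?_⟩
  rw [← ofReal_norm]
  exact ENNReal.ofReal_le_ofReal (hL w)

lemma enorm_flowParts_le {L : ℝ≥0} (hL : ∀ w : PSpace N, ‖weight N w‖ₑ ≤ L)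
    (ψ : 𝓢(PSpace N, ℝ)) (s : ℝ) {w : PSpace N} (hw : w ∈ closedBall 0 1) :
    ‖flowParts ψ s w‖ₑ ≤ (1 + 2 * L : ℝ≥0) * (‖s‖ₑ * heatSize ψ (pdil N s w)) := by
  have hb : ‖bump N w‖ₑ ≤ 1 := by
    rw [← ofReal_norm,
      show ‖bump N w‖ = bump N w from Real.norm_of_nonneg (Real.smoothTransition.nonneg _)]
    exact ENNReal.ofReal_le_one.2 (Real.smoothTransition.le_one _)
  have ht : ‖w.2‖ₑ ≤ 1 := by
    rw [← ofReal_norm]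
    exact ENNReal.ofReal_le_one.2 ((norm_snd_le w).trans (mem_closedBall_zero_iff.1 hw))
  have h2 : ‖(2 : ℝ)‖ₑ = 2 := by
    rw [← ofReal_norm, Real.norm_ofNat, ENNReal.ofReal_ofNat]
  set A := ∑ i : Fin N, ‖(∂_{spaceDir i} (∂_{spaceDir i} ψ) : 𝓢(PSpace N, ℝ)) (pdil N s w)‖ₑ
    with hA
  set B := ‖(∂_{timeDir N} ψ : 𝓢(PSpace N, ℝ)) (pdil N s w)‖ₑ with hB
  calc ‖flowParts ψ s w‖ₑ ≤ ‖s‖ₑ * (1 * A) + 2 * ‖s‖ₑ * (L * (1 * B)) := by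
        refine (enorm_add_le _ _).trans ?_
        simp only [enorm_mul, h2, ← hB]
        gcongr
        · exact enorm_sum_le _ _
        · exact hL w
    _ ≤ ‖s‖ₑ * (1 * A) + 2 * ‖s‖ₑ * (L * (1 * B)) + (‖s‖ₑ * B + 2 * ‖s‖ₑ * L * A) := le_self_add
    _ = (1 + 2 * L : ℝ≥0) * (‖s‖ₑ * heatSize ψ (pdil N s w)) := by
        rw [heatSize, ← hA, ← hB]
        push_cast
        ring

lemma exists_enorm_zero_le (N : ℕ) : ∃ M : ℝ≥0, ∀ (ψ : 𝓢(PSpace N, ℝ)) (S : ℝ), 0 < S →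
    ‖ψ 0‖ₑ ≤ M * (ballAvg (fun z => ‖ψ z‖ₑ) S 0 +
      ∫⁻ s in Ioc 0 S, ‖s‖ₑ * ballAvg (heatSize ψ) s 0) := by
  obtain ⟨L, hL⟩ := exists_weight_le N
  set m := ∫ w, weight N w with hm
  have hm₀ : 0 < m := integral_weight_pos
  refine ⟨(m.toNNReal)⁻¹ * (1 + 2 * L), fun ψ S hS => ?_⟩
  have h₁ : Integrable fun w => weight N w * ψ (pdil N S w) :=
    (continuous_weight.mul
      (ψ.continuous.comp (pdil N S).continuous)).integrable_of_hasCompactSupport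
      hasCompactSupport_weight.mul_right
  have h₂ : Integrable fun w => weight N w * ψ 0 :=
    (continuous_weight.integrable_of_hasCompactSupport hasCompactSupport_weight).mul_const _
  have h₃ := integral_weight_sub ψ S
  simp only [mul_sub] at h₃
  rw [integral_sub h₁ h₂, integral_mul_const, ← hm,
    intervalIntegral.integral_of_le hS.le] at h₃
  have h₄ : m * ψ 0 = (∫ w, weight N w * ψ (pdil N S w)) -
      ∫ s in Ioc 0 S, ∫ w, flowParts ψ s w := by
    linarith
  have h₅ : ‖∫ w, weight N w * ψ (pdil N S w)‖ₑ ≤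
      (1 + 2 * L : ℝ≥0) * ballAvg (fun z => ‖ψ z‖ₑ) S 0 := by
    rw [ballAvg, ← lintegral_const_mul' _ _ ENNReal.coe_ne_top]
    refine (enorm_integral_le_lintegral_enorm _).trans (lintegral_le_of_bump (fun w _ => ?_)
      fun w hw => by rw [weight_eq_zero hw, zero_mul, enorm_zero])
    rw [enorm_mul, zero_add]
    gcongr
    refine (hL w).trans (ENNReal.coe_le_coe.2 ?_)
    nlinarith [L.2]
  have h₆ : ‖∫ s in Ioc 0 S, ∫ w, flowParts ψ s w‖ₑ ≤
      (1 + 2 * L : ℝ≥0) * ∫⁻ s in Ioc 0 S, ‖s‖ₑ * ballAvg (heatSize ψ) s 0 := by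
    rw [← lintegral_const_mul' _ _ ENNReal.coe_ne_top]
    refine (enorm_integral_le_lintegral_enorm _).trans (lintegral_mono fun s => ?_)
    rw [ballAvg, ← lintegral_const_mul' _ _ enorm_ne_top,
      ← lintegral_const_mul' _ _ ENNReal.coe_ne_top]
    refine (enorm_integral_le_lintegral_enorm _).trans (lintegral_le_of_bump (fun w hw => ?_)
      fun w hw => by simp [flowParts, weight_eq_zero hw, bump_eq_zero hw])
    rw [zero_add]
    exact enorm_flowParts_le hL ψ s hw
  have h₇ : ‖m‖ₑ = m.toNNReal := by
    rw [← ofReal_norm, Real.norm_of_nonneg hm₀.le]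
    rfl
  have h₈ : m.toNNReal ≠ 0 := (Real.toNNReal_pos.2 hm₀).ne'
  calc ‖ψ 0‖ₑ = ((m.toNNReal)⁻¹ : ℝ≥0) * ‖m * ψ 0‖ₑ := by
        rw [enorm_mul, h₇, ← mul_assoc, ENNReal.coe_inv h₈,
          ENNReal.inv_mul_cancel (by exact_mod_cast h₈)
          ENNReal.coe_ne_top, one_mul]
    _ ≤ ((m.toNNReal)⁻¹ : ℝ≥0) * ((1 + 2 * L : ℝ≥0) * ballAvg (fun z => ‖ψ z‖ₑ) S 0 +
          (1 + 2 * L : ℝ≥0) * ∫⁻ s in Ioc 0 S, ‖s‖ₑ * ballAvg (heatSize ψ) s 0) := by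
        rw [h₄]
        gcongr
        exact (enorm_sub_le).trans (add_le_add h₅ h₆)
    _ = _ := by
        rw [ENNReal.coe_mul]
        ring

lemma heatSize_translate (z : PSpace N) (ψ : 𝓢(PSpace N, ℝ)) (w : PSpace N) :
    heatSize (translate z ψ) w = heatSize ψ (z + w) := by
  simp only [heatSize, lineDeriv_translate, translate_apply]

lemma exists_enorm_le (N : ℕ) : ∃ M : ℝ≥0, ∀ (ψ : 𝓢(PSpace N, ℝ)) (z : PSpace N) (S : ℝ),
    0 < S → ‖ψ z‖ₑ ≤ M * (ballAvg (fun z => ‖ψ z‖ₑ) S z +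
      ∫⁻ s in Ioc 0 S, ‖s‖ₑ * ballAvg (heatSize ψ) s z) := by
  obtain ⟨M, hM⟩ := exists_enorm_zero_le N
  refine ⟨M, fun ψ z S hS => ?_⟩
  simpa only [ballAvg, translate_apply, heatSize_translate, zero_add, add_zero] using
    hM (translate z ψ) S hS

/-- The `L^p` norm of a nonnegative function. -/
def lpNorm {α : Type*} [MeasurableSpace α] (p : ℝ) (μ : Measure α) (f : α → ℝ≥0∞) : ℝ≥0∞ :=
  (∫⁻ a, f a ^ p ∂μ) ^ (1 / p)

lemma lintegral_le_lpNorm {α : Type*} [MeasurableSpace α] {p : ℝ} (hp : 1 < p) (μ : Measure α)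
    {f : α → ℝ≥0∞} (hf : AEMeasurable f μ) :
    ∫⁻ a, f a ∂μ ≤ lpNorm p μ f * μ univ ^ (1 - 1 / p) := by
  have hpq := Real.HolderConjugate.conjExponent hp
  have h := ENNReal.lintegral_mul_le_Lp_mul_Lq μ hpq hf (aemeasurable_const (b := 1))
  have hq : 1 / p.conjExponent = 1 - 1 / p := by
    rw [one_div, one_div, ← hpq.one_sub_inv]
  simpa [lpNorm, hq] using h

lemma lpNorm_ball_le {p : ℝ} (hp : 1 < p) {G : PSpace N → ℝ≥0∞} (hG : Measurable G)
    {s : ℝ} (hs : 0 < s) (z : PSpace N) :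
    ballAvg G s z ≤ volume (closedBall (0 : PSpace N) 1) ^ (1 - 1 / p) *
      (ENNReal.ofReal (s ^ (-((N : ℝ) + 2) / p)) * lpNorm p volume G) := by
  have hp₀ : 0 < p := zero_lt_one.trans hp
  have hG₁ : Measurable fun w => G (z + w) := hG.comp (measurable_const_add z)
  have h₁ := lintegral_le_lpNorm hp (volume.restrict (closedBall (0 : PSpace N) 1))
    (f := fun w => G (z + pdil N s w))
    (hG₁.comp (pdil N s).continuous.measurable).aemeasurable
  rw [Measure.restrict_apply_univ] at h₁
  refine h₁.trans ?_
  rw [mul_comm]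
  gcongr
  calc lpNorm p (volume.restrict (closedBall (0 : PSpace N) 1)) (fun w => G (z + pdil N s w))
      ≤ (∫⁻ w, G (z + pdil N s w) ^ p) ^ (1 / p) := by
        unfold lpNorm
        gcongr
        exact Measure.restrict_le_self
    _ = _ := by
        rw [lintegral_comp_pdil hs (hG₁.pow_const p), lintegral_add_left_eq_self (fun w => G w ^ p),
          ENNReal.mul_rpow_of_nonneg _ _ (by positivity), ENNReal.ofReal_rpow_of_pos (by positivity),
          ← Real.rpow_mul hs.le, mul_one_div, lpNorm]

/-- The contribution of the radii `s ≤ 1`. -/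
def nearAvg (G : PSpace N → ℝ≥0∞) (z : PSpace N) : ℝ≥0∞ :=
  ∫⁻ q in Ioc (0 : ℝ) 1 ×ˢ closedBall (0 : PSpace N) 1, G (z + pdil N q.1 q.2)
    ∂(volume.prod volume)

lemma measurable_flow {G : PSpace N → ℝ≥0∞} (hG : Measurable G) :
    Measurable fun a : PSpace N × (ℝ × PSpace N) => G (a.1 + pdil N a.2.1 a.2.2) :=
  hG.comp (continuous_fst.add (continuous_pdil.comp continuous_snd)).measurable

lemma measurable_nearAvg {G : PSpace N → ℝ≥0∞} (hG : Measurable G) : Measurable (nearAvg G) :=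
  (measurable_flow hG).lintegral_prod_right'

lemma lintegral_ballAvg_le_nearAvg {G : PSpace N → ℝ≥0∞} (hG : Measurable G) (z : PSpace N) :
    ∫⁻ s in Ioc (0 : ℝ) 1, ‖s‖ₑ * ballAvg G s z ≤ nearAvg G z := by
  have h : Measurable fun q : ℝ × PSpace N => G (z + pdil N q.1 q.2) :=
    hG.comp (continuous_const.add continuous_pdil).measurable
  rw [nearAvg, ← Measure.prod_restrict, lintegral_prod _ h.aemeasurable]
  refine setLIntegral_mono' measurableSet_Ioc fun s hs => ?_
  refine mul_le_of_le_one_left zero_le ?_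
  rw [← ofReal_norm, Real.norm_of_nonneg hs.1.le]
  exact ENNReal.ofReal_le_one.2 hs.2

/-- Minkowski's inequality for a superposition of translates. -/
lemma lpNorm_lintegral_translate_le {β : Type*} [MeasurableSpace β] (ν : Measure β)
    [IsFiniteMeasure ν] {p : ℝ} (hp : 1 < p) {G : PSpace N → ℝ≥0∞} (hG : Measurable G)
    {τ : β → PSpace N} (hτ : Measurable τ) :
    lpNorm p volume (fun z => ∫⁻ q, G (z + τ q) ∂ν) ≤ ν univ * lpNorm p volume G := by
  have hp₀ : 0 < p := zero_lt_one.trans hp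
  have hm : Measurable fun a : PSpace N × β => G (a.1 + τ a.2) ^ p :=
    (hG.comp (measurable_fst.add (hτ.comp measurable_snd))).pow_const p
  have h₁ (z : PSpace N) : (∫⁻ q, G (z + τ q) ∂ν) ^ p ≤
      (∫⁻ q, G (z + τ q) ^ p ∂ν) * ν univ ^ (p - 1) := by
    have h := lintegral_le_lpNorm hp ν (f := fun q => G (z + τ q))
      (hG.comp (hτ.const_add z)).aemeasurable
    refine (ENNReal.rpow_le_rpow h hp₀.le).trans_eq ?_
    rw [ENNReal.mul_rpow_of_nonneg _ _ hp₀.le, lpNorm, ← ENNReal.rpow_mul, ← ENNReal.rpow_mul,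
      one_div_mul_cancel hp₀.ne', ENNReal.rpow_one, sub_mul, one_div_mul_cancel hp₀.ne', one_mul]
  have h₂ : ∫⁻ z, (∫⁻ q, G (z + τ q) ∂ν) ^ p ≤ ν univ ^ p * ∫⁻ z, G z ^ p := by
    calc ∫⁻ z, (∫⁻ q, G (z + τ q) ∂ν) ^ p
        ≤ ∫⁻ z, (∫⁻ q, G (z + τ q) ^ p ∂ν) * ν univ ^ (p - 1) := lintegral_mono h₁
      _ = (∫⁻ q, (∫⁻ z, G (z + τ q) ^ p) ∂ν) * ν univ ^ (p - 1) := by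
          rw [lintegral_mul_const _ (hm.lintegral_prod_right' (ν := ν)),
            lintegral_lintegral_swap hm.aemeasurable]
      _ = ν univ ^ p * ∫⁻ z, G z ^ p := by
          simp_rw [fun q => lintegral_add_right_eq_self (μ := volume) (fun z => G z ^ p) (τ q)]
          rw [lintegral_const, mul_assoc, mul_comm]
          nth_rw 1 [← ENNReal.rpow_one (ν univ)]
          rw [← ENNReal.rpow_add_of_nonneg _ _ zero_le_one (sub_nonneg.2 hp.le), add_sub_cancel]
  calc lpNorm p volume (fun z => ∫⁻ q, G (z + τ q) ∂ν)
      ≤ (ν univ ^ p * ∫⁻ z, G z ^ p) ^ (1 / p) := by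
        unfold lpNorm
        gcongr
    _ = ν univ * lpNorm p volume G := by
        rw [ENNReal.mul_rpow_of_nonneg _ _ (by positivity), ← ENNReal.rpow_mul,
          mul_one_div_cancel hp₀.ne', ENNReal.rpow_one, lpNorm]

lemma lpNorm_nearAvg_le {p : ℝ} (hp : 1 < p) {G : PSpace N → ℝ≥0∞} (hG : Measurable G) :
    lpNorm p volume (nearAvg G) ≤
      volume (closedBall (0 : PSpace N) 1) * lpNorm p volume G := by
  have hν : (volume.prod volume).restrict (Ioc (0 : ℝ) 1 ×ˢ closedBall (0 : PSpace N) 1) univ =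
      volume (closedBall (0 : PSpace N) 1) := by
    rw [Measure.restrict_apply_univ, Measure.prod_prod, Real.volume_Ioc]
    simp
  have : IsFiniteMeasure
      ((volume.prod volume).restrict (Ioc (0 : ℝ) 1 ×ˢ closedBall (0 : PSpace N) 1)) :=
    ⟨by rw [hν]; exact measure_closedBall_lt_top⟩
  rw [← hν]
  exact lpNorm_lintegral_translate_le _ hp hG continuous_pdil.measurable

lemma lpNorm_eq_eLpNorm {α ε : Type*} [MeasurableSpace α] [TopologicalSpace ε]
    [ContinuousENorm ε] {p : ℝ} (hp : 0 < p) (μ : Measure α) (f : α → ε) :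
    lpNorm p μ (fun a => ‖f a‖ₑ) = eLpNorm f (ENNReal.ofReal p) μ := by
  rw [eLpNorm_eq_lintegral_rpow_enorm_toReal (by simpa using hp) ENNReal.ofReal_ne_top,
    ENNReal.toReal_ofReal hp.le, lpNorm]

lemma eLpNorm_ne_top (p : ℝ) (ψ : 𝓢(PSpace N, ℝ)) :
    eLpNorm ψ (ENNReal.ofReal p) volume ≠ ⊤ :=
  (ψ.eLpNorm_lt_top (ENNReal.ofReal p) volume).ne

lemma eLpNorm_spaceDir_spaceDir_le (p : ℝ) (i j : Fin N) (ψ : 𝓢(PSpace N, ℝ)) :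
    eLpNorm (∂_{spaceDir i} (∂_{spaceDir j} ψ) : 𝓢(PSpace N, ℝ)) (ENNReal.ofReal p) volume ≤
      ENNReal.ofReal (topNorm p ψ) := by
  rw [← ENNReal.ofReal_toReal (eLpNorm_ne_top p (∂_{spaceDir i} (∂_{spaceDir j} ψ)))]
  refine ENNReal.ofReal_le_ofReal ?_
  refine le_add_of_nonneg_of_le ENNReal.toReal_nonneg ?_
  refine (Finset.single_le_sum (f := fun j => (eLpNorm
    (∂_{spaceDir i} (∂_{spaceDir j} ψ) : 𝓢(PSpace N, ℝ)) (ENNReal.ofReal p) volume).toReal)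
    (fun _ _ => ENNReal.toReal_nonneg) (Finset.mem_univ j)).trans ?_
  exact Finset.single_le_sum (f := fun i => ∑ j, (eLpNorm
    (∂_{spaceDir i} (∂_{spaceDir j} ψ) : 𝓢(PSpace N, ℝ)) (ENNReal.ofReal p) volume).toReal)
    (fun _ _ => Finset.sum_nonneg fun _ _ => ENNReal.toReal_nonneg) (Finset.mem_univ i)

lemma eLpNorm_timeDir_le (p : ℝ) (ψ : 𝓢(PSpace N, ℝ)) :
    eLpNorm (∂_{timeDir N} ψ : 𝓢(PSpace N, ℝ)) (ENNReal.ofReal p) volume ≤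
      ENNReal.ofReal (topNorm p ψ) := by
  rw [← ENNReal.ofReal_toReal (eLpNorm_ne_top p (∂_{timeDir N} ψ))]
  exact ENNReal.ofReal_le_ofReal (le_add_of_nonneg_right
    (Finset.sum_nonneg fun _ _ => Finset.sum_nonneg fun _ _ => ENNReal.toReal_nonneg))

lemma lpNorm_heatSize_le {p : ℝ} (hp : 1 ≤ p) (ψ : 𝓢(PSpace N, ℝ)) :
    lpNorm p volume (heatSize ψ) ≤ (N + 1 : ℝ≥0) * ENNReal.ofReal (topNorm p ψ) := by
  have hP : (1 : ℝ≥0∞) ≤ ENNReal.ofReal p := ENNReal.one_le_ofReal.2 hp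
  have h₁ (φ : 𝓢(PSpace N, ℝ)) :
      AEStronglyMeasurable (fun z => ‖φ z‖ₑ) (volume : Measure (PSpace N)) :=
    φ.continuous.measurable.enorm.aestronglyMeasurable
  have h₂ (φ : 𝓢(PSpace N, ℝ)) : eLpNorm (fun z => ‖φ z‖ₑ) (ENNReal.ofReal p) volume =
      eLpNorm φ (ENNReal.ofReal p) volume := by
    rw [← lpNorm_eq_eLpNorm (zero_lt_one.trans_le hp),
      ← lpNorm_eq_eLpNorm (zero_lt_one.trans_le hp)]
    rfl
  calc lpNorm p volume (heatSize ψ) = eLpNorm (heatSize ψ) (ENNReal.ofReal p) volume :=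
        lpNorm_eq_eLpNorm (zero_lt_one.trans_le hp) volume (heatSize ψ)
    _ ≤ eLpNorm (∑ i : Fin N, fun z => ‖(∂_{spaceDir i} (∂_{spaceDir i} ψ) : 𝓢(PSpace N, ℝ)) z‖ₑ)
          (ENNReal.ofReal p) volume +
        eLpNorm (fun z => ‖(∂_{timeDir N} ψ : 𝓢(PSpace N, ℝ)) z‖ₑ) (ENNReal.ofReal p) volume := by
        refine le_of_eq_of_le ?_ (eLpNorm_add_le
          (Finset.aestronglyMeasurable_sum _ fun i _ => h₁ _) (h₁ _) hP)
        congr 1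
        ext z
        simp [heatSize]
    _ ≤ (∑ i : Fin N, ENNReal.ofReal (topNorm p ψ)) + ENNReal.ofReal (topNorm p ψ) := by
        refine add_le_add ((eLpNorm_sum_le (fun i _ => h₁ _) hP).trans
          (Finset.sum_le_sum fun i _ => ?_)) ?_
        · rw [h₂]
          exact eLpNorm_spaceDir_spaceDir_le p i i ψ
        · rw [h₂]
          exact eLpNorm_timeDir_le p ψ
    _ = _ := by
        push_cast
        simp [add_mul]

lemma exists_enorm_le_nearAvg {p : ℝ} (hp : 1 < p) (hp2 : p < ((N : ℝ) + 2) / 2) :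
    ∃ M c : ℝ≥0, ∀ (ψ : 𝓢(PSpace N, ℝ)) (z : PSpace N),
      ‖ψ z‖ₑ ≤ M * (nearAvg (heatSize ψ) z + c * lpNorm p volume (heatSize ψ)) := by
  obtain ⟨M, hM⟩ := exists_enorm_le N
  have hp₀ : 0 < p := zero_lt_one.trans hp
  set V := volume (closedBall (0 : PSpace N) 1) ^ (1 - 1 / p) with hV
  have hVt : V ≠ ⊤ := ENNReal.rpow_ne_top_of_nonneg
    (sub_nonneg.2 ((div_le_one hp₀).2 hp.le)) measure_closedBall_lt_top.ne
  have ha : 1 + -((N : ℝ) + 2) / p < -1 := by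
    have : 2 < ((N : ℝ) + 2) / p := by
      rw [lt_div_iff₀ hp₀]
      linarith
    rw [neg_div]
    linarith
  set I := ∫⁻ s in Ioi (1 : ℝ), ENNReal.ofReal (s ^ (1 + -((N : ℝ) + 2) / p)) with hI
  have hIt : I ≠ ⊤ := (integrableOn_Ioi_rpow_of_lt ha zero_lt_one).lintegral_lt_top.ne
  lift V to ℝ≥0 using hVt with V'
  lift I to ℝ≥0 using hIt with I'
  refine ⟨M, V' * I', fun ψ z => ?_⟩
  set H := lpNorm p volume (heatSize ψ) with hH
  have hψ : Measurable fun z => ‖ψ z‖ₑ := ψ.continuous.measurable.enorm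
  have hfar (S : ℝ) : ∫⁻ s in Ioc 1 S, ‖s‖ₑ * ballAvg (heatSize ψ) s z ≤ (V' * I' : ℝ≥0) * H := by
    calc ∫⁻ s in Ioc 1 S, ‖s‖ₑ * ballAvg (heatSize ψ) s z
        ≤ ∫⁻ s in Ioi (1 : ℝ), ‖s‖ₑ * ballAvg (heatSize ψ) s z :=
          lintegral_mono_set Ioc_subset_Ioi_self
      _ ≤ ∫⁻ s in Ioi (1 : ℝ), ENNReal.ofReal (s ^ (1 + -((N : ℝ) + 2) / p)) * (V' * H) := by
          refine setLIntegral_mono' measurableSet_Ioi fun s hs => ?_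
          have hs₀ : (0 : ℝ) < s := zero_lt_one.trans hs
          rw [← ofReal_norm, Real.norm_of_nonneg hs₀.le, Real.rpow_add hs₀, Real.rpow_one,
            ENNReal.ofReal_mul hs₀.le, mul_assoc]
          gcongr
          refine (lpNorm_ball_le hp (measurable_heatSize ψ) hs₀ z).trans_eq ?_
          rw [← hV]
          ring
      _ = _ := by
          rw [lintegral_mul_const _ (by fun_prop), ← hI]
          push_cast
          ring
  have hS (S : ℝ) (h1 : 1 ≤ S) : ‖ψ z‖ₑ ≤ M * (V' * (ENNReal.ofReal (S ^ (-((N : ℝ) + 2) / p)) *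
      lpNorm p volume fun z => ‖ψ z‖ₑ) + (nearAvg (heatSize ψ) z + (V' * I' : ℝ≥0) * H)) := by
    refine (hM ψ z S (zero_lt_one.trans_le h1)).trans ?_
    rw [← Ioc_union_Ioc_eq_Ioc zero_le_one h1]
    gcongr
    · exact (lpNorm_ball_le hp hψ (zero_lt_one.trans_le h1) z).trans_eq (by rw [← hV])
    · exact (lintegral_union_le _ _ _).trans (add_le_add
        (lintegral_ballAvg_le_nearAvg (measurable_heatSize ψ) z) (hfar S))
  have hlim : Filter.Tendsto (fun S : ℝ => M * (V' * (ENNReal.ofReal (S ^ (-((N : ℝ) + 2) / p)) *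
      lpNorm p volume fun z => ‖ψ z‖ₑ) + (nearAvg (heatSize ψ) z + (V' * I' : ℝ≥0) * H)))
      Filter.atTop (nhds (M * (V' * (ENNReal.ofReal 0 * lpNorm p volume fun z => ‖ψ z‖ₑ) +
        (nearAvg (heatSize ψ) z + (V' * I' : ℝ≥0) * H)))) := by
    refine ENNReal.Tendsto.const_mul (Filter.Tendsto.add_const _ (ENNReal.Tendsto.const_mul
      (ENNReal.Tendsto.mul_const (ENNReal.tendsto_ofReal ?_) (Or.inr ?_))
      (Or.inr ENNReal.coe_ne_top))) (Or.inr ENNReal.coe_ne_top)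
    · rw [neg_div]
      exact tendsto_rpow_neg_atTop (by positivity)
    · rw [lpNorm_eq_eLpNorm hp₀]
      exact eLpNorm_ne_top p ψ
  have := ge_of_tendsto hlim (Filter.eventually_atTop.2 ⟨1, hS⟩)
  simpa using this

lemma exists_eLpNorm_restrict_le {p : ℝ} (hp : 1 < p) (hp2 : p < ((N : ℝ) + 2) / 2)
    {B : Set (PSpace N)} (hB : volume B ≠ ⊤) : ∃ C : ℝ≥0, ∀ ψ : 𝓢(PSpace N, ℝ),
      eLpNorm ψ (ENNReal.ofReal p) (volume.restrict B) ≤ C * ENNReal.ofReal (topNorm p ψ) := by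
  obtain ⟨M, c, h⟩ := exists_enorm_le_nearAvg hp hp2
  have hp₀ : 0 < p := zero_lt_one.trans hp
  have hP : (1 : ℝ≥0∞) ≤ ENNReal.ofReal p := ENNReal.one_le_ofReal.2 hp.le
  have hBt : volume B ^ (1 / p) ≠ ⊤ := ENNReal.rpow_ne_top_of_nonneg (by positivity) hB
  have hVt : volume (closedBall (0 : PSpace N) 1) ≠ ⊤ := measure_closedBall_lt_top.ne
  refine ⟨M * ((volume (closedBall (0 : PSpace N) 1)).toNNReal +
    c * (volume B ^ (1 / p)).toNNReal) * (N + 1), fun ψ => ?_⟩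
  set H := lpNorm p volume (heatSize ψ) with hH
  calc eLpNorm ψ (ENNReal.ofReal p) (volume.restrict B)
      ≤ M • eLpNorm (fun z => nearAvg (heatSize ψ) z + c * H) (ENNReal.ofReal p)
          (volume.restrict B) :=
        eLpNorm_le_nnreal_smul_eLpNorm_of_ae_le_mul' (.of_forall fun z => h ψ z) _
    _ ≤ M * (eLpNorm (nearAvg (heatSize ψ)) (ENNReal.ofReal p) (volume.restrict B) +
          eLpNorm (fun _ : PSpace N => c * H) (ENNReal.ofReal p) (volume.restrict B)) := by
        rw [ENNReal.smul_def, smul_eq_mul]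
        gcongr
        exact eLpNorm_add_le (measurable_nearAvg (measurable_heatSize ψ)).aestronglyMeasurable
          aestronglyMeasurable_const hP
    _ ≤ M * (volume (closedBall (0 : PSpace N) 1) * H + c * H * volume B ^ (1 / p)) := by
        gcongr
        · refine (eLpNorm_mono_measure _ Measure.restrict_le_self).trans ?_
          exact (lpNorm_eq_eLpNorm hp₀ volume (nearAvg (heatSize ψ))).symm.trans_le
            (lpNorm_nearAvg_le hp (measurable_heatSize ψ))
        · rw [← lpNorm_eq_eLpNorm hp₀, lpNorm]
          simp only [enorm_eq_self, lintegral_const, Measure.restrict_apply_univ]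
          rw [ENNReal.mul_rpow_of_nonneg _ _ (by positivity), ← ENNReal.rpow_mul,
            mul_one_div_cancel hp₀.ne', ENNReal.rpow_one]
    _ = M * (volume (closedBall (0 : PSpace N) 1) + c * volume B ^ (1 / p)) * H := by ring
    _ ≤ M * (volume (closedBall (0 : PSpace N) 1) + c * volume B ^ (1 / p)) *
          ((N + 1 : ℝ≥0) * ENNReal.ofReal (topNorm p ψ)) := by
        gcongr
        exact lpNorm_heatSize_le hp.le ψ
    _ = _ := by
        push_cast
        rw [ENNReal.coe_toNNReal hBt, ENNReal.coe_toNNReal hVt]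
        ring

lemma hasDerivAt_line (ψ : 𝓢(PSpace N, ℝ)) (z e : PSpace N) (σ : ℝ) :
    HasDerivAt (fun σ : ℝ => ψ (z + σ • e)) ((∂_{e} ψ : 𝓢(PSpace N, ℝ)) (z + σ • e)) σ := by
  rw [SchwartzMap.lineDerivOp_apply_eq_fderiv]
  have h : HasDerivAt (fun σ : ℝ => z + σ • e) e σ := by
    simpa using ((hasDerivAt_id σ).smul_const e).const_add z
  exact (ψ.differentiable _).hasFDerivAt.comp_hasDerivAt σ h

lemma lineDeriv_eq_taylor (ψ : 𝓢(PSpace N, ℝ)) (z e : PSpace N) :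
    (∂_{e} ψ : 𝓢(PSpace N, ℝ)) z = ψ (z + e) - ψ z -
      ∫ σ in (0 : ℝ)..1, (1 - σ) * (∂_{e} (∂_{e} ψ) : 𝓢(PSpace N, ℝ)) (z + σ • e) := by
  have hd (σ : ℝ) : HasDerivAt
      (fun σ : ℝ => (1 - σ) * (∂_{e} ψ : 𝓢(PSpace N, ℝ)) (z + σ • e) + ψ (z + σ • e))
      ((1 - σ) * (∂_{e} (∂_{e} ψ) : 𝓢(PSpace N, ℝ)) (z + σ • e)) σ := by
    refine ((((hasDerivAt_id σ).const_sub 1).mul (hasDerivAt_line (∂_{e} ψ) z e σ)).add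
      (hasDerivAt_line ψ z e σ)).congr_deriv ?_
    simp
  have hc : Continuous fun σ : ℝ =>
      (1 - σ) * (∂_{e} (∂_{e} ψ) : 𝓢(PSpace N, ℝ)) (z + σ • e) := by
    have := (∂_{e} (∂_{e} ψ)).continuous
    fun_prop
  rw [intervalIntegral.integral_eq_sub_of_hasDerivAt (fun σ _ => hd σ)
    (hc.intervalIntegrable 0 1)]
  simp

lemma enorm_lineDeriv_le (ψ : 𝓢(PSpace N, ℝ)) (z e : PSpace N) :
    ‖(∂_{e} ψ : 𝓢(PSpace N, ℝ)) z‖ₑ ≤ ‖ψ (z + e)‖ₑ + ‖ψ z‖ₑ +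
      ∫⁻ σ in Ioc (0 : ℝ) 1, ‖(∂_{e} (∂_{e} ψ) : 𝓢(PSpace N, ℝ)) (z + σ • e)‖ₑ := by
  rw [lineDeriv_eq_taylor, intervalIntegral.integral_of_le zero_le_one]
  refine enorm_sub_le.trans (add_le_add enorm_sub_le
    ((enorm_integral_le_lintegral_enorm _).trans ?_))
  refine setLIntegral_mono' measurableSet_Ioc fun σ hσ => ?_
  rw [enorm_mul]
  refine mul_le_of_le_one_left zero_le ?_
  rw [← ofReal_norm, Real.norm_of_nonneg (sub_nonneg.2 hσ.2)]
  exact ENNReal.ofReal_le_one.2 (by linarith [hσ.1])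

lemma exists_eLpNorm_lineDeriv_restrict_le {p : ℝ} (hp : 1 < p) (hp2 : p < ((N : ℝ) + 2) / 2)
    {B : Set (PSpace N)} (hB : volume B ≠ ⊤) :
    ∃ C : ℝ≥0, ∀ (ψ : 𝓢(PSpace N, ℝ)) (i : Fin N),
      eLpNorm (∂_{spaceDir i} ψ : 𝓢(PSpace N, ℝ)) (ENNReal.ofReal p) (volume.restrict B) ≤
        C * ENNReal.ofReal (topNorm p ψ) := by
  have hp₀ : 0 < p := zero_lt_one.trans hp
  have hP : (1 : ℝ≥0∞) ≤ ENNReal.ofReal p := ENNReal.one_le_ofReal.2 hp.le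
  obtain ⟨C₀, h₀⟩ := exists_eLpNorm_restrict_le hp hp2 hB
  have hBi (i : Fin N) : volume ((fun z => z + spaceDir i) '' B) ≠ ⊤ := by
    rwa [image_add_right, measure_preimage_add_right]
  choose C hC using fun i => exists_eLpNorm_restrict_le hp hp2 (hBi i)
  refine ⟨∑ i, C i + C₀ + 1, fun ψ i => ?_⟩
  set e := spaceDir i with he
  have hm (φ : 𝓢(PSpace N, ℝ)) : Measurable fun z => ‖φ z‖ₑ := φ.continuous.measurable.enorm
  set D : PSpace N → ℝ≥0∞ := fun z =>
    ∫⁻ σ in Ioc (0 : ℝ) 1, ‖(∂_{e} (∂_{e} ψ) : 𝓢(PSpace N, ℝ)) (z + σ • e)‖ₑ with hD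
  have hτ : Measurable fun σ : ℝ => σ • e := measurable_id.smul_const e
  have hDm : Measurable D := by
    have h : Measurable fun a : PSpace N × ℝ =>
        ‖(∂_{e} (∂_{e} ψ) : 𝓢(PSpace N, ℝ)) (a.1 + a.2 • e)‖ₑ :=
      (hm _).comp (measurable_fst.add (hτ.comp measurable_snd))
    exact h.lintegral_prod_right'
  have hDle : lpNorm p volume D ≤ ENNReal.ofReal (topNorm p ψ) := by
    have h := lpNorm_lintegral_translate_le (volume.restrict (Ioc (0 : ℝ) 1)) hp
      (hm (∂_{e} (∂_{e} ψ))) hτ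
    rw [Measure.restrict_apply_univ, Real.volume_Ioc, sub_zero, ENNReal.ofReal_one, one_mul,
      lpNorm_eq_eLpNorm hp₀] at h
    exact h.trans (eLpNorm_spaceDir_spaceDir_le p i i ψ)
  have h₁ : eLpNorm (fun z => ψ (z + e)) (ENNReal.ofReal p) (volume.restrict B) ≤
      C i * ENNReal.ofReal (topNorm p ψ) := by
    refine le_trans ?_ (hC i ψ)
    have := (measurePreserving_add_right (volume : Measure (PSpace N)) e).restrict_image_emb
      (measurableEmbedding_addRight e) B
    rw [← eLpNorm_comp_measurePreserving ψ.continuous.aestronglyMeasurable this]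
    rfl
  have hsub : C i ≤ ∑ i, C i := Finset.single_le_sum (fun _ _ => zero_le) (Finset.mem_univ i)
  calc eLpNorm (∂_{e} ψ : 𝓢(PSpace N, ℝ)) (ENNReal.ofReal p) (volume.restrict B)
      ≤ eLpNorm ((fun z => ‖ψ (z + e)‖ₑ) + (fun z => ‖ψ z‖ₑ) + D) (ENNReal.ofReal p)
          (volume.restrict B) :=
        eLpNorm_mono_enorm fun z => enorm_lineDeriv_le ψ z e
    _ ≤ eLpNorm (fun z => ‖ψ (z + e)‖ₑ) (ENNReal.ofReal p) (volume.restrict B) +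
          eLpNorm (fun z => ‖ψ z‖ₑ) (ENNReal.ofReal p) (volume.restrict B) +
          eLpNorm D (ENNReal.ofReal p) (volume.restrict B) := by
        have h₂ : Measurable fun z => ‖ψ (z + e)‖ₑ := (hm ψ).comp (measurable_add_const e)
        refine (eLpNorm_add_le (h₂.add (hm ψ)).aestronglyMeasurable
          hDm.aestronglyMeasurable hP).trans ?_
        gcongr
        exact eLpNorm_add_le h₂.aestronglyMeasurable (hm ψ).aestronglyMeasurable hP
    _ ≤ C i * ENNReal.ofReal (topNorm p ψ) + C₀ * ENNReal.ofReal (topNorm p ψ) +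
          1 * ENNReal.ofReal (topNorm p ψ) := by
        gcongr
        · exact h₁
        · exact h₀ ψ
        · rw [one_mul]
          refine (eLpNorm_mono_measure _ Measure.restrict_le_self).trans ?_
          exact (lpNorm_eq_eLpNorm hp₀ volume D).symm.trans_le hDle
    _ = (C i + C₀ + 1 : ℝ≥0) * ENNReal.ofReal (topNorm p ψ) := by
        push_cast
        ring
    _ ≤ _ := by
        gcongr

/-- The product of two Schwartz functions. -/
def mulS (χ ψ : 𝓢(PSpace N, ℝ)) : 𝓢(PSpace N, ℝ) :=
  SchwartzMap.pairing (ContinuousLinearMap.mul ℝ ℝ) χ ψ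

lemma mulS_apply (χ ψ : 𝓢(PSpace N, ℝ)) (z : PSpace N) : mulS χ ψ z = χ z * ψ z := rfl

lemma lineDeriv_mulS (v : PSpace N) (χ ψ : 𝓢(PSpace N, ℝ)) :
    ∂_{v} (mulS χ ψ) = mulS χ (∂_{v} ψ) + mulS (∂_{v} χ) ψ := by
  ext z
  rw [add_apply, mulS_apply, mulS_apply, SchwartzMap.lineDerivOp_apply_eq_fderiv,
    SchwartzMap.lineDerivOp_apply_eq_fderiv, SchwartzMap.lineDerivOp_apply_eq_fderiv,
    show ⇑(mulS χ ψ) = fun z => χ z * ψ z from rfl,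
    fderiv_fun_mul χ.differentiableAt ψ.differentiableAt]
  simp [mul_comm]

lemma lineDeriv_eq_zero_of_notMem {B : Set (PSpace N)} (hB : IsClosed B) {χ : 𝓢(PSpace N, ℝ)}
    (h : ∀ z ∉ B, χ z = 0) (v : PSpace N) : ∀ z ∉ B, (∂_{v} χ : 𝓢(PSpace N, ℝ)) z = 0 := by
  intro z hz
  have h₀ : (χ : PSpace N → ℝ) =ᶠ[nhds z] fun _ => 0 :=
    Filter.eventually_of_mem (hB.isOpen_compl.mem_nhds hz) h
  rw [SchwartzMap.lineDerivOp_apply_eq_fderiv, h₀.fderiv_eq]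
  simp

/-- The operator `L` is bounded from the homogeneous second order norm to `L^p`. -/
def Controlled (p : ℝ) (L : 𝓢(PSpace N, ℝ) → 𝓢(PSpace N, ℝ)) : Prop :=
  ∃ C : ℝ≥0, ∀ ψ, eLpNorm (L ψ) (ENNReal.ofReal p) volume ≤ C * ENNReal.ofReal (topNorm p ψ)

lemma Controlled.add {p : ℝ} (hp : 1 ≤ p) {L L' : 𝓢(PSpace N, ℝ) → 𝓢(PSpace N, ℝ)}
    (h : Controlled p L) (h' : Controlled p L') : Controlled p fun ψ => L ψ + L' ψ := by
  obtain ⟨C, hC⟩ := h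
  obtain ⟨C', hC'⟩ := h'
  refine ⟨C + C', fun ψ => ?_⟩
  rw [ENNReal.coe_add, add_mul]
  exact (eLpNorm_add_le (L ψ).continuous.aestronglyMeasurable
    (L' ψ).continuous.aestronglyMeasurable (ENNReal.one_le_ofReal.2 hp)).trans
    (add_le_add (hC ψ) (hC' ψ))

lemma Controlled.mulS {p : ℝ} {B : Set (PSpace N)} (hB : MeasurableSet B) {η : 𝓢(PSpace N, ℝ)}
    (hη : ∀ z ∉ B, η z = 0) {L : 𝓢(PSpace N, ℝ) → 𝓢(PSpace N, ℝ)}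
    (h : ∃ C : ℝ≥0, ∀ ψ, eLpNorm (L ψ) (ENNReal.ofReal p) (volume.restrict B) ≤
      C * ENNReal.ofReal (topNorm p ψ)) : Controlled p fun ψ => mulS η (L ψ) := by
  obtain ⟨C, hC⟩ := h
  obtain ⟨A, -, hA⟩ := η.decay 0 0
  refine ⟨A.toNNReal * C, fun ψ => ?_⟩
  have h₁ (z : PSpace N) : ‖ParabolicCapacity.mulS η (L ψ) z‖ₑ ≤
      (A.toNNReal : ℝ≥0∞) * ‖B.indicator (L ψ) z‖ₑ := by
    by_cases hz : z ∈ B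
    · rw [indicator_of_mem hz, mulS_apply, enorm_mul]
      gcongr
      rw [← ofReal_norm]
      exact ENNReal.ofReal_le_ofReal (by simpa using hA z)
    · rw [mulS_apply, hη z hz, zero_mul, enorm_zero]
      exact zero_le
  refine (eLpNorm_le_nnreal_smul_eLpNorm_of_ae_le_mul' (.of_forall h₁) _).trans ?_
  rw [eLpNorm_indicator_eq_eLpNorm_restrict hB, ENNReal.smul_def, smul_eq_mul, ENNReal.coe_mul,
    mul_assoc]
  gcongr
  exact hC ψ

lemma gradNorm_le (φ : 𝓢(PSpace N, ℝ)) (z : PSpace N) :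
    gradNorm φ z ≤ ∑ i : Fin N, ‖(∂_{spaceDir i} φ : 𝓢(PSpace N, ℝ)) z‖ := by
  rw [gradNorm, Real.sqrt_le_iff]
  refine ⟨by positivity, ?_⟩
  simp only [xDeriv_eq]
  refine le_of_eq_of_le (Finset.sum_congr rfl fun i _ => (sq_abs _).symm)
    (Finset.sum_sq_le_sq_sum_of_nonneg fun i _ => abs_nonneg _)

lemma eLpNorm_gradNorm_le {p : ℝ} (hp : 1 ≤ p) (φ : 𝓢(PSpace N, ℝ)) :
    eLpNorm (gradNorm φ) (ENNReal.ofReal p) volume ≤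
      ∑ i : Fin N, eLpNorm (∂_{spaceDir i} φ : 𝓢(PSpace N, ℝ)) (ENNReal.ofReal p) volume := by
  calc eLpNorm (gradNorm φ) (ENNReal.ofReal p) volume
      ≤ eLpNorm (∑ i : Fin N, fun z => ‖(∂_{spaceDir i} φ : 𝓢(PSpace N, ℝ)) z‖)
          (ENNReal.ofReal p) volume := by
        refine eLpNorm_mono_real fun z => ?_
        rw [show ‖gradNorm φ z‖ = gradNorm φ z from Real.norm_of_nonneg (Real.sqrt_nonneg _),
          Finset.sum_apply]
        exact gradNorm_le φ z
    _ ≤ ∑ i : Fin N, eLpNorm (fun z => ‖(∂_{spaceDir i} φ : 𝓢(PSpace N, ℝ)) z‖)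
          (ENNReal.ofReal p) volume :=
        eLpNorm_sum_le (fun i _ => (∂_{spaceDir i} φ).continuous.norm.aestronglyMeasurable)
          (ENNReal.one_le_ofReal.2 hp)
    _ = _ := by simp only [eLpNorm_norm]

lemma Controlled.toReal_le {p : ℝ} {C : ℝ≥0} {ψ : 𝓢(PSpace N, ℝ)} {a : ℝ≥0∞}
    (h : a ≤ C * ENNReal.ofReal (topNorm p ψ)) : a.toReal ≤ C * topNorm p ψ := by
  refine (ENNReal.toReal_mono (by finiteness) h).trans_eq ?_
  rw [ENNReal.toReal_mul, ENNReal.toReal_ofReal (topNorm_nonneg p ψ)]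
  rfl

lemma exists_W21Norm_mulS_le {p : ℝ} (hp : 1 < p) (hp2 : p < ((N : ℝ) + 2) / 2)
    {χ : 𝓢(PSpace N, ℝ)} {R : ℝ} (hχ : ∀ z ∉ closedBall 0 R, χ z = 0) :
    ∃ C : ℝ≥0, ∀ ψ, W21Norm N p (mulS χ ψ) ≤ C * topNorm p ψ := by
  set B := closedBall (0 : PSpace N) R
  have hBc : IsClosed B := isClosed_closedBall
  have hBt : volume B ≠ ⊤ := measure_closedBall_lt_top.ne
  have h₀ {η : 𝓢(PSpace N, ℝ)} (hη : ∀ z ∉ B, η z = 0) : Controlled p fun ψ => mulS η ψ :=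
    Controlled.mulS hBc.measurableSet hη (exists_eLpNorm_restrict_le hp hp2 hBt)
  have h₁ {η : 𝓢(PSpace N, ℝ)} (hη : ∀ z ∉ B, η z = 0) (i : Fin N) :
      Controlled p fun ψ => mulS η (∂_{spaceDir i} ψ) := by
    obtain ⟨C, hC⟩ := exists_eLpNorm_lineDeriv_restrict_le hp hp2 hBt
    exact Controlled.mulS hBc.measurableSet hη ⟨C, fun ψ => hC ψ i⟩
  have h₂ (i j : Fin N) : Controlled p fun ψ => mulS χ (∂_{spaceDir i} (∂_{spaceDir j} ψ)) :=
    Controlled.mulS hBc.measurableSet hχ ⟨1, fun ψ => by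
      rw [ENNReal.coe_one, one_mul]
      exact (eLpNorm_mono_measure _ Measure.restrict_le_self).trans
        (eLpNorm_spaceDir_spaceDir_le p i j ψ)⟩
  have h₃ : Controlled p fun ψ => mulS χ (∂_{timeDir N} ψ) :=
    Controlled.mulS hBc.measurableSet hχ ⟨1, fun ψ => by
      rw [ENNReal.coe_one, one_mul]
      exact (eLpNorm_mono_measure _ Measure.restrict_le_self).trans (eLpNorm_timeDir_le p ψ)⟩
  have hd (v : PSpace N) := lineDeriv_eq_zero_of_notMem hBc hχ v
  have hdd (v w : PSpace N) := lineDeriv_eq_zero_of_notMem hBc (hd w) v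
  have ht : Controlled p fun ψ => ∂_{timeDir N} (mulS χ ψ) := by
    simp only [lineDeriv_mulS]
    exact h₃.add hp.le (h₀ (hd _))
  have hx (i : Fin N) : Controlled p fun ψ => ∂_{spaceDir i} (mulS χ ψ) := by
    simp only [lineDeriv_mulS]
    exact (h₁ hχ i).add hp.le (h₀ (hd _))
  have hxx (i j : Fin N) : Controlled p fun ψ => ∂_{spaceDir i} (∂_{spaceDir j} (mulS χ ψ)) := by
    simp only [lineDeriv_mulS, LineDeriv.lineDerivOp_add]
    exact ((h₂ i j).add hp.le (h₁ (hd _) j)).add hp.le ((h₁ (hd _) i).add hp.le (h₀ (hdd _ _)))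
  obtain ⟨C₀, hC₀⟩ := h₀ hχ
  obtain ⟨Ct, hCt⟩ := ht
  choose Cx hCx using hx
  choose Cxx hCxx using hxx
  refine ⟨C₀ + ∑ i, Cx i + (Ct + ∑ i, ∑ j, Cxx i j), fun ψ => ?_⟩
  have hgrad : eLpNorm (gradNorm (mulS χ ψ)) (ENNReal.ofReal p) volume ≤
      (∑ i, Cx i : ℝ≥0) * ENNReal.ofReal (topNorm p ψ) := by
    refine (eLpNorm_gradNorm_le hp.le _).trans ?_
    push_cast
    rw [Finset.sum_mul]
    exact Finset.sum_le_sum fun i _ => hCx i ψ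
  rw [W21Norm_eq, topNorm]
  push_cast
  simp only [add_mul, Finset.sum_mul]
  gcongr
  · exact Controlled.toReal_le (hC₀ ψ)
  · simpa [Finset.sum_mul] using Controlled.toReal_le hgrad
  · exact Controlled.toReal_le (hCt ψ)
  · exact Controlled.toReal_le (hCxx _ _ ψ)

lemma closure_pQt_subset (N : ℕ) : closure (pQt N 100 0) ⊆ closedBall 0 10000 := by
  refine closure_minimal ?_ isClosed_closedBall
  rintro ⟨x, t⟩ ⟨hx, ht⟩
  simp only [Prod.fst_zero, Prod.snd_zero, mem_ball_zero_iff, mem_Ioo] at hx ht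
  rw [mem_closedBall_zero_iff, Prod.norm_mk, max_le_iff, Real.norm_eq_abs, abs_le]
  refine ⟨?_, ?_, ?_⟩ <;> linarith

/-- A smooth cutoff function equal to `1` near the cylinder `Q̃_{100}(0)`. -/
lemma exists_cutoff (N : ℕ) : ∃ χ : 𝓢(PSpace N, ℝ),
    (∀ z ∉ closedBall (0 : PSpace N) 10002, χ z = 0) ∧ ∀ z ∈ ball (0 : PSpace N) 10001, χ z = 1 := by
  let f : ContDiffBump (0 : PSpace N) := ⟨10001, 10002, by norm_num, by norm_num⟩
  refine ⟨f.hasCompactSupport.toSchwartzMap f.contDiff, fun z hz => ?_, fun z hz => ?_⟩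
  · exact f.zero_of_le_dist (not_le.1 hz).le
  · exact f.one_of_mem_closedBall (ball_subset_closedBall hz)

lemma Admissible.mulS {K V : Set (PSpace N)} {χ ψ : 𝓢(PSpace N, ℝ)} (h : Admissible K ψ)
    (hV : IsOpen V) (hKV : K ⊆ V) (hχ : ∀ z ∈ V, χ z = 1) : Admissible K (mulS χ ψ) := by
  obtain ⟨U, hU, hKU, h1⟩ := h
  refine ⟨U ∩ V, hU.inter hV, subset_inter hKU hKV, fun z hz => ?_⟩
  rw [mulS_apply, hχ z hz.2, one_mul]
  exact h1 z hz.1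

lemma cap21c_nonneg (p : ℝ) (K : Set (PSpace N)) : 0 ≤ cap21c N p K :=
  Real.sInf_nonneg (by rintro _ ⟨φ, -, rfl⟩; exact Real.rpow_nonneg (W21Norm_nonneg p φ) p)

lemma dilation_factor_rpow {p : ℝ} (hp : 0 < p) {ρ : ℝ} (hρ : 0 < ρ) (a : ℝ) :
    (ρ ^ 2 * ρ ^ (-a / p)) ^ p = (ρ ^ (a - 2 * p))⁻¹ := by
  rw [← Real.rpow_natCast, ← Real.rpow_add hρ, ← Real.rpow_mul hρ.le, ← Real.rpow_neg hρ.le]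
  congr 1
  field_simp
  push_cast
  ring

lemma mapsTo_pdil_inv {ρ : ℝ} (hρ : ρ ≠ 0) (K : Set (PSpace N)) :
    MapsTo (pdil N ρ⁻¹) (pdil N ρ '' K) K := by
  rintro _ ⟨z, hz, rfl⟩
  convert hz
  exact (pdilEquiv N hρ).symm_apply_apply z

lemma exists_admissible {K : Set (PSpace N)} (hK : K ⊆ closure (pQt N 100 0)) :
    ∃ φ : 𝓢(PSpace N, ℝ), Admissible K φ := by
  obtain ⟨χ, -, hχ⟩ := exists_cutoff N
  exact ⟨χ, _, isOpen_ball, hK.trans ((closure_pQt_subset N).trans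
    (closedBall_subset_ball (by norm_num))), fun z hz => (hχ z hz).ge⟩

lemma cap21c_image_pdil_le {p : ℝ} (hp : 0 < p) {K : Set (PSpace N)}
    (hK : ∃ φ : 𝓢(PSpace N, ℝ), Admissible K φ) {ρ : ℝ} (hρ : 0 < ρ) (hρ1 : ρ ≤ 1) :
    cap21c N p (pdil N ρ '' K) ≤ ρ ^ ((N : ℝ) + 2 - 2 * p) * cap21c N p K := by
  have h1 : 1 ≤ ρ⁻¹ := (one_le_inv₀ hρ).2 hρ1
  have h := cap21c_le_mul hp (A := ρ⁻¹ ^ 2 * ρ⁻¹ ^ (-((N : ℝ) + 2) / p)) (by positivity) hK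
    fun φ hφ => ⟨_, hφ.dilate _ (mapsTo_pdil_inv hρ.ne' K), W21Norm_dilate_le hp h1 φ⟩
  rwa [dilation_factor_rpow hp (by positivity), Real.inv_rpow hρ.le, inv_inv] at h

lemma exists_cap21c_le_image_pdil {p : ℝ} (hp : 1 < p) (hp2 : p < ((N : ℝ) + 2) / 2) :
    ∃ C : ℝ, 1 ≤ C ∧ ∀ K ⊆ closure (pQt N 100 0), ∀ ρ : ℝ, 0 < ρ →
      cap21c N p K ≤ C * (ρ ^ ((N : ℝ) + 2 - 2 * p))⁻¹ * cap21c N p (pdil N ρ '' K) := by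
  have hp₀ : 0 < p := zero_lt_one.trans hp
  obtain ⟨χ, hχ₀, hχ₁⟩ := exists_cutoff N
  obtain ⟨C, hC⟩ := exists_W21Norm_mulS_le hp hp2 hχ₀
  have hC1 : (1 : ℝ) ≤ C + 1 := le_add_of_nonneg_left C.2
  refine ⟨((C : ℝ) + 1) ^ p, Real.one_le_rpow hC1 hp₀.le, fun K hK ρ hρ => ?_⟩
  have hKV : K ⊆ ball (0 : PSpace N) 10001 :=
    hK.trans ((closure_pQt_subset N).trans (closedBall_subset_ball (by norm_num)))
  obtain ⟨φ₀, hφ₀⟩ := exists_admissible hK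
  have h := cap21c_le_mul (K := K) hp₀
    (A := ((C : ℝ) + 1) * (ρ ^ 2 * ρ ^ (-((N : ℝ) + 2) / p))) (by positivity)
    ⟨_, hφ₀.dilate (inv_ne_zero hρ.ne') (mapsTo_pdil_inv hρ.ne' K)⟩ fun φ hφ =>
      ⟨_, (hφ.dilate hρ.ne' (mapsTo_image _ K)).mulS isOpen_ball hKV hχ₁, by
        refine (hC _).trans ?_
        rw [topNorm_dilate hp₀ hρ, ← mul_assoc]
        gcongr
        · exact topNorm_nonneg p φ
        · exact le_add_of_nonneg_right zero_le_one
        · exact topNorm_le_W21Norm p φ⟩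
  rwa [Real.mul_rpow (by positivity) (by positivity), dilation_factor_rpow hp₀ hρ] at h

end ParabolicCapacity

end

/-- Scaling property (2.3) of the capacity: for `1 < p < (N+2)/2`, compact
`K ⊆ closure Q̃_{100}(0,0)` and `0 < ρ < 1`,
`Cap_{2,1,p}(K_ρ) ≍ ρ^{N+2-2p} Cap_{2,1,p}(K)` where `K_ρ = {(ρx, ρ²t) : (x,t) ∈ K}`. -/
theorem cap21_scaling
    (N : ℕ) (hN : 2 ≤ N) (p : ℝ) (hp : 1 < p) (hp2 : p < ((N : ℝ) + 2) / 2) :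
    ∃ C : ℝ, 1 ≤ C ∧ ∀ K : Set (PSpace N), K ⊆ closure (pQt N 100 0) → IsCompact K →
      ∀ ρ : ℝ, 0 < ρ → ρ < 1 →
        C⁻¹ * (ρ ^ ((N : ℝ) + 2 - 2 * p) * cap21c N p K) ≤
          cap21c N p ((fun z : PSpace N => (ρ • z.1, ρ ^ 2 * z.2)) '' K) ∧
        cap21c N p ((fun z : PSpace N => (ρ • z.1, ρ ^ 2 * z.2)) '' K) ≤
          C * (ρ ^ ((N : ℝ) + 2 - 2 * p) * cap21c N p K) := by
  obtain ⟨C, hC1, hC⟩ := ParabolicCapacity.exists_cap21c_le_image_pdil hp hp2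
  refine ⟨C, hC1, fun K hK _ ρ hρ hρ1 => ?_⟩
  have hcap := ParabolicCapacity.cap21c_nonneg p K
  have hlow := hC K hK ρ hρ
  have hup := ParabolicCapacity.cap21c_image_pdil_le (zero_lt_one.trans hp)
    (ParabolicCapacity.exists_admissible hK) hρ hρ1.le
  have hρe : 0 < ρ ^ ((N : ℝ) + 2 - 2 * p) := Real.rpow_pos_of_pos hρ _
  constructor
  · rw [inv_mul_le_iff₀ (zero_lt_one.trans_le hC1), ← le_inv_mul_iff₀ hρe]
    exact hlow.trans_eq (by
      simp only [mul_assoc, mul_left_comm]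
      rfl)
  · exact hup.trans (le_mul_of_one_le_left (by positivity) hC1)
end
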